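/- Let D ⊂ ℂⁿ be a bounded α-regular domain, K ⊂ D a compact set, and ψ a bounded function on K with sup_K ψ < 0 that admits a negative α-subharmonic extension to D. Then the function z ↦ ω_α(z,K,D,ψ) is continuous on D if and only if ψ is continuous on K and K is an (α,ψ)-regular compact set. -/

import Mathlib

open MeasureTheory Filter Topology Complex Metric

noncomputable section

/-- Complex `n`-space. -/
abbrev Cn (n : ℕ) := Fin n → ℂ

/-- The Wirtinger derivative `∂f/∂z_j` of a (real-differentiable) function `f : ℂⁿ → ℂ`. -/
noncomputable def wdz {n : ℕ} (j : Fin n) (f : Cn n → ℂ) (z : Cn n) : ℂ :=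
  (fderiv ℝ f z (Pi.single j 1) - Complex.I * fderiv ℝ f z (Pi.single j Complex.I)) / 2

/-- The Wirtinger derivative `∂f/∂z̄_j` of a (real-differentiable) function `f : ℂⁿ → ℂ`. -/
noncomputable def wdzbar {n : ℕ} (j : Fin n) (f : Cn n → ℂ) (z : Cn n) : ℂ :=
  (fderiv ℝ f z (Pi.single j 1) + Complex.I * fderiv ℝ f z (Pi.single j Complex.I)) / 2

/-- The square of the Euclidean norm `|z|² = ∑ |z_i|²` on `ℂⁿ`. -/
noncomputable def sqNorm {n : ℕ} (z : Cn n) : ℝ := ∑ i, Complex.normSq (z i)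

/-- A closed, strictly positive differential form `α` of bidegree `(n-1, n-1)` with `C¹`
coefficients on `ℂⁿ`, recorded through its normalized coefficient matrix:  `coeff j k` is
the Hermitian positive-definite matrix `A_{jk}` such that
`dd^c u ∧ α = (∑_{j,k} A_{jk} ∂²u/∂z_j∂z̄_k) dV`.  In these terms closedness of `α`
reads `∑_j ∂A_{jk}/∂z_j = 0` for every `k` (the conjugate identity follows by
Hermitian symmetry). -/
structure AlphaForm (n : ℕ) where
  coeff : Fin n → Fin n → Cn n → ℂ
  contDiff : ∀ j k, ContDiff ℝ 1 (coeff j k)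
  hermitian : ∀ j k z, coeff k j z = starRingEnd ℂ (coeff j k z)
  strictlyPositive : ∀ z : Cn n, ∀ ξ : Fin n → ℂ, ξ ≠ 0 →
    0 < (∑ j, ∑ k, coeff j k z * ξ j * starRingEnd ℂ (ξ k)).re
  closed : ∀ k, ∀ z : Cn n, (∑ j, wdz j (coeff j k) z) = 0

/-- The second order operator `f ↦ ∑_{j,k} A_{jk} ∂²f/∂z_j∂z̄_k` representing the
top-degree form `dd^c f ∧ α` (with respect to Lebesgue measure). -/
noncomputable def alphaOp {n : ℕ} (A : AlphaForm n) (f : Cn n → ℂ) (z : Cn n) : ℂ :=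
  ∑ j, ∑ k, A.coeff j k z * wdzbar k (wdz j f) z

/-- The operator `alphaOp` applied to a real-valued function, returning the real part. -/
noncomputable def alphaOpR {n : ℕ} (A : AlphaForm n) (ω : Cn n → ℝ) (z : Cn n) : ℝ :=
  (alphaOp A (fun w => (ω w : ℂ)) z).re

/-- `u : ℂⁿ → EReal` is `α`-subharmonic on `D`: it is finite-or-`-∞`, strongly upper
semicontinuous on `D`, locally integrable on `D`, and the current `dd^c u ∧ α` is
positive, i.e. `∫_D u · (α ∧ dd^c ω) ≥ 0` for every nonnegative test function `ω` on `D`. -/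
def IsAlphaSubharmonicE {n : ℕ} (A : AlphaForm n) (D : Set (Cn n)) (u : Cn n → EReal) : Prop :=
  (∀ z ∈ D, u z ≠ ⊤) ∧
  UpperSemicontinuousOn u D ∧
  (∀ z₀ ∈ D, ∀ S : Set (Cn n),
      (∃ N ∈ 𝓝 z₀, volume (N \ S) = 0) → Filter.limsup u (𝓝[S] z₀) = u z₀) ∧
  LocallyIntegrableOn (fun z => (u z).toReal) D volume ∧
  ∀ ω : Cn n → ℝ, ContDiff ℝ (⊤ : ℕ∞) ω → HasCompactSupport ω → tsupport ω ⊆ D →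
    (∀ z, 0 ≤ ω z) → 0 ≤ ∫ z in D, (u z).toReal * alphaOpR A ω z

/-- A real-valued function is `α`-subharmonic on `D` if it is so as an `EReal`-valued
function. -/
def IsAlphaSubharmonic {n : ℕ} (A : AlphaForm n) (D : Set (Cn n)) (u : Cn n → ℝ) : Prop :=
  IsAlphaSubharmonicE A D (fun z => (u z : EReal))

/-- `h` is `α`-harmonic on the open set `U`: `dd^c h ∧ α = 0` there, in the sense of
currents. -/
def IsAlphaHarmonicOn {n : ℕ} (A : AlphaForm n) (U : Set (Cn n)) (h : Cn n → ℝ) : Prop :=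
  LocallyIntegrableOn h U volume ∧
  ∀ ω : Cn n → ℝ, ContDiff ℝ (⊤ : ℕ∞) ω → HasCompactSupport ω → tsupport ω ⊆ U →
    (∫ z in U, h z * alphaOpR A ω z) = 0

/-- `u` is strictly `α`-subharmonic on `G`: for every compact subdomain `G' ⋐ G` there is
`ε > 0` with `u - ε|z|²` `α`-subharmonic on `G'`. -/
def IsStrictlyAlphaSubharmonic {n : ℕ} (A : AlphaForm n) (G : Set (Cn n)) (u : Cn n → ℝ) :
    Prop :=
  ∀ G' : Set (Cn n), IsOpen G' → IsCompact (closure G') → closure G' ⊆ G →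
    ∃ ε > (0 : ℝ), IsAlphaSubharmonic A G' (fun z => u z - ε * sqNorm z)

/-- `D` is a bounded `α`-regular domain: a bounded domain carrying a negative
`α`-subharmonic exhaustion `ρ` with boundary limit `0`. -/
def IsAlphaRegularDomain {n : ℕ} (A : AlphaForm n) (D : Set (Cn n)) : Prop :=
  IsOpen D ∧ IsConnected D ∧ Bornology.IsBounded D ∧
  ∃ ρ : Cn n → ℝ, IsAlphaSubharmonic A D ρ ∧ (∀ z ∈ D, ρ z < 0) ∧
    ∀ ζ ∈ frontier D, Filter.Tendsto ρ (𝓝[D] ζ) (𝓝 0)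

/-- `D` is a strongly `α`-regular domain: `D = {ρ < 0}` for some `ρ` which is `C²` and
strictly `α`-subharmonic on a neighborhood `D⁺` of `closure D`. -/
def IsStronglyAlphaRegularDomain {n : ℕ} (A : AlphaForm n) (D : Set (Cn n)) : Prop :=
  IsOpen D ∧ IsConnected D ∧ Bornology.IsBounded D ∧
  ∃ Dp : Set (Cn n), IsOpen Dp ∧ closure D ⊆ Dp ∧
    ∃ ρ : Cn n → ℝ, ContDiffOn ℝ 2 ρ Dp ∧ IsStrictlyAlphaSubharmonic A Dp ρ ∧
      D = {z ∈ Dp | ρ z < 0}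

/-- The class `U(E, D, ψ)` of `α`-subharmonic functions `u` on `D` with `u ≤ ψ` on `E`
and `u < 0` on `D`. -/
def Uclass {n : ℕ} (A : AlphaForm n) (E D : Set (Cn n)) (ψ : Cn n → ℝ) :
    Set (Cn n → ℝ) :=
  {u | IsAlphaSubharmonic A D u ∧ (∀ z ∈ E, u z ≤ ψ z) ∧ ∀ z ∈ D, u z < 0}

/-- The weighted extremal function `ω_α(z, E, D, ψ)`. -/
noncomputable def omegaW {n : ℕ} (A : AlphaForm n) (E D : Set (Cn n)) (ψ : Cn n → ℝ)
    (z : Cn n) : ℝ :=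
  sSup ((fun u : Cn n → ℝ => u z) '' Uclass A E D ψ)

/-- The weighted `α`-subharmonic measure `ω*_α(z, E, D, ψ)`: the upper semicontinuous
regularization of `ω_α(·, E, D, ψ)`. -/
noncomputable def omegaWStar {n : ℕ} (A : AlphaForm n) (E D : Set (Cn n)) (ψ : Cn n → ℝ)
    (z : Cn n) : ℝ :=
  Filter.limsup (omegaW A E D ψ) (𝓝 z)

/-- The (unweighted) extremal function `ω_α(z, E, D)`. -/
noncomputable def omega0 {n : ℕ} (A : AlphaForm n) (E D : Set (Cn n)) : Cn n → ℝ :=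
  omegaW A E D (fun _ => (-1 : ℝ))

/-- The (unweighted) `α`-subharmonic measure `ω*_α(z, E, D)`. -/
noncomputable def omega0Star {n : ℕ} (A : AlphaForm n) (E D : Set (Cn n)) : Cn n → ℝ :=
  omegaWStar A E D (fun _ => (-1 : ℝ))

/-- `S` is `α`-polar in `D`: there is an `α`-subharmonic `ρ` on `D`, not identically
`-∞`, with `ρ = -∞` on `S`. -/
def IsAlphaPolar {n : ℕ} (A : AlphaForm n) (D S : Set (Cn n)) : Prop :=
  ∃ ρ : Cn n → EReal, IsAlphaSubharmonicE A D ρ ∧ (∃ z ∈ D, ρ z ≠ ⊥) ∧ ∀ z ∈ S, ρ z = ⊥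

/-- `u` is plurisubharmonic on `D`: upper semicontinuous, locally integrable, and with
positive semidefinite complex Hessian in the sense of distributions. -/
def IsPlurisubharmonic {n : ℕ} (D : Set (Cn n)) (u : Cn n → ℝ) : Prop :=
  UpperSemicontinuousOn u D ∧ LocallyIntegrableOn u D volume ∧
  ∀ ξ : Fin n → ℂ, ∀ ω : Cn n → ℝ, ContDiff ℝ (⊤ : ℕ∞) ω → HasCompactSupport ω →
    tsupport ω ⊆ D → (∀ z, 0 ≤ ω z) →
    0 ≤ ∫ z in D, u z *
      (∑ j, ∑ k, ξ j * starRingEnd ℂ (ξ k) * wdzbar k (wdz j (fun w => (ω w : ℂ))) z).re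

/-- The class `U(E,D)` for the plurisubharmonic measure. -/
def UclassPsh {n : ℕ} (E D : Set (Cn n)) : Set (Cn n → ℝ) :=
  {u | IsPlurisubharmonic D u ∧ (∀ z ∈ E, u z ≤ -1) ∧ ∀ z ∈ D, u z < 0}

/-- The plurisubharmonic extremal function `ω(z, E, D)`. -/
noncomputable def omegaPsh {n : ℕ} (E D : Set (Cn n)) (z : Cn n) : ℝ :=
  sSup ((fun u : Cn n → ℝ => u z) '' UclassPsh E D)

/-- The plurisubharmonic measure `ω*(z, E, D)`. -/
noncomputable def omegaPshStar {n : ℕ} (E D : Set (Cn n)) (z : Cn n) : ℝ :=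
  Filter.limsup (omegaPsh E D) (𝓝 z)

end

section Part1
set_option linter.unusedSectionVars false

section OpTheory

variable {E : Type*} [NormedAddCommGroup E] [NormedSpace ℝ E] [FiniteDimensional ℝ E]
  [MeasureSpace E] [BorelSpace E] [(volume : Measure E).IsAddHaarMeasure]

/-- the base measure on `(0,∞) × E`. -/
noncomputable def nu0 (E : Type*) [MeasureSpace E] : Measure (ℝ × E) :=
  ((volume : Measure ℝ).restrict (Set.Ioi 0)).prod (volume : Measure E)

/-- kernels dominated by a translation invariant function -/
structure DomK (Φ : ℝ × E → ℝ) (k : ℝ → E → E → ℝ) : Prop where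
  meas : Measurable (fun p : ℝ × E × E => k p.1 p.2.1 p.2.2)
  cont : ∀ t > 0, Continuous (fun p : E × E => k t p.1 p.2)
  dom : ∀ t > 0, ∀ x y, |k t x y| ≤ Φ (t, x - y)

/-- admissible dominating functions -/
structure GoodPhi (Φ : ℝ × E → ℝ) : Prop where
  int : Integrable Φ (nu0 E)
  even : ∀ t ξ, Φ (t, -ξ) = Φ (t, ξ)

noncomputable def Op (k : ℝ → E → E → ℝ) (h : E → ℝ) (x : E) : ℝ :=
  ∫ p, k p.1 x p.2 * h p.2 ∂(nu0 E)

theorem DomK.swap {Φ : ℝ × E → ℝ} (hΦ : GoodPhi Φ) {k : ℝ → E → E → ℝ} (hk : DomK Φ k) :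
    DomK Φ (fun t x y => k t y x) where
  meas := hk.meas.comp (by fun_prop : Measurable (fun p : ℝ × E × E => (p.1, p.2.2, p.2.1)))
  cont := fun t ht => (hk.cont t ht).comp (by fun_prop : Continuous (fun p : E × E => (p.2, p.1)))
  dom := fun t ht x y => by
    have := hk.dom t ht y x
    rwa [← neg_sub, hΦ.even] at this

theorem cocompact_cg : (cocompact E).IsCountablyGenerated := by
  haveI : ProperSpace E := FiniteDimensional.proper ℝ E
  rw [← Metric.cobounded_eq_cocompact, ← comap_norm_atTop]
  infer_instance

theorem nu0_ae_pos : ∀ᵐ p ∂(nu0 E), 0 < p.1 := by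
  have : nu0 E = (volume : Measure (ℝ × E)).restrict (Set.Ioi 0 ×ˢ Set.univ) := by
    rw [nu0, Measure.volume_eq_prod, ← Measure.prod_restrict, Measure.restrict_univ]
  rw [this]
  filter_upwards [ae_restrict_mem (measurableSet_Ioi.prod MeasurableSet.univ)] with p hp
  exact hp.1

instance : SFinite (nu0 E) := by unfold nu0; infer_instance

theorem nu0_mp (x : E) : MeasurePreserving (fun p : ℝ × E => (p.1, x - p.2)) (nu0 E) (nu0 E) := by
  unfold nu0
  exact (MeasurePreserving.id _).prod (Measure.measurePreserving_sub_left volume x)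

theorem nu0_integral_comp (x : E) (F : ℝ × E → ℝ) :
    ∫ p, F (p.1, x - p.2) ∂(nu0 E) = ∫ p, F p ∂(nu0 E) := by
  have he : MeasurableEmbedding (fun p : ℝ × E => (p.1, x - p.2)) :=
    ((MeasurableEquiv.refl ℝ).prodCongr (MeasurableEquiv.subLeft x)).measurableEmbedding
  exact (nu0_mp x).integral_comp he F

theorem nu0_integrable_comp (x : E) {F : ℝ × E → ℝ} (hF : Integrable F (nu0 E)) :
    Integrable (fun p : ℝ × E => F (p.1, x - p.2)) (nu0 E) :=
  (nu0_mp x).integrable_comp_of_integrable hF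

section
variable {Φ : ℝ × E → ℝ} (hΦ : GoodPhi Φ) {k : ℝ → E → E → ℝ} (hk : DomK Φ k)
include hΦ hk

theorem Op_meas {h : E → ℝ} (hm : Measurable h) (x : E) :
    Measurable (fun p : ℝ × E => k p.1 x p.2 * h p.2) := by
  have := hk.meas.comp (by fun_prop : Measurable (fun p : ℝ × E => (p.1, x, p.2)))
  exact this.mul (hm.comp measurable_snd)

theorem Op_integrable {h : E → ℝ} (hm : Measurable h) {H : ℝ} (hH : ∀ y, |h y| ≤ H) (x : E) :
    Integrable (fun p : ℝ × E => k p.1 x p.2 * h p.2) (nu0 E) := by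
  refine Integrable.mono' ((nu0_integrable_comp x hΦ.int).mul_const H)
    (Op_meas hΦ hk hm x).aestronglyMeasurable ?_
  filter_upwards [nu0_ae_pos] with p hp
  rw [Real.norm_eq_abs, abs_mul]
  exact mul_le_mul (hk.dom _ hp _ _) (hH _) (abs_nonneg _) ((abs_nonneg _).trans (hk.dom _ hp x p.2))

theorem Op_bound {h : E → ℝ} {H : ℝ} (hH : ∀ y, |h y| ≤ H) (x : E) :
    |Op k h x| ≤ (∫ p, Φ p ∂(nu0 E)) * H := by
  unfold Op
  rw [← nu0_integral_comp x Φ, ← integral_mul_const, ← Real.norm_eq_abs]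
  refine norm_integral_le_of_norm_le ((nu0_integrable_comp x hΦ.int).mul_const H) ?_
  filter_upwards [nu0_ae_pos] with p hp
  rw [Real.norm_eq_abs, abs_mul]
  exact mul_le_mul (hk.dom _ hp _ _) (hH _) (abs_nonneg _) ((abs_nonneg _).trans (hk.dom _ hp x p.2))

theorem Op_add {h h' : E → ℝ} (hm : Measurable h) {H : ℝ} (hH : ∀ y, |h y| ≤ H)
    (hm' : Measurable h') {H' : ℝ} (hH' : ∀ y, |h' y| ≤ H') (x : E) :
    Op k (fun y => h y - h' y) x = Op k h x - Op k h' x := by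
  unfold Op
  rw [← integral_sub (Op_integrable hΦ hk hm hH x) (Op_integrable hΦ hk hm' hH' x)]
  congr 1; ext p; ring

theorem Op_eq_shift (h : E → ℝ) (x : E) :
    Op k h x = ∫ p, k p.1 x (x - p.2) * h (x - p.2) ∂(nu0 E) := by
  unfold Op
  rw [← nu0_integral_comp x (fun p => k p.1 x (x - p.2) * h (x - p.2))]
  simp

theorem Op_continuous {h : E → ℝ} (hc : Continuous h) {H : ℝ} (hH : ∀ y, |h y| ≤ H) :
    Continuous (Op k h) := by
  have : Op k h = fun x => ∫ p, k p.1 x (x - p.2) * h (x - p.2) ∂(nu0 E) := by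
    ext x; exact Op_eq_shift hΦ hk h x
  rw [this]
  refine continuous_of_dominated (bound := fun p => Φ p * H) ?_ ?_ (hΦ.int.mul_const H) ?_
  · intro x
    have := hk.meas.comp (by fun_prop : Measurable (fun p : ℝ × E => (p.1, x, x - p.2)))
    exact (this.mul (hc.measurable.comp (by fun_prop : Measurable (fun p : ℝ × E => x - p.2)))).aestronglyMeasurable
  · intro x
    filter_upwards [nu0_ae_pos] with p hp
    rw [Real.norm_eq_abs, abs_mul]
    have h1 := hk.dom _ hp x (x - p.2)
    rw [sub_sub_cancel] at h1
    exact mul_le_mul h1 (hH _) (abs_nonneg _) ((abs_nonneg _).trans h1)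
  · filter_upwards [nu0_ae_pos] with p hp
    have := (hk.cont p.1 hp).comp (by fun_prop : Continuous (fun x : E => (x, x - p.2)))
    exact this.mul (hc.comp (by fun_prop))

theorem Op_zero_at_infty {h : E → ℝ} (hm : Measurable h) {H : ℝ} (hH : ∀ y, |h y| ≤ H)
    (h0 : Tendsto h (cocompact E) (𝓝 0)) :
    Tendsto (Op k h) (cocompact E) (𝓝 0) := by
  haveI := cocompact_cg (E := E)
  have : Op k h = fun x => ∫ p, k p.1 x (x - p.2) * h (x - p.2) ∂(nu0 E) := by
    ext x; exact Op_eq_shift hΦ hk h x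
  rw [this]
  have h00 : (0 : ℝ) = ∫ p : ℝ × E, (0:ℝ) ∂(nu0 E) := by simp
  rw [h00]
  refine tendsto_integral_filter_of_dominated_convergence (fun p => Φ p * H) ?_ ?_
    (hΦ.int.mul_const H) ?_
  · refine Eventually.of_forall fun x => ?_
    have := hk.meas.comp (by fun_prop : Measurable (fun p : ℝ × E => (p.1, x, x - p.2)))
    exact (this.mul (hm.comp (by fun_prop : Measurable (fun p : ℝ × E => x - p.2)))).aestronglyMeasurable
  · refine Eventually.of_forall fun x => ?_
    filter_upwards [nu0_ae_pos] with p hp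
    rw [Real.norm_eq_abs, abs_mul]
    have h1 := hk.dom _ hp x (x - p.2)
    rw [sub_sub_cancel] at h1
    exact mul_le_mul h1 (hH _) (abs_nonneg _) ((abs_nonneg _).trans h1)
  · filter_upwards [nu0_ae_pos] with p hp
    have h2 : Tendsto (fun x => h (x - p.2)) (cocompact E) (𝓝 0) :=
      h0.comp (Homeomorph.subRight p.2).isClosedEmbedding.tendsto_cocompact
    have h3 : Tendsto (fun x => Φ p * |h (x - p.2)|) (cocompact E) (𝓝 0) := by
      simpa using (h2.abs).const_mul (Φ p)
    refine squeeze_zero_norm (fun x => ?_) h3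
    rw [Real.norm_eq_abs, abs_mul]
    have h1 := hk.dom _ hp x (x - p.2)
    rw [sub_sub_cancel] at h1
    exact mul_le_mul_of_nonneg_right h1 (abs_nonneg _)

/-- joint integrability -/
theorem Op_joint {f h : E → ℝ} (fm : Measurable f) (fi : Integrable f)
    (hm : Measurable h) {H : ℝ} (hH : ∀ y, |h y| ≤ H) :
    Integrable (fun q : E × ℝ × E => f q.1 * (k q.2.1 q.1 q.2.2 * h q.2.2))
      ((volume : Measure E).prod (nu0 E)) := by
  have hmeas : Measurable (fun q : E × ℝ × E => f q.1 * (k q.2.1 q.1 q.2.2 * h q.2.2)) := by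
    have := hk.meas.comp (by fun_prop : Measurable (fun q : E × ℝ × E => (q.2.1, q.1, q.2.2)))
    exact (fm.comp measurable_fst).mul (this.mul (hm.comp (by fun_prop)))
  rw [integrable_prod_iff hmeas.aestronglyMeasurable]
  constructor
  · refine Eventually.of_forall fun x => ?_
    exact (Op_integrable hΦ hk hm hH x).const_mul (f x)
  · refine Integrable.mono' (fi.norm.mul_const ((∫ p, Φ p ∂(nu0 E)) * H))
      (hmeas.norm.stronglyMeasurable.integral_prod_right').aestronglyMeasurable ?_
    refine Eventually.of_forall fun x => ?_
    rw [Real.norm_of_nonneg (by positivity)]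
    simp only [norm_mul]
    rw [integral_const_mul]
    refine mul_le_mul_of_nonneg_left ?_ (norm_nonneg _)
    have := Op_bound hΦ (k := fun t x y => |k t x y|) (h := fun y => |h y|)
      ⟨hk.meas.abs, fun t ht => (hk.cont t ht).abs, fun t ht x y => by simpa using hk.dom t ht x y⟩
      (H := H) (by simpa using hH) x
    exact (le_abs_self _).trans this

theorem Op_fubini {f h : E → ℝ} (fm : Measurable f) (fi : Integrable f)
    (hm : Measurable h) {H : ℝ} (hH : ∀ y, |h y| ≤ H) :
    ∫ x, f x * Op k h x = ∫ y, Op (fun t x y => k t y x) f y * h y := by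
  have hj := Op_joint hΦ hk fm fi hm hH
  have e1 : ∫ x, f x * Op k h x = ∫ q, f q.1 * (k q.2.1 q.1 q.2.2 * h q.2.2)
      ∂((volume : Measure E).prod (nu0 E)) := by
    rw [integral_prod _ hj]
    congr 1; ext x
    show _ = ∫ y : ℝ × E, f x * (k y.1 x y.2 * h y.2) ∂(nu0 E)
    rw [integral_const_mul]; rfl
  let e : E × ℝ × E ≃ᵐ E × ℝ × E :=
    { toFun := fun q => (q.2.2, q.2.1, q.1)
      invFun := fun q => (q.2.2, q.2.1, q.1)
      left_inv := fun q => rfl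
      right_inv := fun q => rfl
      measurable_toFun := by
        show Measurable (fun q : E × ℝ × E => (q.2.2, q.2.1, q.1)); fun_prop
      measurable_invFun := by
        show Measurable (fun q : E × ℝ × E => (q.2.2, q.2.1, q.1)); fun_prop }
  have he : MeasurePreserving e ((volume : Measure E).prod (nu0 E)) ((volume : Measure E).prod (nu0 E)) := by
    unfold nu0
    set ρ := (volume : Measure ℝ).restrict (Set.Ioi 0)
    have a1 : MeasurePreserving (Prod.swap : E × ℝ × E → (ℝ × E) × E)
      ((volume : Measure E).prod (ρ.prod (volume : Measure E))) ((ρ.prod (volume : Measure E)).prod volume) :=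
      Measure.measurePreserving_swap
    have a2 : MeasurePreserving (MeasurableEquiv.prodAssoc : (ℝ × E) × E ≃ᵐ ℝ × E × E)
      ((ρ.prod (volume : Measure E)).prod volume) (ρ.prod ((volume : Measure E).prod volume)) :=
      measurePreserving_prodAssoc _ _ _
    have a3 : MeasurePreserving (Prod.map id Prod.swap : ℝ × E × E → ℝ × E × E)
      (ρ.prod ((volume : Measure E).prod volume)) (ρ.prod ((volume : Measure E).prod volume)) :=
      (MeasurePreserving.id _).prod Measure.measurePreserving_swap
    have a4 := (a1.symm (e := (MeasurableEquiv.prodComm : E × ℝ × E ≃ᵐ (ℝ × E) × E))).comp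
      ((a2.symm).comp (a3.comp (a2.comp a1)))
    exact a4
  have e2 : ∫ q, f q.1 * (k q.2.1 q.1 q.2.2 * h q.2.2) ∂((volume : Measure E).prod (nu0 E))
      = ∫ q, f q.2.2 * (k q.2.1 q.2.2 q.1 * h q.1) ∂((volume : Measure E).prod (nu0 E)) := by
    rw [← he.integral_comp e.measurableEmbedding]
    rfl
  have hj' : Integrable (fun q : E × ℝ × E => f q.2.2 * (k q.2.1 q.2.2 q.1 * h q.1))
      ((volume : Measure E).prod (nu0 E)) := by
    have := he.integrable_comp_of_integrable hj
    exact this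
  rw [e1, e2, integral_prod _ hj']
  congr 1; ext y
  unfold Op
  rw [← integral_mul_const]
  congr 1; ext p; ring

theorem Op_integrable' {f : E → ℝ} (fm : Measurable f) (fi : Integrable f) :
    Integrable (Op k f) ∧ ∫ x, |Op k f x| ≤ (∫ p, Φ p ∂(nu0 E)) * ∫ x, |f x| := by
  have hk' := hk.swap hΦ
  -- absolute kernels
  have hka : DomK Φ (fun t x y => |k t y x|) :=
    ⟨hk'.meas.abs, fun t ht => (hk'.cont t ht).abs, fun t ht x y => by simpa using hk'.dom t ht x y⟩
  have hfu := Op_fubini hΦ hka (f := fun x => |f x|) (h := fun _ => 1) fm.abs fi.abs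
    measurable_const (H := 1) (by simp)
  have hle : ∀ x, |Op k f x| ≤ Op (fun t x y => |k t x y|) (fun x => |f x|) x := by
    intro x
    unfold Op
    refine (abs_integral_le_integral_abs).trans (le_of_eq ?_)
    simp only [abs_mul]
  have hj := Op_joint hΦ hka (f := fun x => |f x|) (h := fun _ => 1) fm.abs fi.abs
    measurable_const (H := 1) (by simp)
  have hmeas : Measurable (fun q : E × ℝ × E => k q.2.1 q.1 q.2.2 * f q.2.2) := by
    have := hk.meas.comp (by fun_prop : Measurable (fun q : E × ℝ × E => (q.2.1, q.1, q.2.2)))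
    exact (this.mul (fm.comp (by fun_prop)))
  have hOpm : AEStronglyMeasurable (Op k f) volume :=
    (hmeas.stronglyMeasurable.integral_prod_right').aestronglyMeasurable
  -- bound of lintegral
  have hint : Integrable (Op (fun t x y => |k t x y|) (fun x => |f x|)) := by
    -- use the swapped joint integrability
    let e : E × ℝ × E ≃ᵐ E × ℝ × E :=
      { toFun := fun q => (q.2.2, q.2.1, q.1)
        invFun := fun q => (q.2.2, q.2.1, q.1)
        left_inv := fun q => rfl
        right_inv := fun q => rfl
        measurable_toFun := by
          show Measurable (fun q : E × ℝ × E => (q.2.2, q.2.1, q.1)); fun_prop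
        measurable_invFun := by
          show Measurable (fun q : E × ℝ × E => (q.2.2, q.2.1, q.1)); fun_prop }
    have he : MeasurePreserving e ((volume : Measure E).prod (nu0 E)) ((volume : Measure E).prod (nu0 E)) := by
      unfold nu0
      set ρ := (volume : Measure ℝ).restrict (Set.Ioi 0)
      have a1 : MeasurePreserving (Prod.swap : E × ℝ × E → (ℝ × E) × E)
        ((volume : Measure E).prod (ρ.prod (volume : Measure E))) ((ρ.prod (volume : Measure E)).prod volume) :=
        Measure.measurePreserving_swap
      have a2 : MeasurePreserving (MeasurableEquiv.prodAssoc : (ℝ × E) × E ≃ᵐ ℝ × E × E)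
        ((ρ.prod (volume : Measure E)).prod volume) (ρ.prod ((volume : Measure E).prod volume)) :=
        measurePreserving_prodAssoc _ _ _
      have a3 : MeasurePreserving (Prod.map id Prod.swap : ℝ × E × E → ℝ × E × E)
        (ρ.prod ((volume : Measure E).prod volume)) (ρ.prod ((volume : Measure E).prod volume)) :=
        (MeasurePreserving.id _).prod Measure.measurePreserving_swap
      have a4 := (a1.symm (e := (MeasurableEquiv.prodComm : E × ℝ × E ≃ᵐ (ℝ × E) × E))).comp
        ((a2.symm).comp (a3.comp (a2.comp a1)))
      exact a4
    have h2 := he.integrable_comp_of_integrable hj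
    have h3 := h2.integral_prod_left
    refine h3.congr (Eventually.of_forall fun x => ?_)
    show ∫ p : ℝ × E, |f p.2| * (|k p.1 x p.2| * 1) ∂(nu0 E) = _
    unfold Op
    congr 1; ext p; ring
  refine ⟨Integrable.mono' hint hOpm (Eventually.of_forall hle), ?_⟩
  calc ∫ x, |Op k f x| ≤ ∫ x, Op (fun t x y => |k t x y|) (fun x => |f x|) x :=
        integral_mono_of_nonneg (Eventually.of_forall fun x => abs_nonneg _) hint (Eventually.of_forall hle)
    _ = ∫ x, |f x| * Op (fun t x y => |k t y x|) (fun _ => 1) x := by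
        rw [hfu]; simp
    _ ≤ ∫ x, |f x| * (∫ p, Φ p ∂(nu0 E)) := by
        refine integral_mono_of_nonneg (Eventually.of_forall fun x => ?_) (fi.abs.mul_const _)
          (Eventually.of_forall fun x => ?_)
        · exact mul_nonneg (abs_nonneg _) (integral_nonneg fun p => by simp)
        · refine mul_le_mul_of_nonneg_left ?_ (abs_nonneg _)
          have := Op_bound hΦ hka (h := fun _ => 1) (H := 1) (by simp) x
          simpa using (le_abs_self _).trans this
    _ = _ := by rw [integral_mul_const, mul_comm]

end

/-- truncated kernel -/
noncomputable def truncK (τ : ℝ) (k : ℝ → E → E → ℝ) : ℝ → E → E → ℝ :=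
  fun t x y => if τ < t then k t x y else 0

theorem DomK.trunc {Φ : ℝ × E → ℝ} {k : ℝ → E → E → ℝ} (hk : DomK Φ k) (τ : ℝ) :
    DomK Φ (truncK τ k) where
  meas := by
    unfold truncK
    exact Measurable.ite (measurableSet_lt measurable_const measurable_fst) hk.meas measurable_const
  cont := fun t ht => by
    unfold truncK
    by_cases h : τ < t
    · simpa [h] using hk.cont t ht
    · simpa [h] using continuous_const
  dom := fun t ht x y => by
    unfold truncK
    by_cases h : τ < t
    · simpa [h] using hk.dom t ht x y
    · simpa [h] using (abs_nonneg _).trans (hk.dom t ht x y)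

noncomputable def tailPhi (τ : ℝ) (Φ : ℝ × E → ℝ) : ℝ × E → ℝ :=
  fun p => if τ < p.1 then 0 else Φ p

theorem GoodPhi.tail {Φ : ℝ × E → ℝ} (hΦ : GoodPhi Φ) (τ : ℝ) : GoodPhi (tailPhi τ Φ) where
  int := by
    have : tailPhi τ Φ = Set.indicator {p : ℝ × E | p.1 ≤ τ} Φ := by
      ext p; simp only [tailPhi, Set.indicator, Set.mem_ofPred_eq]
      by_cases h : τ < p.1
      · simp [h]
      · simp [h, not_lt.1 h]
    rw [this]
    exact hΦ.int.indicator (measurableSet_le measurable_fst measurable_const)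
  even := fun t ξ => by simp [tailPhi, hΦ.even]

theorem DomK.tail {Φ : ℝ × E → ℝ} {k : ℝ → E → E → ℝ} (hk : DomK Φ k) (τ : ℝ) :
    DomK (tailPhi τ Φ) (fun t x y => k t x y - truncK τ k t x y) where
  meas := hk.meas.sub (hk.trunc τ).meas
  cont := fun t ht => (hk.cont t ht).sub ((hk.trunc τ).cont t ht)
  dom := fun t ht x y => by
    unfold truncK tailPhi
    by_cases h : τ < t
    · simp [h]
    · simpa [h] using hk.dom t ht x y

theorem tail_tendsto {Φ : ℝ × E → ℝ} (hΦ : GoodPhi Φ) :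
    Tendsto (fun τ => ∫ p, tailPhi τ Φ p ∂(nu0 E)) (𝓝[>] 0) (𝓝 0) := by
  have h00 : 𝓝 (0 : ℝ) = 𝓝 (∫ p : ℝ × E, (0:ℝ) ∂(nu0 E)) := by simp
  rw [h00]
  refine tendsto_integral_filter_of_dominated_convergence (fun p => |Φ p|) ?_ ?_ hΦ.int.abs ?_
  · exact Eventually.of_forall fun τ => (hΦ.tail τ).int.aestronglyMeasurable
  · refine Eventually.of_forall fun τ => Eventually.of_forall fun p => ?_
    unfold tailPhi; split_ifs <;> simp
  · filter_upwards [nu0_ae_pos] with p hp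
    refine tendsto_const_nhds.congr' ?_
    have : ∀ᶠ τ in 𝓝[>] (0:ℝ), τ < p.1 := nhdsWithin_le_nhds (eventually_lt_nhds hp)
    filter_upwards [this] with τ hτ
    simp [tailPhi, hτ]

theorem Op_trunc_diff {Φ : ℝ × E → ℝ} (hΦ : GoodPhi Φ) {k : ℝ → E → E → ℝ} (hk : DomK Φ k)
    {h : E → ℝ} (hm : Measurable h) {H : ℝ} (hH : ∀ y, |h y| ≤ H) (τ : ℝ) (x : E) :
    |Op k h x - Op (truncK τ k) h x| ≤ (∫ p, tailPhi τ Φ p ∂(nu0 E)) * H := by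
  have := Op_bound (hΦ.tail τ) (hk.tail τ) hH x
  convert this using 2
  unfold Op
  rw [← integral_sub (Op_integrable hΦ hk hm hH x) (Op_integrable hΦ (hk.trunc τ) hm hH x)]
  congr 1; ext p; ring

theorem Op_continuous_int {Φ : ℝ × E → ℝ} (hΦ : GoodPhi Φ) {k : ℝ → E → E → ℝ} (hk : DomK Φ k)
    (hq : ∀ τ > 0, ∃ q : ℝ → ℝ, IntegrableOn q (Set.Ioi 0) ∧ (∀ t, 0 ≤ q t) ∧
      ∀ t > τ, ∀ ξ, Φ (t, ξ) ≤ q t)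
    {h : E → ℝ} (hm : Measurable h) {H : ℝ} (hH : ∀ y, |h y| ≤ H) (hi : Integrable h) :
    Continuous (Op k h) := by
  have hH0 : 0 ≤ H := (abs_nonneg _).trans (hH 0)
  have htr : ∀ τ > 0, Continuous (Op (truncK τ k) h) := by
    intro τ hτ
    obtain ⟨q, qi, q0, hq⟩ := hq τ hτ
    unfold Op
    refine continuous_of_dominated (bound := fun p => q p.1 * |h p.2|) ?_ ?_ ?_ ?_
    · intro x; exact (Op_meas hΦ (hk.trunc τ) hm x).aestronglyMeasurable
    · intro x
      filter_upwards [nu0_ae_pos] with p hp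
      rw [Real.norm_eq_abs, abs_mul]
      refine mul_le_mul_of_nonneg_right ?_ (abs_nonneg _)
      unfold truncK
      split_ifs with h
      · exact (hk.dom _ hp _ _).trans (hq _ h _)
      · simpa using q0 _
    · unfold nu0
      exact Integrable.mul_prod qi hi.abs
    · filter_upwards [nu0_ae_pos] with p hp
      have := ((hk.trunc τ).cont p.1 hp).comp (by fun_prop : Continuous (fun x : E => (x, p.2)))
      exact this.mul continuous_const
  refine continuous_of_uniform_approx_of_continuous fun u hu => ?_
  obtain ⟨ε, hε, hεu⟩ := Metric.mem_uniformity_dist.1 hu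
  have h1 : Tendsto (fun τ => (∫ p, tailPhi τ Φ p ∂(nu0 E)) * H) (𝓝[>] 0) (𝓝 0) := by
    simpa using (tail_tendsto hΦ).mul_const H
  obtain ⟨τ, hτ, hτ0⟩ := ((h1.eventually (gt_mem_nhds hε)).and self_mem_nhdsWithin).exists
  refine ⟨Op (truncK τ k) h, htr τ hτ0, fun x => hεu ?_⟩
  rw [Real.dist_eq]
  exact (Op_trunc_diff hΦ hk hm hH τ x).trans_lt hτ

end OpTheory

end Part1

section Part2
set_option linter.unusedSectionVars false
set_option linter.style.haveILetI false
set_option synthInstance.maxHeartbeats 400000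
set_option maxSynthPendingDepth 3

/-- uniformly elliptic operator data -/
structure Ell (E : Type*) [NormedAddCommGroup E] [NormedSpace ℝ E] (m : ℕ) where
  l : E → (E →L[ℝ] E →L[ℝ] ℝ) →L[ℝ] ℝ
  b : E → E →L[ℝ] E →L[ℝ] ℝ
  L : ℝ
  B : ℝ
  c0 : ℝ
  L0 : 0 ≤ L
  B0 : 0 ≤ B
  c0pos : 0 < c0
  hdim : Module.finrank ℝ E = 2 * m
  lip : ∀ x y T, |l x T - l y T| ≤ L * ‖x - y‖ * ‖T‖
  bdd : ∀ x T, |l x T| ≤ B * ‖T‖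
  bbdd : ∀ x, ‖b x‖ ≤ B
  bcont : Continuous b
  bsymm : ∀ x u w, b x u w = b x w u
  bpos : ∀ x u, c0 * ‖u‖ ^ 2 ≤ b x u u
  lb : ∀ x, l x (b x) = m / 2
  lbb : ∀ x u, l x ((b x u).smulRight (b x u)) = b x u u / 4
  pos : ∀ x T, (∀ u w, T u w = T w u) → (∀ u, 0 ≤ T u u) → 0 ≤ l x T

section Kernel

variable {E : Type*} [NormedAddCommGroup E] [NormedSpace ℝ E] [FiniteDimensional ℝ E]
  [MeasureSpace E] [BorelSpace E] [(volume : Measure E).IsAddHaarMeasure]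

theorem exp_poly_bound {c : ℝ} (hc : 0 < c) (N : ℕ) {s : ℝ} (hs : 0 ≤ s) :
    Real.exp (-(c * s ^ 2)) * (1 + s) ^ N ≤ Real.exp (N ^ 2 / (4 * c)) := by
  have h1 : (1 + s) ^ N ≤ Real.exp (N * s) := by
    rw [Real.exp_nat_mul]
    exact pow_le_pow_left₀ (by positivity) (by linarith [Real.add_one_le_exp s]) N
  calc Real.exp (-(c * s ^ 2)) * (1 + s) ^ N ≤ Real.exp (-(c * s ^ 2)) * Real.exp (N * s) :=
        mul_le_mul_of_nonneg_left h1 (Real.exp_nonneg _)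
    _ = Real.exp (-(c * s ^ 2) + N * s) := by rw [Real.exp_add]
    _ ≤ _ := by
        apply Real.exp_le_exp.2
        rw [le_div_iff₀ (by positivity)]
        nlinarith [sq_nonneg (2 * c * s - N)]

noncomputable def PhiK (m : ℕ) (κ C : ℝ) (p : ℝ × E) : ℝ :=
  C * (Real.exp (-(κ * p.1)) * (√p.1)⁻¹ * (p.1 ^ m)⁻¹ * ((1 + ‖p.2‖ / √p.1) ^ (2 * m + 1))⁻¹)

theorem theta_integrable {m : ℕ} (hd : Module.finrank ℝ E = 2 * m) :
    Integrable (fun ξ : E => ((1 + ‖ξ‖) ^ (2 * m + 1))⁻¹) := by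
  have := integrable_one_add_norm (E := E) (μ := volume) (r := 2 * m + 1) (by rw [hd]; push_cast; linarith)
  refine this.congr (Eventually.of_forall fun ξ => ?_)
  have h : (0:ℝ) < 1 + ‖ξ‖ := by positivity
  show (1 + ‖ξ‖) ^ (-(2 * (m:ℝ) + 1)) = _
  rw [Real.rpow_neg h.le]
  congr 1
  exact_mod_cast Real.rpow_natCast (1 + ‖ξ‖) (2 * m + 1)

theorem PhiK_meas (m : ℕ) (κ C : ℝ) : Measurable (PhiK m κ C : ℝ × E → ℝ) := by
  unfold PhiK
  fun_prop

theorem PhiK_nonneg {m : ℕ} {κ C : ℝ} (hC : 0 ≤ C) {p : ℝ × E} (hp : 0 < p.1) : 0 ≤ PhiK m κ C p := by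
  unfold PhiK; positivity

theorem scale_integral {m : ℕ} (hd : Module.finrank ℝ E = 2 * m) {t : ℝ} (ht : 0 < t) (f : E → ℝ) :
    ∫ ξ : E, (t ^ m)⁻¹ * f ((√t)⁻¹ • ξ) = ∫ ξ : E, f ξ := by
  have hs : 0 < √t := Real.sqrt_pos.2 ht
  rw [integral_const_mul, Measure.integral_comp_smul_of_nonneg volume f (√t)⁻¹ (hR := by positivity), hd]
  rw [inv_pow, inv_inv, smul_eq_mul, pow_mul, Real.sq_sqrt ht.le, ← mul_assoc,
    inv_mul_cancel₀ (by positivity), one_mul]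

theorem PhiK_good {m : ℕ} (hd : Module.finrank ℝ E = 2 * m) {κ : ℝ} (hκ : 0 < κ) (C : ℝ) :
    GoodPhi (PhiK m κ C : ℝ × E → ℝ) where
  even := fun t ξ => by simp [PhiK]
  int := by
    unfold PhiK
    apply Integrable.const_mul
    have hm : Measurable (fun p : ℝ × E => Real.exp (-(κ * p.1)) * (√p.1)⁻¹ * (p.1 ^ m)⁻¹ *
      ((1 + ‖p.2‖ / √p.1) ^ (2 * m + 1))⁻¹) := by fun_prop
    have key : ∀ t > 0, ∀ ξ : E, (t ^ m)⁻¹ * ((1 + ‖ξ‖ / √t) ^ (2 * m + 1))⁻¹ =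
       (t ^ m)⁻¹ * (fun ξ : E => ((1 + ‖ξ‖) ^ (2 * m + 1))⁻¹) ((√t)⁻¹ • ξ) := by
      intro t ht ξ
      have hs : 0 < √t := Real.sqrt_pos.2 ht
      simp only [norm_smul, norm_inv, Real.norm_eq_abs, abs_of_pos hs]
      rw [div_eq_inv_mul]
    unfold nu0
    rw [integrable_prod_iff hm.aestronglyMeasurable]
    constructor
    · filter_upwards [ae_restrict_mem measurableSet_Ioi] with t ht
      have hs : 0 < √t := Real.sqrt_pos.2 ht
      have h1 : Integrable (fun ξ : E => (fun ξ : E => ((1 + ‖ξ‖) ^ (2 * m + 1))⁻¹) ((√t)⁻¹ • ξ)) :=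
        (theta_integrable hd).comp_smul (by positivity)
      refine ((h1.const_mul ((t ^ m)⁻¹)).const_mul (Real.exp (-(κ * t)) * (√t)⁻¹)).congr
        (Eventually.of_forall fun ξ => ?_)
      dsimp only
      rw [← key t ht ξ]; ring
    · have hI : IntegrableOn (fun t : ℝ => Real.exp (-(κ * t)) * (√t)⁻¹ *
          ∫ ξ : E, ((1 + ‖ξ‖) ^ (2 * m + 1))⁻¹) (Set.Ioi 0) := by
        apply Integrable.mul_const
        have h2 : IntegrableOn (fun x => x ^ ((-1/2 : ℝ)) * Real.exp (-κ * x ^ (1:ℝ))) (Set.Ioi 0) :=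
          integrableOn_rpow_mul_exp_neg_mul_rpow (by norm_num) (by norm_num) hκ
        refine h2.congr_fun (fun t ht => ?_) measurableSet_Ioi
        have ht' : (0:ℝ) < t := ht
        dsimp only
        rw [Real.rpow_one, mul_comm, neg_mul, Real.sqrt_eq_rpow, ← Real.rpow_neg ht'.le]
        norm_num
      refine hI.congr_fun (fun t ht => ?_) measurableSet_Ioi
      have ht' : (0:ℝ) < t := ht
      have hs : 0 < √t := Real.sqrt_pos.2 ht
      dsimp only
      rw [← scale_integral hd ht' (fun ξ : E => ((1 + ‖ξ‖) ^ (2 * m + 1))⁻¹), ← integral_const_mul]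
      congr 1; ext ξ
      rw [← key t ht ξ, Real.norm_of_nonneg (by positivity)]; ring

theorem PhiK_tendsto {m : ℕ} (hd : Module.finrank ℝ E = 2 * m) (C : ℝ) :
    Tendsto (fun κ : ℝ => ∫ p, PhiK m κ C p ∂(nu0 E)) atTop (𝓝 0) := by
  have h00 : 𝓝 (0 : ℝ) = 𝓝 (∫ p : ℝ × E, (0:ℝ) ∂(nu0 E)) := by simp
  rw [h00]
  refine tendsto_integral_filter_of_dominated_convergence (fun p => |PhiK m 1 C p|) ?_ ?_
    (PhiK_good hd one_pos C).int.abs ?_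
  · exact Eventually.of_forall fun κ => (PhiK_meas m κ C).aestronglyMeasurable
  · filter_upwards [eventually_ge_atTop 1] with κ hκ
    filter_upwards [nu0_ae_pos] with p hp
    have hp' : (0:ℝ) < p.1 := hp
    have h0 : Real.exp (-(κ * p.1)) ≤ Real.exp (-(1 * p.1)) := by
      apply Real.exp_le_exp.2; nlinarith
    unfold PhiK
    rw [Real.norm_eq_abs, abs_mul C, abs_mul C]
    refine mul_le_mul_of_nonneg_left ?_ (abs_nonneg C)
    have e1 : 0 ≤ Real.exp (-(κ * p.1)) * (√p.1)⁻¹ * (p.1 ^ m)⁻¹ * ((1 + ‖p.2‖ / √p.1) ^ (2 * m + 1))⁻¹ := by positivity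
    have e2 : 0 ≤ Real.exp (-(1 * p.1)) * (√p.1)⁻¹ * (p.1 ^ m)⁻¹ * ((1 + ‖p.2‖ / √p.1) ^ (2 * m + 1))⁻¹ := by positivity
    rw [abs_of_nonneg e1, abs_of_nonneg e2]
    gcongr
  · filter_upwards [nu0_ae_pos] with p hp
    have h1 : Tendsto (fun κ : ℝ => Real.exp (-(κ * p.1))) atTop (𝓝 0) :=
      Real.tendsto_exp_neg_atTop_nhds_zero.comp (tendsto_id.atTop_mul_const hp)
    have h2 := ((h1.mul_const ((√p.1)⁻¹)).mul_const ((p.1 ^ m)⁻¹)).mul_const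
      (((1 + ‖p.2‖ / √p.1) ^ (2 * m + 1))⁻¹)
    simpa [PhiK] using h2.const_mul C

theorem PhiK_q {m : ℕ} {κ C : ℝ} (hκ : 0 < κ) (hC : 0 ≤ C) :
    ∀ τ > 0, ∃ q : ℝ → ℝ, IntegrableOn q (Set.Ioi 0) ∧ (∀ t, 0 ≤ q t) ∧
      ∀ t > τ, ∀ ξ : E, PhiK m κ C (t, ξ) ≤ q t := by
  intro τ hτ
  refine ⟨fun t => C * (Real.exp (-κ * t) * (√τ)⁻¹ * (τ ^ m)⁻¹ * 1), ?_, ?_, ?_⟩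
  · have := integrableOn_exp_mul_Ioi (a := -κ) (by linarith) 0
    exact (((this.mul_const _).mul_const _).mul_const _).const_mul C
  · intro t; positivity
  · intro t ht ξ
    have ht0 : 0 < t := hτ.trans ht
    unfold PhiK
    have h1 : ((1 + ‖ξ‖ / √t) ^ (2 * m + 1))⁻¹ ≤ 1 := by
      apply inv_le_one_of_one_le₀
      apply one_le_pow₀
      have : 0 ≤ ‖ξ‖ / √t := by positivity
      linarith
    have h2 : (√t)⁻¹ ≤ (√τ)⁻¹ := inv_anti₀ (Real.sqrt_pos.2 hτ) (Real.sqrt_le_sqrt ht.le)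
    have h3 : (t ^ m)⁻¹ ≤ (τ ^ m)⁻¹ := inv_anti₀ (by positivity) (pow_le_pow_left₀ hτ.le ht.le m)
    dsimp only
    rw [neg_mul]
    gcongr

variable {m : ℕ} (e : Ell E m)

noncomputable def Ell.cc (y : E) : ℝ := ∫ ζ : E, Real.exp (-(e.b y ζ ζ))
noncomputable def Ell.a (y : E) : ℝ := (e.cc y)⁻¹

theorem Ell.bquad_cont : Continuous (fun p : E × E => e.b p.1 p.2 p.2) := by
  have := e.bcont
  fun_prop

theorem Ell.b_le (y u : E) : e.b y u u ≤ e.B * ‖u‖ ^ 2 := by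
  have h1 := (e.b y).le_opNorm₂ u u
  have h2 := e.bbdd y
  calc e.b y u u ≤ ‖e.b y u u‖ := le_abs_self _
    _ ≤ ‖e.b y‖ * ‖u‖ * ‖u‖ := h1
    _ ≤ e.B * ‖u‖ * ‖u‖ := by gcongr
    _ = _ := by ring

theorem gauss_integrable {c : ℝ} (hc : 0 < c) {m : ℕ} (hd : Module.finrank ℝ E = 2 * m) :
    Integrable (fun ζ : E => Real.exp (-(c * ‖ζ‖ ^ 2))) := by
  refine Integrable.mono' ((theta_integrable hd).const_mul (Real.exp ((2 * m + 1 : ℕ) ^ 2 / (4 * c))))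
    (by fun_prop) (Eventually.of_forall fun ζ => ?_)
  have := exp_poly_bound hc (2 * m + 1) (norm_nonneg ζ)
  rw [Real.norm_of_nonneg (Real.exp_nonneg _), ← div_eq_mul_inv, le_div_iff₀ (by positivity)]
  exact this

theorem Ell.exp_le (y ζ : E) : Real.exp (-(e.b y ζ ζ)) ≤ Real.exp (-(e.c0 * ‖ζ‖ ^ 2)) :=
  Real.exp_le_exp.2 (neg_le_neg (e.bpos y ζ))

theorem Ell.exp_integrable (y : E) : Integrable (fun ζ : E => Real.exp (-(e.b y ζ ζ))) := by
  refine Integrable.mono' (gauss_integrable e.c0pos e.hdim) ?_ (Eventually.of_forall fun ζ => ?_)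
  · have := e.bcont
    exact (by fun_prop : Continuous (fun ζ : E => Real.exp (-(e.b y ζ ζ)))).aestronglyMeasurable
  · rw [Real.norm_of_nonneg (Real.exp_nonneg _)]
    exact e.exp_le y ζ

theorem Ell.cc_cont : Continuous e.cc := by
  unfold Ell.cc
  have := e.bcont
  refine continuous_of_dominated (bound := fun ζ => Real.exp (-(e.c0 * ‖ζ‖ ^ 2))) ?_ ?_
    (gauss_integrable e.c0pos e.hdim) ?_
  · intro y; exact (e.exp_integrable y).aestronglyMeasurable
  · intro y
    refine Eventually.of_forall fun ζ => ?_
    rw [Real.norm_of_nonneg (Real.exp_nonneg _)]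
    exact e.exp_le y ζ
  · refine Eventually.of_forall fun ζ => ?_
    fun_prop

theorem Ell.cc_low : ∃ d > 0, ∀ y, d ≤ e.cc y := by
  have hi : Integrable (fun ζ : E => Real.exp (-((e.B + 1) * ‖ζ‖ ^ 2))) :=
    gauss_integrable (by linarith [e.B0]) e.hdim
  refine ⟨∫ ζ : E, Real.exp (-((e.B + 1) * ‖ζ‖ ^ 2)), ?_, fun y => ?_⟩
  · show 0 < _
    rw [integral_pos_iff_support_of_nonneg (fun ζ => Real.exp_nonneg _) hi]
    have : Function.support (fun ζ : E => Real.exp (-((e.B + 1) * ‖ζ‖ ^ 2))) = Set.univ := by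
      ext ζ; simp [Real.exp_ne_zero]
    rw [this]
    exact isOpen_univ.measure_pos _ Set.univ_nonempty
  · refine integral_mono hi (e.exp_integrable y) fun ζ => ?_
    apply Real.exp_le_exp.2
    have := e.b_le y ζ
    nlinarith [sq_nonneg ‖ζ‖]

theorem Ell.cc_pos (y : E) : 0 < e.cc y := by
  obtain ⟨d, hd, h⟩ := e.cc_low
  exact hd.trans_le (h y)

theorem Ell.a_pos (y : E) : 0 < e.a y := inv_pos.2 (e.cc_pos y)

theorem Ell.a_cont : Continuous e.a := e.cc_cont.inv₀ fun y => (e.cc_pos y).ne'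

theorem Ell.a_bdd : ∃ K, 0 < K ∧ ∀ y, e.a y ≤ K := by
  obtain ⟨d, hd, h⟩ := e.cc_low
  exact ⟨d⁻¹, inv_pos.2 hd, fun y => inv_anti₀ hd (h y)⟩

noncomputable def Ell.zker (lam t : ℝ) (x y : E) : ℝ :=
  Real.exp (-(lam * t)) * (t ^ m)⁻¹ * Real.exp (-(e.b y (x - y) (x - y)) / t) * e.a y

noncomputable def Ell.zD (lam t : ℝ) (x y : E) : E →L[ℝ] ℝ :=
  (e.zker lam t x y * (-2 / t)) • e.b y (x - y)

noncomputable def Ell.pH (t : ℝ) (x y : E) : E →L[ℝ] E →L[ℝ] ℝ :=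
  (4 / t ^ 2) • (e.b y (x - y)).smulRight (e.b y (x - y)) - (2 / t) • e.b y

noncomputable def Ell.zH (lam t : ℝ) (x y : E) : E →L[ℝ] E →L[ℝ] ℝ :=
  e.zker lam t x y • e.pH t x y

noncomputable def Ell.rker (lam t : ℝ) (x y : E) : ℝ :=
  e.l x (e.zH lam t x y) - e.l y (e.zH lam t x y)

theorem Ell.zker_nonneg {lam t : ℝ} (ht : 0 < t) (x y : E) : 0 ≤ e.zker lam t x y := by
  unfold Ell.zker
  have := e.a_pos y
  positivity

/-- master bound -/
theorem Ell.zker_bound : ∃ K, 0 < K ∧ ∀ lam t : ℝ, 0 < t → ∀ x y : E,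
    e.zker lam t x y * (1 + ‖x - y‖ / √t) ^ (2 * m + 4) ≤ K * (Real.exp (-(lam * t)) * (t ^ m)⁻¹) := by
  obtain ⟨A, hA, ha⟩ := e.a_bdd
  refine ⟨Real.exp ((2 * m + 4 : ℕ) ^ 2 / (4 * e.c0)) * A, by positivity, fun lam t ht x y => ?_⟩
  have hs : 0 < √t := Real.sqrt_pos.2 ht
  have h1 := exp_poly_bound e.c0pos (2 * m + 4) (s := ‖x - y‖ / √t) (by positivity)
  have h2 : Real.exp (-(e.b y (x - y) (x - y)) / t) ≤ Real.exp (-(e.c0 * (‖x - y‖ / √t) ^ 2)) := by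
    apply Real.exp_le_exp.2
    rw [div_pow, Real.sq_sqrt ht.le, neg_div]
    apply neg_le_neg
    rw [mul_div_assoc']
    exact div_le_div_of_nonneg_right (e.bpos y _) ht.le
  unfold Ell.zker
  set q := (1 + ‖x - y‖ / √t) ^ (2 * m + 4)
  have hq : 0 ≤ q := by positivity
  have h3 : Real.exp (-(e.b y (x - y) (x - y)) / t) * q ≤ Real.exp ((2 * m + 4 : ℕ) ^ 2 / (4 * e.c0)) :=
    (mul_le_mul_of_nonneg_right h2 hq).trans h1
  have h4 := ha y
  have h5 := e.a_pos y
  calc _ = (Real.exp (-(lam * t)) * (t ^ m)⁻¹) * ((Real.exp (-(e.b y (x - y) (x - y)) / t) * q) * e.a y) := by ring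
    _ ≤ (Real.exp (-(lam * t)) * (t ^ m)⁻¹) * (Real.exp ((2 * m + 4 : ℕ) ^ 2 / (4 * e.c0)) * A) := by
        gcongr
    _ = _ := by ring

theorem Ell.pH_bound {t : ℝ} (ht : 0 < t) (x y : E) :
    ‖e.pH t x y‖ ≤ (4 * e.B ^ 2 + 2 * e.B) * (1 + ‖x - y‖ / √t) ^ 2 / t := by
  have hs : 0 < √t := Real.sqrt_pos.2 ht
  have hB := e.B0
  have hb : ‖e.b y (x - y)‖ ≤ e.B * ‖x - y‖ :=
    ((e.b y).le_opNorm _).trans (mul_le_mul_of_nonneg_right (e.bbdd y) (norm_nonneg _))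
  set s := ‖x - y‖ / √t with hsdef
  have hs0 : 0 ≤ s := by positivity
  have hx : ‖x - y‖ = s * √t := by rw [hsdef]; field_simp
  unfold Ell.pH
  refine (norm_sub_le _ _).trans ?_
  rw [norm_smul, norm_smul, ContinuousLinearMap.norm_smulRight_apply, Real.norm_of_nonneg (by positivity),
    Real.norm_of_nonneg (by positivity)]
  have h1 : ‖e.b y (x - y)‖ * ‖e.b y (x - y)‖ ≤ e.B ^ 2 * s ^ 2 * t := by
    calc _ ≤ (e.B * ‖x - y‖) * (e.B * ‖x - y‖) := by gcongr
      _ = e.B ^ 2 * s ^ 2 * (√t) ^ 2 := by rw [hx]; ring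
      _ = _ := by rw [Real.sq_sqrt ht.le]
  calc _ ≤ 4 / t ^ 2 * (e.B ^ 2 * s ^ 2 * t) + 2 / t * e.B := by
        have := e.bbdd y
        gcongr
    _ = (4 * e.B ^ 2 * s ^ 2 + 2 * e.B) / t := by field_simp
    _ ≤ _ := by
        gcongr
        nlinarith [mul_nonneg hB hs0, mul_nonneg (sq_nonneg e.B) hs0, mul_nonneg hB (sq_nonneg s)]

theorem Ell.l_cont : Continuous (fun p : E × (E →L[ℝ] E →L[ℝ] ℝ) => e.l p.1 p.2) := by
  have : Continuous e.l := by
    have hl : LipschitzWith (Real.toNNReal e.L) e.l := by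
      refine LipschitzWith.of_dist_le_mul fun x y => ?_
      rw [dist_eq_norm, dist_eq_norm, Real.coe_toNNReal _ e.L0]
      refine ContinuousLinearMap.opNorm_le_bound _ (mul_nonneg e.L0 (norm_nonneg _)) fun T => ?_
      exact e.lip x y T
    exact hl.continuous
  fun_prop

theorem Ell.zker_meas (lam : ℝ) : Measurable (fun p : ℝ × E × E => e.zker lam p.1 p.2.1 p.2.2) := by
  unfold Ell.zker
  have h1 : Measurable (fun p : ℝ × E × E => e.b p.2.2 (p.2.1 - p.2.2) (p.2.1 - p.2.2)) := by
    have := e.bcont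
    exact (by fun_prop : Continuous (fun p : ℝ × E × E => e.b p.2.2 (p.2.1 - p.2.2) (p.2.1 - p.2.2))).measurable
  have h2 := e.a_cont.measurable
  fun_prop

theorem Ell.zker_cont (lam : ℝ) (t : ℝ) : Continuous (fun p : E × E => e.zker lam t p.1 p.2) := by
  unfold Ell.zker
  have := e.bcont
  have h2 := e.a_cont
  fun_prop

theorem Ell.rker_eq (lam t : ℝ) (x y : E) : e.rker lam t x y =
    e.zker lam t x y * ((4 / t ^ 2) * (e.l x ((e.b y (x - y)).smulRight (e.b y (x - y))) -
      e.l y ((e.b y (x - y)).smulRight (e.b y (x - y)))) - (2 / t) * (e.l x (e.b y) - e.l y (e.b y))) := by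
  simp only [Ell.rker, Ell.zH, Ell.pH, map_smul, map_sub, smul_eq_mul]
  ring

theorem Ell.smulRight_cont : Continuous (fun p : E × E =>
    (e.b p.2 (p.1 - p.2)).smulRight (e.b p.2 (p.1 - p.2))) := by
  have hb := e.bcont
  have h1 : Continuous (fun p : E × E => e.b p.2 (p.1 - p.2)) := by fun_prop
  have := (ContinuousLinearMap.smulRightL ℝ E (E →L[ℝ] ℝ)).continuous₂
  exact this.comp (h1.prodMk h1)

theorem Ell.aux_cont : Continuous (fun p : E × E =>
    (e.l p.1 ((e.b p.2 (p.1 - p.2)).smulRight (e.b p.2 (p.1 - p.2))) -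
      e.l p.2 ((e.b p.2 (p.1 - p.2)).smulRight (e.b p.2 (p.1 - p.2))))) := by
  have h1 := e.smulRight_cont
  exact (e.l_cont.comp (continuous_fst.prodMk h1)).sub (e.l_cont.comp (continuous_snd.prodMk h1))

theorem Ell.aux_cont2 : Continuous (fun p : E × E => (e.l p.1 (e.b p.2) - e.l p.2 (e.b p.2))) := by
  have h1 := e.bcont.comp (continuous_snd (X := E) (Y := E))
  exact (e.l_cont.comp (continuous_fst.prodMk h1)).sub (e.l_cont.comp (continuous_snd.prodMk h1))

theorem Ell.kernels_dom : ∃ C, 0 < C ∧ ∀ lam : ℝ,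
    DomK (PhiK m (lam - 1) C) (e.zker lam) ∧ DomK (PhiK m (lam - 1) C) (e.rker lam) := by
  obtain ⟨K, hK, hz⟩ := e.zker_bound
  set C1 := e.L * (4 * e.B ^ 2 + 2 * e.B) with hC1
  have hC1' : 0 ≤ C1 := by have := e.L0; have := e.B0; positivity
  refine ⟨K * (1 + C1), by positivity, fun lam => ⟨⟨e.zker_meas lam, fun t _ => e.zker_cont lam t, ?_⟩, ⟨?_, ?_, ?_⟩⟩⟩
  · intro t ht x y
    have hs : 0 < √t := Real.sqrt_pos.2 ht
    rw [abs_of_nonneg (e.zker_nonneg ht x y)]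
    have h := hz lam t ht x y
    unfold PhiK
    dsimp only
    set q := 1 + ‖x - y‖ / √t with hq
    have hq1 : 1 ≤ q := by rw [hq]; have : 0 ≤ ‖x - y‖ / √t := by positivity
                           linarith
    have h1 : e.zker lam t x y * q ^ (2 * m + 1) ≤ K * (Real.exp (-(lam * t)) * (t ^ m)⁻¹) := by
      refine le_trans (mul_le_mul_of_nonneg_left ?_ (e.zker_nonneg ht x y)) h
      exact pow_le_pow_right₀ hq1 (by omega)
    have h2 : Real.exp (-(lam * t)) ≤ Real.exp (-((lam - 1) * t)) * (√t)⁻¹ := by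
      rw [← div_eq_mul_inv, le_div_iff₀ hs]
      have : √t ≤ Real.exp t := by
        have a1 := Real.add_one_le_exp t
        have a2 : √t ≤ t + 1 := by
          rw [Real.sqrt_le_left (by positivity)]; nlinarith
        linarith
      calc Real.exp (-(lam * t)) * √t ≤ Real.exp (-(lam * t)) * Real.exp t := by gcongr
        _ = _ := by rw [← Real.exp_add]; ring_nf
    have h3 : e.zker lam t x y ≤ K * (Real.exp (-(lam * t)) * (t ^ m)⁻¹) * (q ^ (2 * m + 1))⁻¹ := by
      rw [← div_eq_mul_inv, le_div_iff₀ (by positivity)]; exact h1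
    calc _ ≤ K * (Real.exp (-(lam * t)) * (t ^ m)⁻¹) * (q ^ (2 * m + 1))⁻¹ := h3
      _ ≤ K * ((Real.exp (-((lam - 1) * t)) * (√t)⁻¹) * (t ^ m)⁻¹) * (q ^ (2 * m + 1))⁻¹ := by gcongr
      _ = K * 1 * ((Real.exp (-((lam - 1) * t)) * (√t)⁻¹) * (t ^ m)⁻¹ * (q ^ (2 * m + 1))⁻¹) := by ring
      _ ≤ _ := by gcongr; linarith
  · have h1 := e.aux_cont.measurable.comp (by fun_prop : Measurable (fun p : ℝ × E × E => p.2))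
    have h2 := e.aux_cont2.measurable.comp (by fun_prop : Measurable (fun p : ℝ × E × E => p.2))
    have h3 := e.zker_meas lam
    simp only [e.rker_eq]
    refine h3.mul (Measurable.sub (Measurable.mul (by fun_prop : Measurable (fun p : ℝ × E × E => 4 / p.1 ^ 2)) h1) (Measurable.mul (by fun_prop : Measurable (fun p : ℝ × E × E => 2 / p.1)) h2))
  · intro t ht
    simp only [e.rker_eq]
    exact (e.zker_cont lam t).mul ((continuous_const.mul e.aux_cont).sub (continuous_const.mul e.aux_cont2))
  · intro t ht x y
    have hs : 0 < √t := Real.sqrt_pos.2 ht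
    have hz0 := e.zker_nonneg (lam := lam) ht x y
    have h := hz lam t ht x y
    have hr : |e.rker lam t x y| ≤ e.L * ‖x - y‖ * ‖e.zH lam t x y‖ := e.lip x y _
    unfold Ell.zH at hr
    rw [norm_smul, Real.norm_of_nonneg hz0] at hr
    have hp := e.pH_bound ht x y
    unfold PhiK
    dsimp only
    set q := 1 + ‖x - y‖ / √t with hq
    have hq0 : 0 ≤ ‖x - y‖ / √t := by positivity
    have hq1 : 1 ≤ q := by rw [hq]; linarith
    have hx : ‖x - y‖ ≤ q * √t := by
      rw [hq, add_mul, div_mul_cancel₀ _ hs.ne']; linarith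
    have hL := e.L0
    have hB := e.B0
    have h4 : |e.rker lam t x y| ≤ e.zker lam t x y * q ^ 3 * (C1 * (√t)⁻¹) := by
      calc _ ≤ _ := hr
        _ ≤ e.L * (q * √t) * (e.zker lam t x y * ((4 * e.B ^ 2 + 2 * e.B) * q ^ 2 / t)) := by gcongr
        _ = e.zker lam t x y * q ^ 3 * (C1 * (√t / t)) := by rw [hC1]; ring
        _ = _ := by rw [Real.sqrt_div_self]; 
    have h1 : e.zker lam t x y * q ^ 3 ≤ K * (Real.exp (-(lam * t)) * (t ^ m)⁻¹) * (q ^ (2 * m + 1))⁻¹ := by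
      rw [← div_eq_mul_inv, le_div_iff₀ (by positivity), mul_assoc, ← pow_add,
        show 3 + (2 * m + 1) = 2 * m + 4 by omega]
      exact h
    have h2 : Real.exp (-(lam * t)) ≤ Real.exp (-((lam - 1) * t)) := by
      apply Real.exp_le_exp.2; nlinarith
    calc _ ≤ _ := h4
      _ ≤ (K * (Real.exp (-(lam * t)) * (t ^ m)⁻¹) * (q ^ (2 * m + 1))⁻¹) * (C1 * (√t)⁻¹) := by gcongr
      _ ≤ (K * (Real.exp (-((lam - 1) * t)) * (t ^ m)⁻¹) * (q ^ (2 * m + 1))⁻¹) * (C1 * (√t)⁻¹) := by gcongr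
      _ = K * C1 * (Real.exp (-((lam - 1) * t)) * (√t)⁻¹ * (t ^ m)⁻¹ * (q ^ (2 * m + 1))⁻¹) := by ring
      _ ≤ _ := by gcongr; linarith

/-- uniform bounds for `t > τ`. -/
theorem Ell.zker_tau (τ : ℝ) (hτ : 0 < τ) : ∃ C, 0 < C ∧ ∀ lam t : ℝ, τ < t → ∀ x y : E,
    e.zker lam t x y ≤ C * Real.exp (-(lam * t)) ∧ ‖e.zD lam t x y‖ ≤ C * Real.exp (-(lam * t)) ∧
    ‖e.zH lam t x y‖ ≤ C * Real.exp (-(lam * t)) := by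
  obtain ⟨K, hK, hz⟩ := e.zker_bound
  have hB := e.B0
  set C2 := 4 * e.B ^ 2 + 2 * e.B with hC2
  have hC2' : 0 ≤ C2 := by positivity
  set K' := K * (τ ^ m)⁻¹ with hK'
  have hK'0 : 0 < K' := by positivity
  refine ⟨K' * (1 + 2 * e.B * (√τ)⁻¹ + C2 * τ⁻¹), by positivity, fun lam t ht x y => ?_⟩
  have ht0 : 0 < t := hτ.trans ht
  have hs : 0 < √t := Real.sqrt_pos.2 ht0
  have hz0 := e.zker_nonneg (lam := lam) ht0 x y
  have h := hz lam t ht0 x y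
  have hp := e.pH_bound ht0 x y
  set q := 1 + ‖x - y‖ / √t with hq
  have hq0 : 0 ≤ ‖x - y‖ / √t := by positivity
  have hq1 : 1 ≤ q := by rw [hq]; linarith
  have hx : ‖x - y‖ ≤ q * √t := by
    rw [hq, add_mul, div_mul_cancel₀ _ hs.ne']; linarith
  have h3 : (t ^ m)⁻¹ ≤ (τ ^ m)⁻¹ := inv_anti₀ (by positivity) (pow_le_pow_left₀ hτ.le ht.le m)
  have hpw : ∀ j ≤ 2 * m + 4, e.zker lam t x y * q ^ j ≤ K' * Real.exp (-(lam * t)) := by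
    intro j hj
    calc _ ≤ e.zker lam t x y * q ^ (2 * m + 4) :=
          mul_le_mul_of_nonneg_left (pow_le_pow_right₀ hq1 hj) hz0
      _ ≤ _ := h
      _ ≤ K * (Real.exp (-(lam * t)) * (τ ^ m)⁻¹) := by gcongr
      _ = _ := by rw [hK']; ring
  have hexp := Real.exp_pos (-(lam * t))
  have hi1 : 0 ≤ 2 * e.B * (√τ)⁻¹ := by positivity
  have hi2 : 0 ≤ C2 * τ⁻¹ := by positivity
  have hKe : 0 ≤ K' * Real.exp (-(lam * t)) := by positivity
  refine ⟨?_, ?_, ?_⟩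
  · have := hpw 0 (by omega)
    rw [pow_zero, mul_one] at this
    calc _ ≤ _ := this
      _ = K' * Real.exp (-(lam * t)) * 1 := by ring
      _ ≤ K' * Real.exp (-(lam * t)) * (1 + 2 * e.B * (√τ)⁻¹ + C2 * τ⁻¹) := by gcongr; linarith
      _ = _ := by ring
  · have := hpw 1 (by omega)
    have hb : ‖e.b y (x - y)‖ ≤ e.B * ‖x - y‖ :=
      ((e.b y).le_opNorm _).trans (mul_le_mul_of_nonneg_right (e.bbdd y) (norm_nonneg _))
    have h5 : (√t)⁻¹ ≤ (√τ)⁻¹ := inv_anti₀ (Real.sqrt_pos.2 hτ) (Real.sqrt_le_sqrt ht.le)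
    unfold Ell.zD
    rw [norm_smul, norm_mul, Real.norm_of_nonneg hz0]
    have h6 : ‖-2 / t‖ = 2 / t := by rw [norm_div, Real.norm_of_nonneg ht0.le]; norm_num
    rw [h6]
    calc _ ≤ e.zker lam t x y * (2 / t) * (e.B * (q * √t)) := by gcongr; exact hb.trans (by gcongr)
      _ = (e.zker lam t x y * q ^ 1) * (2 * e.B * (√t / t)) := by ring
      _ = (e.zker lam t x y * q ^ 1) * (2 * e.B * (√t)⁻¹) := by rw [Real.sqrt_div_self]
      _ ≤ (K' * Real.exp (-(lam * t))) * (2 * e.B * (√τ)⁻¹) := by gcongr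
      _ ≤ K' * Real.exp (-(lam * t)) * (1 + 2 * e.B * (√τ)⁻¹ + C2 * τ⁻¹) := by gcongr; linarith
      _ = _ := by ring
  · have := hpw 2 (by omega)
    unfold Ell.zH
    rw [norm_smul, Real.norm_of_nonneg hz0]
    calc _ ≤ e.zker lam t x y * (C2 * q ^ 2 / t) := by gcongr
      _ = (e.zker lam t x y * q ^ 2) * (C2 * t⁻¹) := by ring
      _ ≤ (K' * Real.exp (-(lam * t))) * (C2 * τ⁻¹) := by gcongr
      _ ≤ K' * Real.exp (-(lam * t)) * (1 + 2 * e.B * (√τ)⁻¹ + C2 * τ⁻¹) := by gcongr; linarith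
      _ = _ := by ring

end Kernel

end Part2

section Part3
set_option linter.unusedSectionVars false
set_option linter.style.haveILetI false
set_option synthInstance.maxHeartbeats 400000
set_option maxSynthPendingDepth 3

section Parametrix

variable {E : Type*} [NormedAddCommGroup E] [NormedSpace ℝ E] [FiniteDimensional ℝ E]
  [MeasureSpace E] [BorelSpace E] [(volume : Measure E).IsAddHaarMeasure]
variable {m : ℕ} (e : Ell E m)

theorem Ell.q_deriv (x y : E) :
    HasFDerivAt (fun x => e.b y (x - y) (x - y)) ((2:ℝ) • e.b y (x - y)) x := by
  have h1 : HasFDerivAt (fun x : E => x - y) (ContinuousLinearMap.id ℝ E) x :=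
    (hasFDerivAt_id x).sub_const y
  have h2 : HasFDerivAt (fun x => e.b y (x - y)) (e.b y) x := by
    exact ((e.b y).hasFDerivAt.comp x h1).congr_fderiv (ContinuousLinearMap.comp_id _)
  refine (h2.clm_apply h1).congr_fderiv ?_
  ext w
  simp [e.bsymm y w]
  ring

theorem Ell.zker_deriv (lam t : ℝ) (x y : E) :
    HasFDerivAt (fun x => e.zker lam t x y) (e.zD lam t x y) x := by
  have h1 := e.q_deriv x y
  have h2 : HasFDerivAt (fun x => -(e.b y (x - y) (x - y)) / t) (t⁻¹ • -((2:ℝ) • e.b y (x - y))) x := by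
    simpa [div_eq_mul_inv] using h1.neg.mul_const t⁻¹
  have h3 := (h2.exp.const_mul (Real.exp (-(lam * t)) * (t ^ m)⁻¹)).mul_const (e.a y)
  refine h3.congr_fderiv ?_
  ext w
  simp [Ell.zD, Ell.zker]
  ring

theorem Ell.zD_deriv (lam t : ℝ) (x y : E) :
    HasFDerivAt (fun x => e.zD lam t x y) (e.zH lam t x y) x := by
  have h1 : HasFDerivAt (fun x : E => x - y) (ContinuousLinearMap.id ℝ E) x :=
    (hasFDerivAt_id x).sub_const y
  have h2 : HasFDerivAt (fun x => e.b y (x - y)) (e.b y) x := by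
    exact ((e.b y).hasFDerivAt.comp x h1).congr_fderiv (ContinuousLinearMap.comp_id _)
  have h3 := ((e.zker_deriv lam t x y).mul_const (-2 / t)).smul h2
  refine h3.congr_fderiv ?_
  ext v w
  simp [Ell.zD, Ell.zH, Ell.pH]
  ring

noncomputable def nuT (E : Type*) [MeasureSpace E] (τ : ℝ) : Measure (ℝ × E) :=
  ((volume : Measure ℝ).restrict (Set.Ioi τ)).prod (volume : Measure E)

theorem nuT_eq {τ : ℝ} (hτ : 0 ≤ τ) : nuT E τ = (nu0 E).restrict (Set.Ioi τ ×ˢ Set.univ) := by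
  rw [nuT, nu0, ← Measure.prod_restrict, Measure.restrict_univ, Measure.restrict_restrict measurableSet_Ioi,
    Set.inter_eq_left.2 (Set.Ioi_subset_Ioi hτ)]

theorem nuT_ae (τ : ℝ) : ∀ᵐ p ∂(nuT E τ), τ < p.1 := by
  have : nuT E τ = (volume : Measure (ℝ × E)).restrict (Set.Ioi τ ×ˢ Set.univ) := by
    rw [nuT, Measure.volume_eq_prod, ← Measure.prod_restrict, Measure.restrict_univ]
  rw [this]
  filter_upwards [ae_restrict_mem (measurableSet_Ioi.prod MeasurableSet.univ)] with p hp
  exact hp.1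

instance (τ : ℝ) : SFinite (nuT E τ) := by unfold nuT; infer_instance

theorem Op_trunc_eq {τ : ℝ} (hτ : 0 ≤ τ) (k : ℝ → E → E → ℝ) (h : E → ℝ) (x : E) :
    Op (truncK τ k) h x = ∫ p, k p.1 x p.2 * h p.2 ∂(nuT E τ) := by
  rw [nuT_eq hτ, ← integral_indicator (measurableSet_Ioi.prod MeasurableSet.univ)]
  unfold Op truncK
  congr 1; ext p
  by_cases hp : τ < p.1 <;> simp [Set.indicator, hp]

theorem dom_int {lam : ℝ} (hl : 0 < lam) (τ C : ℝ) {f : E → ℝ} (fi : Integrable f) :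
    Integrable (fun p : ℝ × E => C * Real.exp (-(lam * p.1)) * |f p.2|) (nuT E τ) := by
  have h1 : Integrable (fun t : ℝ => C * Real.exp (-(lam * t))) (volume.restrict (Set.Ioi τ)) := by
    have := integrableOn_exp_mul_Ioi (a := -lam) (by linarith) τ
    simpa using Integrable.const_mul this C
  exact h1.mul_prod fi.abs

theorem Ell.bx_meas (x : E) : Continuous (fun p : ℝ × E => e.b p.2 (x - p.2)) := by
  have := e.bcont
  fun_prop

theorem Ell.z_meas (lam : ℝ) (x : E) : Measurable (fun p : ℝ × E => e.zker lam p.1 x p.2) :=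
  (e.zker_meas lam).comp (by fun_prop : Measurable (fun p : ℝ × E => (p.1, x, p.2)))

theorem Ell.zD_meas (lam τ : ℝ) (x : E) {f : E → ℝ} (fm : Measurable f) :
    AEStronglyMeasurable (fun p : ℝ × E => f p.2 • e.zD lam p.1 x p.2) (nuT E τ) := by
  have h0 := e.z_meas lam x
  have h1 : Measurable (fun p : ℝ × E => f p.2 * (e.zker lam p.1 x p.2 * (-2 / p.1))) := by fun_prop
  have h2 := h1.aestronglyMeasurable.smul (e.bx_meas x).aestronglyMeasurable (μ := nuT E τ)
  refine h2.congr (Eventually.of_forall fun p => ?_)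
  simp [Ell.zD, smul_smul]

theorem Ell.zH_meas (lam τ : ℝ) (x : E) {f : E → ℝ} (fm : Measurable f) :
    AEStronglyMeasurable (fun p : ℝ × E => f p.2 • e.zH lam p.1 x p.2) (nuT E τ) := by
  have h0 := e.z_meas lam x
  have h1 : Measurable (fun p : ℝ × E => f p.2 * (e.zker lam p.1 x p.2 * (4 / p.1 ^ 2))) := by fun_prop
  have h1' : Measurable (fun p : ℝ × E => f p.2 * (e.zker lam p.1 x p.2 * (2 / p.1))) := by fun_prop
  have c1 : Continuous (fun p : ℝ × E => (e.b p.2 (x - p.2)).smulRight (e.b p.2 (x - p.2))) :=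
    e.smulRight_cont.comp (by fun_prop : Continuous (fun p : ℝ × E => (x, p.2)))
  have c2 : Continuous (fun p : ℝ × E => e.b p.2) := e.bcont.comp continuous_snd
  have h2 := (h1.aestronglyMeasurable.smul c1.aestronglyMeasurable (μ := nuT E τ)).sub
    (h1'.aestronglyMeasurable.smul c2.aestronglyMeasurable (μ := nuT E τ))
  refine h2.congr (Eventually.of_forall fun p => ?_)
  simp [Ell.zH, Ell.pH, smul_smul, smul_sub]

structure XF (f : E → ℝ) : Prop where
  cont : Continuous f
  zero : Tendsto f (cocompact E) (𝓝 0)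
  int : Integrable f

theorem c0_bdd {f : E → ℝ} (hc : Continuous f) (h0 : Tendsto f (cocompact E) (𝓝 0)) :
    ∃ H, 0 ≤ H ∧ ∀ y, |f y| ≤ H := by
  have h1 : ∀ᶠ y in cocompact E, |f y| ≤ 1 := by
    have := h0.eventually (Metric.closedBall_mem_nhds 0 one_pos)
    filter_upwards [this] with y hy
    simpa [Real.norm_eq_abs] using hy
  obtain ⟨K, hK, hKs⟩ := Filter.mem_cocompact.1 h1
  obtain ⟨C, hC⟩ := hK.exists_bound_of_continuousOn hc.continuousOn
  refine ⟨max 1 C, by positivity, fun y => ?_⟩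
  by_cases hy : y ∈ K
  · exact (hC y hy).trans (le_max_right _ _)
  · exact (hKs hy : |f y| ≤ 1).trans (le_max_left _ _)

theorem XF.bdd {f : E → ℝ} (hf : XF f) : ∃ H, 0 ≤ H ∧ ∀ y, |f y| ≤ H := c0_bdd hf.cont hf.zero

noncomputable def Ell.M (g : E → ℝ) (x : E) : ℝ := e.l x (fderiv ℝ (fderiv ℝ g) x)

set_option maxHeartbeats 1000000 in
theorem Ell.gtau {lam : ℝ} (hl : 0 < lam) {τ : ℝ} (hτ : 0 < τ) {f : E → ℝ} (hf : XF f) :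
    ContDiff ℝ 2 (Op (truncK τ (e.zker lam)) f) ∧
    ∀ x, Integrable (fun p : ℝ × E => f p.2 • e.zH lam p.1 x p.2) (nuT E τ) ∧
      fderiv ℝ (fderiv ℝ (Op (truncK τ (e.zker lam)) f)) x =
      ∫ p, f p.2 • e.zH lam p.1 x p.2 ∂(nuT E τ) := by
  obtain ⟨C, hC, hb⟩ := e.zker_tau τ hτ
  have fm := hf.cont.measurable
  have hi := dom_int hl τ C hf.int
  set g := Op (truncK τ (e.zker lam)) f with hg
  set g1 : E → E →L[ℝ] ℝ := fun x => ∫ p, f p.2 • e.zD lam p.1 x p.2 ∂(nuT E τ) with hg1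
  set g2 : E → E →L[ℝ] E →L[ℝ] ℝ := fun x => ∫ p, f p.2 • e.zH lam p.1 x p.2 ∂(nuT E τ) with hg2
  have b1 : ∀ x, ∀ᵐ p ∂(nuT E τ), ‖f p.2 • e.zD lam p.1 x p.2‖ ≤ C * Real.exp (-(lam * p.1)) * |f p.2| := by
    intro x
    filter_upwards [nuT_ae τ] with p hp
    rw [norm_smul, mul_comm, Real.norm_eq_abs]
    exact mul_le_mul_of_nonneg_right (hb lam p.1 hp x p.2).2.1 (abs_nonneg _)
  have b2 : ∀ x, ∀ᵐ p ∂(nuT E τ), ‖f p.2 • e.zH lam p.1 x p.2‖ ≤ C * Real.exp (-(lam * p.1)) * |f p.2| := by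
    intro x
    filter_upwards [nuT_ae τ] with p hp
    rw [norm_smul, mul_comm, Real.norm_eq_abs]
    exact mul_le_mul_of_nonneg_right (hb lam p.1 hp x p.2).2.2 (abs_nonneg _)
  have b0 : ∀ x, ∀ᵐ p ∂(nuT E τ), ‖e.zker lam p.1 x p.2 * f p.2‖ ≤ C * Real.exp (-(lam * p.1)) * |f p.2| := by
    intro x
    filter_upwards [nuT_ae τ] with p hp
    rw [norm_mul, Real.norm_eq_abs, Real.norm_eq_abs, abs_of_nonneg (e.zker_nonneg (hτ.trans hp) _ _)]
    exact mul_le_mul_of_nonneg_right (hb lam p.1 hp x p.2).1 (abs_nonneg _)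
  have m0 : ∀ x, AEStronglyMeasurable (fun p : ℝ × E => e.zker lam p.1 x p.2 * f p.2) (nuT E τ) := by
    intro x
    have h0 := e.z_meas lam x
    exact (by fun_prop : Measurable (fun p : ℝ × E => e.zker lam p.1 x p.2 * f p.2)).aestronglyMeasurable
  have d1 : ∀ x, HasFDerivAt g (g1 x) x := by
    intro x
    have : HasFDerivAt (fun x => ∫ p, e.zker lam p.1 x p.2 * f p.2 ∂(nuT E τ)) (g1 x) x := by
      refine hasFDerivAt_integral_of_dominated_of_fderiv_le (s := Set.univ)
        (bound := fun p : ℝ × E => C * Real.exp (-(lam * p.1)) * |f p.2|)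
        (F' := fun x (p : ℝ × E) => f p.2 • e.zD lam p.1 x p.2) univ_mem
        (Eventually.of_forall m0) (Integrable.mono' hi (m0 x) (b0 x)) (e.zD_meas lam τ x fm) ?_ hi ?_
      · filter_upwards [nuT_ae τ] with p hp y _
        rw [norm_smul, mul_comm, Real.norm_eq_abs]
        exact mul_le_mul_of_nonneg_right (hb lam p.1 hp y p.2).2.1 (abs_nonneg _)
      · refine Eventually.of_forall fun p y _ => ?_
        exact (e.zker_deriv lam p.1 y p.2).mul_const (f p.2)
    refine this.congr_of_eventuallyEq (Eventually.of_forall fun x => ?_)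
    exact Op_trunc_eq hτ.le _ _ _
  have d2 : ∀ x, HasFDerivAt g1 (g2 x) x := by
    intro x
    refine hasFDerivAt_integral_of_dominated_of_fderiv_le (s := Set.univ)
        (bound := fun p : ℝ × E => C * Real.exp (-(lam * p.1)) * |f p.2|)
        (F := fun x (p : ℝ × E) => f p.2 • e.zD lam p.1 x p.2)
        (F' := fun x (p : ℝ × E) => f p.2 • e.zH lam p.1 x p.2) univ_mem
        (Eventually.of_forall fun x => e.zD_meas lam τ x fm) 
        (Integrable.mono' hi (e.zD_meas lam τ x fm) (b1 x)) (e.zH_meas lam τ x fm) ?_ hi ?_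
    · filter_upwards [nuT_ae τ] with p hp y _
      rw [norm_smul, mul_comm, Real.norm_eq_abs]
      exact mul_le_mul_of_nonneg_right (hb lam p.1 hp y p.2).2.2 (abs_nonneg _)
    · refine Eventually.of_forall fun p y _ => ?_
      exact (e.zD_deriv lam p.1 y p.2).const_smul (f p.2)
  have c2 : Continuous g2 := by
    refine continuous_of_dominated (bound := fun p : ℝ × E => C * Real.exp (-(lam * p.1)) * |f p.2|)
      (fun x => e.zH_meas lam τ x fm) b2 hi ?_
    refine Eventually.of_forall fun p => ?_
    have hz : Continuous (fun x => e.zker lam p.1 x p.2) :=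
      (e.zker_cont lam p.1).comp (by fun_prop : Continuous (fun x : E => (x, p.2)))
    have c1 : Continuous (fun x : E => (e.b p.2 (x - p.2)).smulRight (e.b p.2 (x - p.2))) :=
      e.smulRight_cont.comp (by fun_prop : Continuous (fun x : E => (x, p.2)))
    have c3 : Continuous (fun x : E => (4 / p.1 ^ 2) • (e.b p.2 (x - p.2)).smulRight (e.b p.2 (x - p.2)) - (2 / p.1) • e.b p.2) :=
      (c1.const_smul (4 / p.1 ^ 2)).sub continuous_const
    have c4 : Continuous (fun x : E => e.pH p.1 x p.2) := c3
    have c5 : Continuous (fun x : E => e.zH lam p.1 x p.2) := hz.smul c4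
    exact c5.const_smul (f p.2)
  have f1 : fderiv ℝ g = g1 := by ext1 x; exact (d1 x).fderiv
  have f2 : fderiv ℝ g1 = g2 := by ext1 x; exact (d2 x).fderiv
  refine ⟨?_, fun x => ⟨Integrable.mono' hi (e.zH_meas lam τ x fm) (b2 x), ?_⟩⟩
  · have hg1c : ContDiff ℝ 1 g1 := by
      rw [contDiff_one_iff_fderiv]
      exact ⟨fun x => (d2 x).differentiableAt, f2 ▸ c2⟩
    have : (2 : WithTop ℕ∞) = 1 + 1 := by norm_num
    rw [this, contDiff_succ_iff_fderiv]
    exact ⟨fun x => (d1 x).differentiableAt, by simp, f1 ▸ hg1c⟩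
  · rw [f1, f2]

end Parametrix

end Part3

section Part4
set_option linter.unusedSectionVars false
set_option linter.style.haveILetI false
set_option synthInstance.maxHeartbeats 400000
set_option maxSynthPendingDepth 3

section Parametrix2

variable {E : Type*} [NormedAddCommGroup E] [NormedSpace ℝ E] [FiniteDimensional ℝ E]
  [MeasureSpace E] [BorelSpace E] [(volume : Measure E).IsAddHaarMeasure]
variable {m : ℕ} (e : Ell E m)

noncomputable def Ell.zt (lam t : ℝ) (x y : E) : ℝ :=
  e.zker lam t x y * (e.b y (x - y) (x - y) / t ^ 2 - m / t - lam)

theorem Ell.heat (lam t : ℝ) (x y : E) :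
    lam * e.zker lam t x y - e.l y (e.zH lam t x y) = - e.zt lam t x y := by
  have h1 := e.lb y
  have h2 := e.lbb y (x - y)
  unfold Ell.zH Ell.pH Ell.zt
  rw [ContinuousLinearMap.map_smul, ContinuousLinearMap.map_sub, ContinuousLinearMap.map_smul,
    ContinuousLinearMap.map_smul, h1, h2]
  simp only [smul_eq_mul]
  ring

theorem Ell.zt_deriv (lam : ℝ) {t : ℝ} (ht : 0 < t) (x y : E) :
    HasDerivAt (fun t => e.zker lam t x y) (e.zt lam t x y) t := by
  unfold Ell.zt Ell.zker
  set q := e.b y (x - y) (x - y)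
  have h1 : HasDerivAt (fun t : ℝ => Real.exp (-(lam * t))) (Real.exp (-(lam * t)) * (-(lam * 1))) t :=
    (((hasDerivAt_id t).const_mul lam).neg).exp
  have h2 : HasDerivAt (fun t : ℝ => (t ^ m)⁻¹) (-(m * t ^ (m - 1)) / (t ^ m) ^ 2) t :=
    (hasDerivAt_pow m t).inv (by positivity)
  have h3 : HasDerivAt (fun t : ℝ => Real.exp (-q / t)) (Real.exp (-q / t) * (q / t ^ 2)) t := by
    have : HasDerivAt (fun t : ℝ => -q / t) (q / t ^ 2) t := by
      have := (hasDerivAt_inv ht.ne').const_mul (-q)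
      refine this.congr_deriv ?_
      field_simp
    exact this.exp
  refine (((h1.mul h2).mul h3).mul_const (e.a y)).congr_deriv ?_
  have h4 : -(m * t ^ (m - 1)) / (t ^ m) ^ 2 = (t ^ m)⁻¹ * (-(m / t)) := by
    rcases m with _ | k
    · simp
    · simp only [Nat.add_sub_cancel]
      field_simp
      ring
  rw [h4]
  simp only [Pi.mul_apply]
  ring

theorem Ell.zker_tendsto {lam : ℝ} (hl : 0 < lam) (x y : E) :
    Tendsto (fun t => e.zker lam t x y) atTop (𝓝 0) := by
  obtain ⟨C, hC, hb⟩ := e.zker_tau 1 one_pos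
  have h1 : Tendsto (fun t : ℝ => C * Real.exp (-(lam * t))) atTop (𝓝 0) := by
    have : Tendsto (fun t : ℝ => Real.exp (-(lam * t))) atTop (𝓝 0) :=
      Real.tendsto_exp_neg_atTop_nhds_zero.comp (tendsto_id.const_mul_atTop hl)
    simpa using this.const_mul C
  refine tendsto_of_tendsto_of_tendsto_of_le_of_le' tendsto_const_nhds h1 ?_ ?_
  · filter_upwards [eventually_gt_atTop 0] with t ht using e.zker_nonneg ht x y
  · filter_upwards [eventually_gt_atTop 1] with t ht using (hb lam t ht x y).1

noncomputable def Ell.Gam (lam τ : ℝ) (f : E → ℝ) (x : E) : ℝ := ∫ y, e.zker lam τ x y * f y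

set_option maxHeartbeats 1000000 in
theorem Ell.gtau_eq {lam : ℝ} (hl : 0 < lam) {τ : ℝ} (hτ : 0 < τ) {f : E → ℝ} (hf : XF f) (x : E) :
    lam * Op (truncK τ (e.zker lam)) f x - e.M (Op (truncK τ (e.zker lam)) f) x =
      e.Gam lam τ f x - Op (truncK τ (e.rker lam)) f x := by
  obtain ⟨C, hC, hb⟩ := e.zker_tau τ hτ
  have fm := hf.cont.measurable
  have hi := dom_int hl τ C hf.int
  obtain ⟨hH, hH2⟩ := (e.gtau hl hτ hf).2 x
  have hz : Integrable (fun p : ℝ × E => e.zker lam p.1 x p.2 * f p.2) (nuT E τ) := by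
    have h0 := e.z_meas lam x
    refine Integrable.mono' hi (by fun_prop : Measurable (fun p : ℝ × E => e.zker lam p.1 x p.2 * f p.2)).aestronglyMeasurable ?_
    filter_upwards [nuT_ae τ] with p hp
    rw [norm_mul, Real.norm_eq_abs, Real.norm_eq_abs, abs_of_nonneg (e.zker_nonneg (hτ.trans hp) _ _)]
    exact mul_le_mul_of_nonneg_right (hb lam p.1 hp x p.2).1 (abs_nonneg _)
  have hlx : Integrable (fun p : ℝ × E => e.l x (e.zH lam p.1 x p.2) * f p.2) (nuT E τ) := by
    refine ((e.l x).integrable_comp hH).congr (Eventually.of_forall fun p => ?_)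
    dsimp only
    rw [ContinuousLinearMap.map_smul, smul_eq_mul, mul_comm]
  have hzt : Integrable (fun p : ℝ × E => e.zt lam p.1 x p.2 * f p.2) (nuT E τ) := by
    have h0 := e.z_meas lam x
    have hq : Measurable (fun p : ℝ × E => e.b p.2 (x - p.2) (x - p.2)) := by
      have := e.bcont
      exact (by fun_prop : Continuous (fun p : ℝ × E => e.b p.2 (x - p.2) (x - p.2))).measurable
    refine Integrable.mono' (hi.const_mul (lam + e.B))
      (by unfold Ell.zt; fun_prop : Measurable (fun p : ℝ × E => e.zt lam p.1 x p.2 * f p.2)).aestronglyMeasurable ?_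
    filter_upwards [nuT_ae τ] with p hp
    obtain ⟨c1, -, c2⟩ := hb lam p.1 hp x p.2
    have c3 := e.bdd p.2 (e.zH lam p.1 x p.2)
    have c4 := e.heat lam p.1 x p.2
    have c5 := e.zker_nonneg (lam := lam) (hτ.trans hp) x p.2
    have hB := e.B0
    rw [norm_mul, Real.norm_eq_abs, Real.norm_eq_abs, ← mul_assoc]
    refine mul_le_mul_of_nonneg_right ?_ (abs_nonneg _)
    rw [← abs_neg, ← c4]
    refine (abs_sub _ _).trans ?_
    rw [abs_of_nonneg (by positivity)]
    have : |e.l p.2 (e.zH lam p.1 x p.2)| ≤ e.B * (C * Real.exp (-(lam * p.1))) :=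
      c3.trans (by gcongr)
    nlinarith
  have hr : Integrable (fun p : ℝ × E => e.rker lam p.1 x p.2 * f p.2) (nuT E τ) := by
    refine ((hlx.sub (hz.const_mul lam)).sub hzt).congr (Eventually.of_forall fun p => ?_)
    have c4 := e.heat lam p.1 x p.2
    simp only [Pi.sub_apply, Ell.rker]
    linear_combination (-f p.2) * c4
  have hM : e.M (Op (truncK τ (e.zker lam)) f) x = ∫ p, e.l x (e.zH lam p.1 x p.2) * f p.2 ∂(nuT E τ) := by
    unfold Ell.M
    rw [hH2, ← (e.l x).integral_comp_comm hH]
    congr 1; ext p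
    rw [ContinuousLinearMap.map_smul, smul_eq_mul, mul_comm]
  have hG : e.Gam lam τ f x = ∫ p, - (e.zt lam p.1 x p.2 * f p.2) ∂(nuT E τ) := by
    rw [integral_neg]
    have hzt' := hzt
    unfold nuT at hzt' ⊢
    rw [integral_prod_symm _ hzt', ← integral_neg]
    unfold Ell.Gam
    refine integral_congr_ae ?_
    filter_upwards [hzt'.prod_left_ae] with y hy
    have hder := integral_Ioi_of_hasDerivAt_of_tendsto (a := τ) (f := fun t => e.zker lam t x y * f y)
      (f' := fun t => e.zt lam t x y * f y) (m := 0) ?_ ?_ hy ?_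
    · rw [hder]; ring
    · exact ((e.zt_deriv lam hτ x y).mul_const _).continuousAt.continuousWithinAt
    · intro t ht
      exact (e.zt_deriv lam (hτ.trans ht) x y).mul_const _
    · simpa using (e.zker_tendsto hl x y).mul_const (f y)
  have hztn : Integrable (fun p : ℝ × E => -(e.zt lam p.1 x p.2 * f p.2)) (nuT E τ) := hzt.neg
  rw [hM, hG, Op_trunc_eq hτ.le, Op_trunc_eq hτ.le, ← integral_const_mul, ← integral_sub (hz.const_mul _) hlx,
    ← integral_sub hztn hr]
  congr 1; ext p
  have c4 := e.heat lam p.1 x p.2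
  simp only [Ell.rker]
  linear_combination (f p.2) * c4

noncomputable def Ell.FF (f : E → ℝ) (y ζ : E) : ℝ := Real.exp (-(e.b y ζ ζ)) * (e.a y * f y)

theorem Ell.Gam_eq {lam τ : ℝ} (hτ : 0 < τ) (f : E → ℝ) (x : E) :
    e.Gam lam τ f x = Real.exp (-(lam * τ)) * ∫ ζ, e.FF f (x - √τ • ζ) ζ := by
  have hs : 0 < √τ := Real.sqrt_pos.2 hτ
  rw [← scale_integral e.hdim hτ, ← integral_const_mul]
  unfold Ell.Gam
  rw [← integral_sub_left_eq_self _ volume x]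
  congr 1; ext ξ
  have h1 : √τ • (√τ)⁻¹ • ξ = ξ := by rw [smul_smul, mul_inv_cancel₀ hs.ne', one_smul]
  have h2 : (√τ)⁻¹ * ((√τ)⁻¹ * e.b (x - ξ) ξ ξ) = e.b (x - ξ) ξ ξ / τ := by
    rw [← mul_assoc, ← mul_inv, Real.mul_self_sqrt hτ.le]; ring
  unfold Ell.FF Ell.zker
  simp only [h1, sub_sub_cancel, map_smul, _root_.smul_apply, smul_eq_mul, h2, neg_div]
  ring

theorem Ell.FF_int (f : E → ℝ) (x : E) : ∫ ζ, e.FF f x ζ = f x := by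
  unfold Ell.FF
  rw [integral_mul_const]
  have : e.a x * e.cc x = 1 := inv_mul_cancel₀ (e.cc_pos x).ne'
  change e.cc x * _ = _
  linear_combination (f x) * this

set_option maxHeartbeats 1000000 in
theorem Ell.Gam_tendsto (lam : ℝ) {f : E → ℝ} (hf : XF f) :
    ∀ ε > 0, ∀ᶠ τ in 𝓝[>] (0:ℝ), ∀ x, |e.Gam lam τ f x - f x| ≤ ε := by
  intro ε hε
  obtain ⟨H, hH0, hH⟩ := hf.bdd
  obtain ⟨A, hA, ha⟩ := e.a_bdd
  have hac := e.a_cont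
  have hbc := e.bcont
  have hfc := hf.cont
  have key : Tendsto (fun p : ℝ × E => ∫ ζ, (e.FF f (p.2 - √p.1 • ζ) ζ - e.FF f p.2 ζ)) (𝓝[>] (0:ℝ) ×ˢ ⊤) (𝓝 (∫ _ζ : E, (0:ℝ))) := by
    have hb : ∀ y ζ, |e.FF f y ζ| ≤ A * H * Real.exp (-(e.c0 * ‖ζ‖ ^ 2)) := by
      intro y ζ
      unfold Ell.FF
      rw [abs_mul, abs_mul, abs_of_pos (Real.exp_pos _), abs_of_pos (e.a_pos y), mul_comm]
      have := e.exp_le y ζ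
      have := ha y
      have := hH y
      gcongr
    haveI : (⊤ : Filter E).IsCountablyGenerated := by
      rw [← Filter.principal_univ]; infer_instance
    refine tendsto_integral_filter_of_dominated_convergence
      (fun ζ => 2 * (A * H * Real.exp (-(e.c0 * ‖ζ‖ ^ 2)))) ?_ ?_
      (((gauss_integrable e.c0pos e.hdim).const_mul _).const_mul _) ?_
    · refine Eventually.of_forall fun p => ?_
      exact (by unfold Ell.FF; fun_prop : Continuous (fun ζ => (e.FF f (p.2 - √p.1 • ζ) ζ - e.FF f p.2 ζ))).aestronglyMeasurable
    · refine Eventually.of_forall fun p => Eventually.of_forall fun ζ => ?_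
      rw [Real.norm_eq_abs]
      refine (abs_sub _ _).trans ?_
      linarith [hb (p.2 - √p.1 • ζ) ζ, hb p.2 ζ]
    · refine Eventually.of_forall fun ζ => ?_
      have hc : Continuous (fun y => e.FF f y ζ) := by unfold Ell.FF; fun_prop
      have h0 : Tendsto (fun y => e.FF f y ζ) (cocompact E) (𝓝 0) := by
        have h1 : Tendsto (fun y => A * |f y|) (cocompact E) (𝓝 0) := by
          simpa using hf.zero.abs.const_mul A
        refine squeeze_zero_norm (fun y => ?_) h1
        unfold Ell.FF
        rw [Real.norm_eq_abs, abs_mul, abs_mul, abs_of_pos (Real.exp_pos _), abs_of_pos (e.a_pos y)]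
        have h2 := ha y
        have h3 : Real.exp (-(e.b y ζ ζ)) ≤ 1 := by
          refine (e.exp_le y ζ).trans (Real.exp_le_one_iff.2 ?_)
          have := e.c0pos
          have : 0 ≤ e.c0 * ‖ζ‖ ^ 2 := by positivity
          linarith
        have h4 := e.a_pos y
        calc _ ≤ 1 * (A * |f y|) := by gcongr
          _ = _ := one_mul _
      have hu := hc.uniformContinuous_of_tendsto_cocompact h0
      rw [Metric.tendsto_nhds]
      intro δ hδ
      obtain ⟨r, hr, hru⟩ := Metric.uniformContinuous_iff.1 hu δ hδ
      have h5 : ∀ᶠ τ in 𝓝[>] (0:ℝ), ‖√τ • ζ‖ < r := by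
        have : Tendsto (fun τ : ℝ => ‖√τ • ζ‖) (𝓝[>] 0) (𝓝 0) := by
          have hc' : Continuous (fun τ : ℝ => ‖√τ • ζ‖) := by fun_prop
          have := hc'.tendsto 0
          simp only [Real.sqrt_zero, zero_smul, norm_zero] at this
          exact this.mono_left nhdsWithin_le_nhds
        exact this.eventually_lt_const hr
      have h6 := h5.prod_inl (⊤ : Filter E)
      filter_upwards [h6] with p hp
      rw [dist_zero_right, ← dist_eq_norm]
      apply hru
      rw [dist_eq_norm]
      simpa [sub_sub_cancel_left] using hp
  rw [integral_zero] at key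
  have k1 := (Metric.tendsto_nhds.1 key) (ε / 2) (by positivity)
  have k1' : ∀ᶠ τ in 𝓝[>] (0:ℝ), ∀ x, |∫ ζ, (e.FF f (x - √τ • ζ) ζ - e.FF f x ζ)| < ε / 2 := by
    rw [Filter.eventually_prod_iff] at k1
    obtain ⟨pa, ha', pb, hb', hab⟩ := k1
    filter_upwards [ha'] with τ hτ x
    have := hab hτ (Filter.eventually_top.1 hb' x)
    simpa using this
  have k2 : ∀ᶠ τ in 𝓝[>] (0:ℝ), |Real.exp (-(lam * τ)) - 1| * H < ε / 4 ∧ Real.exp (-(lam * τ)) < 3 / 2 := by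
    have c1 : Continuous (fun τ : ℝ => |Real.exp (-(lam * τ)) - 1| * H) := by fun_prop
    have c2 : Continuous (fun τ : ℝ => Real.exp (-(lam * τ))) := by fun_prop
    have t1 := c1.tendsto 0
    have t2 := c2.tendsto 0
    simp at t1 t2
    exact ((t1.eventually_lt_const (by positivity)).and (t2.eventually_lt_const (by norm_num))).filter_mono
      nhdsWithin_le_nhds
  filter_upwards [k1', k2, self_mem_nhdsWithin] with τ h1 h2 hτ x
  have hint : ∀ g : E → E, Continuous g → Integrable (fun ζ => e.FF f (g ζ) ζ) := by
    intro g hg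
    refine Integrable.mono' ((gauss_integrable e.c0pos e.hdim).const_mul (A * H))
      (by unfold Ell.FF; fun_prop : Continuous (fun ζ => e.FF f (g ζ) ζ)).aestronglyMeasurable
      (Eventually.of_forall fun ζ => ?_)
    unfold Ell.FF
    rw [Real.norm_eq_abs, abs_mul, abs_mul, abs_of_pos (Real.exp_pos _), abs_of_pos (e.a_pos _), mul_comm]
    have := e.exp_le (g ζ) ζ
    have := ha (g ζ)
    have := hH (g ζ)
    gcongr
  have h3 := h1 x
  rw [integral_sub (hint _ (by fun_prop)) (hint _ (by fun_prop)), e.FF_int] at h3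
  rw [e.Gam_eq hτ]
  set I := ∫ ζ, e.FF f (x - √τ • ζ) ζ
  set s := Real.exp (-(lam * τ))
  have : s * I - f x = s * (I - f x) + (s - 1) * f x := by ring
  rw [this]
  have hs : 0 < s := Real.exp_pos _
  refine (abs_add_le _ _).trans ?_
  rw [abs_mul, abs_mul, abs_of_pos hs]
  have h4 : |s - 1| * |f x| ≤ |s - 1| * H := by gcongr; exact hH x
  nlinarith [h2.1, h2.2, abs_nonneg (I - f x)]

/-- approximate resolvent relation: `lam g - M g = f` -/
def Ell.Res (lam : ℝ) (f g : E → ℝ) : Prop :=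
  ∀ ε > 0, ∃ g1 : E → ℝ, ContDiff ℝ 2 g1 ∧ Tendsto g1 (cocompact E) (𝓝 0) ∧
    (∀ x, |g1 x - g x| ≤ ε) ∧ ∀ x, |lam * g1 x - e.M g1 x - f x| ≤ ε

theorem Ell.Res_step {lam : ℝ} (hl : 1 < lam) {f : E → ℝ} (hf : XF f) :
    e.Res lam (fun x => f x - Op (e.rker lam) f x) (Op (e.zker lam) f) := by
  intro ε hε
  obtain ⟨H, hH0, hH⟩ := hf.bdd
  obtain ⟨C, hC, hdom⟩ := e.kernels_dom
  obtain ⟨hz, hr⟩ := hdom lam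
  have hΦ : GoodPhi (PhiK m (lam - 1) C : ℝ × E → ℝ) := PhiK_good e.hdim (by linarith) C
  have fm := hf.cont.measurable
  have k1 := e.Gam_tendsto lam hf (ε / 2) (by positivity)
  have k2 : ∀ᶠ τ in 𝓝[>] (0:ℝ), (∫ p, tailPhi τ (PhiK m (lam - 1) C) p ∂(nu0 E)) * H < ε / 2 := by
    have := (tail_tendsto hΦ).mul_const H
    rw [zero_mul] at this
    exact this.eventually_lt_const (by positivity)
  obtain ⟨τ, h1, h2, hτ⟩ := (k1.and (k2.and self_mem_nhdsWithin)).exists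
  have hτ' : 0 < τ := hτ
  refine ⟨Op (truncK τ (e.zker lam)) f, (e.gtau (by linarith) hτ' hf).1, ?_, fun x => ?_, fun x => ?_⟩
  · exact Op_zero_at_infty hΦ (hz.trunc τ) fm hH hf.zero
  · rw [abs_sub_comm]
    have := Op_trunc_diff hΦ hz fm hH τ x
    linarith
  · rw [e.gtau_eq (by linarith) hτ' hf]
    have h3 := Op_trunc_diff hΦ hr fm hH τ x
    have h4 := h1 x
    have : e.Gam lam τ f x - Op (truncK τ (e.rker lam)) f x - (f x - Op (e.rker lam) f x) =
      (e.Gam lam τ f x - f x) + (Op (e.rker lam) f x - Op (truncK τ (e.rker lam)) f x) := by ring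
    rw [this]
    refine (abs_add_le _ _).trans ?_
    linarith

end Parametrix2

end Part4

section Part5
set_option linter.unusedSectionVars false
set_option linter.style.haveILetI false
set_option synthInstance.maxHeartbeats 400000
set_option maxSynthPendingDepth 3

section Resolvent

variable {E : Type*} [NormedAddCommGroup E] [NormedSpace ℝ E] [FiniteDimensional ℝ E]
  [MeasureSpace E] [BorelSpace E] [(volume : Measure E).IsAddHaarMeasure]
variable {m : ℕ} (e : Ell E m)

theorem fd1 {f : E → ℝ} (hf : ContDiff ℝ 2 f) : Differentiable ℝ f := hf.differentiable (by norm_num)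

theorem fd1c {f : E → ℝ} (hf : ContDiff ℝ 2 f) : ContDiff ℝ 1 (fderiv ℝ f) :=
  hf.fderiv_right (by norm_num)

theorem fd2 {f : E → ℝ} (hf : ContDiff ℝ 2 f) : Differentiable ℝ (fderiv ℝ f) :=
  (fd1c hf).differentiable (by norm_num)

theorem fd2c {f : E → ℝ} (hf : ContDiff ℝ 2 f) : Continuous (fderiv ℝ (fderiv ℝ f)) :=
  (fd1c hf).continuous_fderiv (by norm_num)

theorem fd2_eq {f : E → ℝ} {f1 : E → E →L[ℝ] ℝ} {f2 : E → E →L[ℝ] E →L[ℝ] ℝ}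
    (h1 : ∀ x, HasFDerivAt f (f1 x) x) (h2 : ∀ x, HasFDerivAt f1 (f2 x) x) (x : E) :
    fderiv ℝ (fderiv ℝ f) x = f2 x := by
  have : fderiv ℝ f = f1 := by ext1 x; exact (h1 x).fderiv
  rw [this]; exact (h2 x).fderiv

theorem Ell.M_sub {f g : E → ℝ} (hf : ContDiff ℝ 2 f) (hg : ContDiff ℝ 2 g) (x : E) :
    e.M (fun x => f x - g x) x = e.M f x - e.M g x := by
  unfold Ell.M
  rw [fd2_eq (fun x => (fd1 hf x).hasFDerivAt.fun_sub (fd1 hg x).hasFDerivAt)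
    (fun x => (fd2 hf x).hasFDerivAt.fun_sub (fd2 hg x).hasFDerivAt), ContinuousLinearMap.map_sub]

theorem Ell.M_add {f g : E → ℝ} (hf : ContDiff ℝ 2 f) (hg : ContDiff ℝ 2 g) (x : E) :
    e.M (fun x => f x + g x) x = e.M f x + e.M g x := by
  unfold Ell.M
  rw [fd2_eq (fun x => (fd1 hf x).hasFDerivAt.fun_add (fd1 hg x).hasFDerivAt)
    (fun x => (fd2 hf x).hasFDerivAt.fun_add (fd2 hg x).hasFDerivAt), ContinuousLinearMap.map_add]

theorem Ell.M_smul {f : E → ℝ} (hf : ContDiff ℝ 2 f) (c : ℝ) (x : E) :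
    e.M (fun x => c * f x) x = c * e.M f x := by
  unfold Ell.M
  rw [fd2_eq (fun x => (fd1 hf x).hasFDerivAt.const_mul c)
    (fun x => (fd2 hf x).hasFDerivAt.const_smul c), ContinuousLinearMap.map_smul, smul_eq_mul]

theorem Ell.M_cont {f : E → ℝ} (hf : ContDiff ℝ 2 f) : Continuous (e.M f) :=
  e.l_cont.comp (continuous_id.prodMk (fd2c hf))

theorem fd2_symm {f : E → ℝ} (hf : ContDiff ℝ 2 f) (x u w : E) :
    fderiv ℝ (fderiv ℝ f) x u w = fderiv ℝ (fderiv ℝ f) x w u :=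
  (hf.contDiffAt.isSymmSndFDerivAt (by simp)) u w

theorem snd_test {f : E → ℝ} (hf : ContDiff ℝ 2 f) {x : E} (hx : ∀ y, f x ≤ f y) (u : E) :
    0 ≤ fderiv ℝ (fderiv ℝ f) x u u := by
  by_contra hneg
  push Not at hneg
  set φ : ℝ → ℝ := fun t => f (x + t • u) with hφ
  have hlin : ∀ t : ℝ, HasDerivAt (fun t : ℝ => x + t • u) u t := by
    intro t
    simpa using ((hasDerivAt_id t).smul_const u).const_add x
  have d1 : ∀ t : ℝ, HasDerivAt φ (fderiv ℝ f (x + t • u) u) t := fun t =>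
    ((fd1 hf (x + t • u)).hasFDerivAt).comp_hasDerivAt t (hlin t)
  have d2 : ∀ t : ℝ, HasDerivAt (fun t : ℝ => fderiv ℝ f (x + t • u) u) (fderiv ℝ (fderiv ℝ f) (x + t • u) u u) t := by
    intro t
    have := ((fd2 hf (x + t • u)).hasFDerivAt).comp_hasDerivAt t (hlin t)
    simpa using this.clm_apply (hasDerivAt_const t u)
  have e1 : deriv φ = fun t : ℝ => fderiv ℝ f (x + t • u) u := by ext t; exact (d1 t).deriv
  have e2 : deriv (deriv φ) 0 = fderiv ℝ (fderiv ℝ f) x u u := by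
    rw [e1, (d2 0).deriv]; simp
  have hmin : IsLocalMin φ 0 := Eventually.of_forall fun t => by simpa [hφ] using hx (x + t • u)
  have hmax : IsLocalMin (fun t => -φ t) 0 := by
    apply isLocalMin_of_deriv_deriv_pos
    · have : deriv (fun t => -φ t) = fun t => - deriv φ t := by ext t; exact deriv.fun_neg
      rw [this]
      have : deriv (fun t => - deriv φ t) 0 = - deriv (deriv φ) 0 := deriv.fun_neg
      rw [this, e2]; linarith
    · have : deriv (fun t => -φ t) 0 = - deriv φ 0 := deriv.fun_neg
      rw [this, hmin.deriv_eq_zero, neg_zero]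
    · exact (d1 0).continuousAt.neg
  have hconst : φ =ᶠ[𝓝 0] fun _ => φ 0 := by
    filter_upwards [hmin, hmax] with t h1 h2
    exact le_antisymm (by linarith [show -φ 0 ≤ -φ t from h2]) h1
  have : deriv (deriv φ) 0 = 0 := by
    have h3 : deriv φ =ᶠ[𝓝 0] deriv (fun _ => φ 0) := hconst.deriv
    rw [h3.deriv_eq]
    simp
  rw [e2] at this
  linarith

theorem Ell.max_princ {lam β : ℝ} (hl : 0 < lam) (hβ : 0 ≤ β) {w : E → ℝ} (hw : ContDiff ℝ 2 w)
    (h0 : Tendsto w (cocompact E) (𝓝 0)) (h : ∀ x, -β ≤ lam * w x - e.M w x) (x : E) : -(β / lam) ≤ w x := by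
  by_contra hx
  push Not at hx
  have hx0 : w x < 0 := hx.trans_le (by have : 0 ≤ β / lam := by positivity
                                        linarith)
  obtain ⟨x1, h1⟩ := hw.continuous.exists_forall_le' x ((h0.eventually_const_lt hx0).mono fun _ h => h.le)
  have h2 : 0 ≤ e.M w x1 := e.pos x1 _ (fd2_symm hw x1) (snd_test hw h1)
  have h3 := h x1
  have h4 := h1 x
  have h5 : lam * w x1 < lam * (-(β / lam)) := mul_lt_mul_of_pos_left (h4.trans_lt hx) hl
  have h6 : lam * (-(β / lam)) = -β := by field_simp
  linarith

variable {e}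

theorem Ell.Res.mono {lam β : ℝ} (hl : 0 < lam) (hβ : 0 ≤ β) {f1 g1 f2 g2 : E → ℝ} (h1 : e.Res lam f1 g1)
    (h2 : e.Res lam f2 g2) (hf : ∀ x, f1 x ≤ f2 x + β) (x : E) : g1 x ≤ g2 x + β / lam := by
  have key : ∀ ε > 0, g1 x ≤ g2 x + β / lam + ε * (2 / lam + 2) := by
    intro ε hε
    obtain ⟨u1, c1, z1, a1, b1⟩ := h1 ε hε
    obtain ⟨u2, c2, z2, a2, b2⟩ := h2 ε hε
    have := e.max_princ hl (β := β + 2 * ε) (by positivity) (w := fun x => u2 x - u1 x) (c2.sub c1)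
      (by simpa using z2.sub z1) (fun y => by
        rw [e.M_sub c2 c1]
        have := abs_le.1 (b1 y)
        have := abs_le.1 (b2 y)
        have := hf y
        nlinarith) x
    have h3 := abs_le.1 (a1 x)
    have h4 := abs_le.1 (a2 x)
    have h5 : (β + 2 * ε) / lam = β / lam + ε * (2 / lam) := by ring
    rw [h5] at this
    linarith
  by_contra hcon
  push Not at hcon
  set d := g1 x - (g2 x + β / lam)
  have hd : 0 < d := by simp only [d]; linarith
  have hc : 0 < 2 / lam + 2 := by positivity
  have := key (d / (2 * (2 / lam + 2))) (by positivity)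
  have h6 : d / (2 * (2 / lam + 2)) * (2 / lam + 2) = d / 2 := by field_simp
  rw [h6] at this
  simp only [d] at this hd
  linarith

theorem Ell.Res.close {lam β : ℝ} (hl : 0 < lam) (hβ : 0 ≤ β) {f1 g1 f2 g2 : E → ℝ} (h1 : e.Res lam f1 g1)
    (h2 : e.Res lam f2 g2) (hf : ∀ x, |f1 x - f2 x| ≤ β) (x : E) : |g1 x - g2 x| ≤ β / lam := by
  have a := h1.mono hl hβ h2 (fun x => by linarith [(abs_le.1 (hf x)).2]) x
  have b := h2.mono hl hβ h1 (fun x => by linarith [(abs_le.1 (hf x)).1]) x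
  rw [abs_le]; constructor <;> linarith

theorem Ell.Res.zero (lam : ℝ) : e.Res lam (fun _ => 0) (fun _ => 0) := by
  intro ε hε
  refine ⟨fun _ => 0, contDiff_const, tendsto_const_nhds, fun x => by simpa using hε.le, fun x => ?_⟩
  have : e.M (fun _ => 0) x = 0 := by
    unfold Ell.M; simp
  simp [this, hε.le]

theorem Ell.Res.nonneg {lam : ℝ} (hl : 0 < lam) {f g : E → ℝ} (h : e.Res lam f g)
    (hf : ∀ x, 0 ≤ f x) (x : E) : 0 ≤ g x := by
  simpa using (Ell.Res.zero lam).mono hl le_rfl h (fun x => by simpa using hf x) x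

theorem Ell.Res.bound {lam β : ℝ} (hl : 0 < lam) (hβ : 0 ≤ β) {f g : E → ℝ} (h : e.Res lam f g)
    (hf : ∀ x, |f x| ≤ β) (x : E) : |g x| ≤ β / lam := by
  simpa using h.close hl hβ (Ell.Res.zero lam) (fun x => by simpa using hf x) x

theorem Ell.Res.of_limit {lam : ℝ} (hl : 0 < lam) {f g : E → ℝ}
    (h : ∀ ε > 0, ∃ f' g', e.Res lam f' g' ∧ (∀ x, |f' x - f x| ≤ ε) ∧ ∀ x, |g' x - g x| ≤ ε) :
    e.Res lam f g := by
  intro ε hε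
  obtain ⟨f', g', hr, hf, hg⟩ := h (ε / 2) (by positivity)
  obtain ⟨u, c, z, a, b⟩ := hr (ε / 2) (by positivity)
  refine ⟨u, c, z, fun x => ?_, fun x => ?_⟩
  · have := abs_sub_le (u x) (g' x) (g x)
    linarith [a x, hg x]
  · have := abs_sub_le (lam * u x - e.M u x) (f' x) (f x)
    linarith [b x, hf x]

theorem Ell.Res.add {lam : ℝ} {f1 g1 f2 g2 : E → ℝ} (h1 : e.Res lam f1 g1)
    (h2 : e.Res lam f2 g2) : e.Res lam (fun x => f1 x + f2 x) (fun x => g1 x + g2 x) := by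
  intro ε hε
  obtain ⟨u1, c1, z1, a1, b1⟩ := h1 (ε / 2) (by positivity)
  obtain ⟨u2, c2, z2, a2, b2⟩ := h2 (ε / 2) (by positivity)
  refine ⟨fun x => u1 x + u2 x, c1.add c2, by simpa using z1.add z2, fun x => ?_, fun x => ?_⟩
  · have h3 := abs_le.1 (a1 x)
    have h4 := abs_le.1 (a2 x)
    rw [abs_le]; constructor <;> linarith
  · rw [e.M_add c1 c2]
    have h3 := abs_le.1 (b1 x)
    have h4 := abs_le.1 (b2 x)
    rw [abs_le]; constructor <;> nlinarith

theorem Ell.Res.smul {lam : ℝ} {f g : E → ℝ} (h : e.Res lam f g) (c : ℝ) :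
    e.Res lam (fun x => c * f x) (fun x => c * g x) := by
  intro ε hε
  obtain ⟨u, cu, z, a, b⟩ := h (ε / (|c| + 1)) (by positivity)
  have hc : |c| * (ε / (|c| + 1)) ≤ ε := by
    rw [mul_div_assoc', div_le_iff₀ (by positivity)]
    nlinarith [abs_nonneg c]
  refine ⟨fun x => c * u x, cu.const_smul c, by simpa using z.const_mul c, fun x => ?_, fun x => ?_⟩
  · rw [← mul_sub, abs_mul]
    exact (mul_le_mul_of_nonneg_left (a x) (abs_nonneg c)).trans hc
  · rw [e.M_smul cu]
    have : lam * (c * u x) - c * e.M u x - c * f x = c * (lam * u x - e.M u x - f x) := by ring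
    rw [this, abs_mul]
    exact (mul_le_mul_of_nonneg_left (b x) (abs_nonneg c)).trans hc

theorem Ell.Res.sub {lam : ℝ} {f1 g1 f2 g2 : E → ℝ} (h1 : e.Res lam f1 g1)
    (h2 : e.Res lam f2 g2) : e.Res lam (fun x => f1 x - f2 x) (fun x => g1 x - g2 x) := by
  have := h1.add (h2.smul (-1))
  simpa [sub_eq_add_neg] using this

theorem Ell.Res.congr_left {lam : ℝ} {f f' g : E → ℝ} (h : e.Res lam f g) (hf : ∀ x, f x = f' x) :
    e.Res lam f' g := by
  have : f = f' := funext hf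
  rwa [← this]

theorem Ell.Res.continuous {lam : ℝ} {f g : E → ℝ} (h : e.Res lam f g) : Continuous g := by
  refine continuous_of_uniform_approx_of_continuous fun u hu => ?_
  obtain ⟨ε, hε, hεu⟩ := Metric.mem_uniformity_dist.1 hu
  obtain ⟨v, c, z, a, b⟩ := h (ε / 2) (by positivity)
  refine ⟨v, c.continuous, fun y => hεu ?_⟩
  rw [dist_comm, Real.dist_eq]
  linarith [a y]

theorem Ell.Res.of_c2 {lam : ℝ} {φ : E → ℝ} (hφ : ContDiff ℝ 2 φ) (hc : Tendsto φ (cocompact E) (𝓝 0)) :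
    e.Res lam (fun x => lam * φ x - e.M φ x) φ :=
  fun ε hε => ⟨φ, hφ, hc, fun x => by simp [hε.le], fun x => by simp [hε.le]⟩

variable (e)

noncomputable def Ell.Cd : ℝ := e.kernels_dom.choose

theorem Ell.Cd_pos : 0 < e.Cd := e.kernels_dom.choose_spec.1

noncomputable def Ell.Ph (lam : ℝ) : ℝ × E → ℝ := PhiK m (lam - 1) e.Cd

theorem Ell.domz (lam : ℝ) : DomK (e.Ph lam) (e.zker lam) := (e.kernels_dom.choose_spec.2 lam).1
theorem Ell.domr (lam : ℝ) : DomK (e.Ph lam) (e.rker lam) := (e.kernels_dom.choose_spec.2 lam).2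

theorem Ell.Ph_good {lam : ℝ} (hl : 1 < lam) : GoodPhi (e.Ph lam) := PhiK_good e.hdim (by linarith) _

noncomputable def Ell.J (lam : ℝ) : ℝ := ∫ p, e.Ph lam p ∂(nu0 E)

theorem Ell.J_nonneg (lam : ℝ) : 0 ≤ e.J lam := by
  apply integral_nonneg_of_ae
  filter_upwards [nu0_ae_pos] with p hp using PhiK_nonneg e.Cd_pos.le hp

theorem Ell.J_tendsto : Tendsto e.J atTop (𝓝 0) :=
  (PhiK_tendsto e.hdim e.Cd).comp (tendsto_atTop_add_const_right atTop (-1) tendsto_id)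

structure Ell.Good (lam : ℝ) : Prop where
  one : 1 < lam
  half : e.J lam ≤ 1 / 2

theorem Ell.good_ev : ∀ᶠ lam in atTop, e.Good lam := by
  filter_upwards [eventually_gt_atTop 1, e.J_tendsto.eventually_lt_const (by norm_num : (0:ℝ) < 1 / 2)] with l h1 h2
  exact ⟨h1, h2.le⟩

theorem XF.sub {f g : E → ℝ} (hf : XF f) (hg : XF g) : XF (fun x => f x - g x) :=
  ⟨hf.cont.sub hg.cont, by simpa using hf.zero.sub hg.zero, hf.int.sub hg.int⟩

theorem XF.add {f g : E → ℝ} (hf : XF f) (hg : XF g) : XF (fun x => f x + g x) :=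
  ⟨hf.cont.add hg.cont, by simpa using hf.zero.add hg.zero, hf.int.add hg.int⟩

theorem XF.of_cs {f : E → ℝ} (hf : Continuous f) (hc : HasCompactSupport f) : XF f :=
  ⟨hf, hc.is_zero_at_infty, hf.integrable_of_hasCompactSupport hc⟩

variable {e}

theorem XF.R {lam : ℝ} (hl : e.Good lam) {f : E → ℝ} (hf : XF f) : XF (Op (e.rker lam) f) := by
  obtain ⟨H, hH0, hH⟩ := hf.bdd
  exact ⟨Op_continuous (e.Ph_good hl.one) (e.domr lam) hf.cont hH,
    Op_zero_at_infty (e.Ph_good hl.one) (e.domr lam) hf.cont.measurable hH hf.zero,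
    (Op_integrable' (e.Ph_good hl.one) (e.domr lam) hf.cont.measurable hf.int).1⟩

theorem Ell.approx {lam : ℝ} (hl : e.Good lam) {f : E → ℝ} (hf : XF f) : ∀ ε > 0, ∃ h, XF h ∧
    (∀ x, |f x - (h x - Op (e.rker lam) h x)| ≤ ε) ∧ ∫ x, |f x - (h x - Op (e.rker lam) h x)| ≤ ε := by
  obtain ⟨H, hH0, hH⟩ := hf.bdd
  have hΦ := e.Ph_good hl.one
  have hJ : (∫ p, e.Ph lam p ∂(nu0 E)) ≤ 1 / 2 := hl.half
  have step : ∀ N : ℕ, ∃ h, XF h ∧ (∀ x, |f x - (h x - Op (e.rker lam) h x)| ≤ (1 / 2) ^ N * H) ∧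
      ∫ x, |f x - (h x - Op (e.rker lam) h x)| ≤ (1 / 2) ^ N * ∫ x, |f x| := by
    intro N
    induction N with
    | zero =>
      refine ⟨fun _ => 0, ⟨continuous_const, tendsto_const_nhds, integrable_zero _ _ _⟩, ?_, ?_⟩ <;>
      simp [Op, hH]
    | succ N ih =>
      obtain ⟨h, hX, h1, h2⟩ := ih
      obtain ⟨B, hB0, hB⟩ := hX.bdd
      set d : E → ℝ := fun x => f x - (h x - Op (e.rker lam) h x) with hd
      have hdX : XF d := hf.sub (hX.sub (hX.R hl))
      have hh' : XF (fun x => h x + d x) := hX.add hdX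
      refine ⟨fun x => h x + d x, hh', ?_⟩
      obtain ⟨B', hB0', hB'⟩ := hh'.bdd
      have hlin : ∀ x, Op (e.rker lam) (fun x => h x + d x) x = Op (e.rker lam) h x + Op (e.rker lam) d x := by
        intro x
        have := Op_add hΦ (e.domr lam) hh'.cont.measurable hB' hX.cont.measurable hB x
        simp only [add_sub_cancel_left] at this
        linarith
      have hid : ∀ x, f x - ((h x + d x) - Op (e.rker lam) (fun x => h x + d x) x) = Op (e.rker lam) d x := by
        intro x; rw [hlin]; simp only [hd]; ring
      simp only [hid]
      constructor
      · intro x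
        refine (Op_bound hΦ (e.domr lam) h1 x).trans ?_
        calc _ ≤ 1 / 2 * ((1 / 2) ^ N * H) := mul_le_mul_of_nonneg_right hJ (by positivity)
          _ = _ := by ring
      · refine (Op_integrable' hΦ (e.domr lam) hdX.cont.measurable hdX.int).2.trans ?_
        have hn : 0 ≤ ∫ x, |f x| := integral_nonneg fun x => abs_nonneg _
        calc _ ≤ 1 / 2 * ((1 / 2) ^ N * ∫ x, |f x|) :=
              mul_le_mul hJ h2 (integral_nonneg fun x => abs_nonneg _) (by norm_num)
          _ = _ := by ring
  intro ε hε
  have ht : Tendsto (fun N : ℕ => (1 / 2 : ℝ) ^ N) atTop (𝓝 0) :=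
    tendsto_pow_atTop_nhds_zero_of_lt_one (by norm_num) (by norm_num)
  have t1 := ht.mul_const H
  have t2 := ht.mul_const (∫ x, |f x|)
  rw [zero_mul] at t1 t2
  obtain ⟨N, h1, h2⟩ := ((t1.eventually_lt_const hε).and (t2.eventually_lt_const hε)).exists
  obtain ⟨h, hX, a, b⟩ := step N
  exact ⟨h, hX, fun x => (a x).trans h1.le, b.trans h2.le⟩

theorem Ell.Res_exists {lam : ℝ} (hl : e.Good lam) {f : E → ℝ} (hf : XF f) : ∃ g, e.Res lam f g := by
  have hl0 : 0 < lam := by linarith [hl.one]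
  choose! h hX ha hb using Ell.approx hl hf
  have hR : ∀ ε > 0, e.Res lam (fun x => h ε x - Op (e.rker lam) (h ε) x) (Op (e.zker lam) (h ε)) :=
    fun ε hε => e.Res_step hl.one (hX ε hε)
  set u : ℕ → ℝ := fun n => 1 / ((n:ℝ) + 1)
  have hu0 : ∀ n, 0 < u n := fun n => by simp only [u]; positivity
  have hut : Tendsto u atTop (𝓝 0) := tendsto_one_div_add_atTop_nhds_zero_nat
  have hclose : ∀ i j x, |Op (e.zker lam) (h (u i)) x - Op (e.zker lam) (h (u j)) x| ≤ u i + u j := by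
    intro i j x
    have := (hR _ (hu0 i)).close hl0 (β := u i + u j) (by linarith [hu0 i, hu0 j]) (hR _ (hu0 j)) (fun x => by
      have a1 := abs_le.1 (ha _ (hu0 i) x)
      have a2 := abs_le.1 (ha _ (hu0 j) x)
      rw [abs_le]; constructor <;> linarith) x
    refine this.trans (div_le_self (by linarith [hu0 i, hu0 j]) hl.one.le)
  have hlim : ∀ x, ∃ y, Tendsto (fun i => Op (e.zker lam) (h (u i)) x) atTop (𝓝 y) := by
    intro x
    apply cauchySeq_tendsto_of_complete
    rw [Metric.cauchySeq_iff]
    intro ε hε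
    obtain ⟨N, hN⟩ := eventually_atTop.1 (hut.eventually_lt_const (half_pos hε))
    refine ⟨N, fun i hi j hj => ?_⟩
    rw [Real.dist_eq]
    linarith [hclose i j x, hN i hi, hN j hj]
  choose g hg using hlim
  refine ⟨g, Ell.Res.of_limit hl0 fun ε hε => ?_⟩
  obtain ⟨i, hi⟩ := (hut.eventually_lt_const hε).exists
  refine ⟨_, _, hR _ (hu0 i), fun x => ?_, fun x => ?_⟩
  · rw [abs_sub_comm]; exact (ha _ (hu0 i) x).trans hi.le
  · have t1 : Tendsto (fun j => |Op (e.zker lam) (h (u i)) x - Op (e.zker lam) (h (u j)) x|) atTop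
        (𝓝 |Op (e.zker lam) (h (u i)) x - g x|) := ((hg x).const_sub _).abs
    have t2 : Tendsto (fun j => u i + u j) atTop (𝓝 (u i + 0)) := hut.const_add _
    rw [add_zero] at t2
    exact (le_of_tendsto_of_tendsto' t1 t2 (fun j => hclose i j x)).trans hi.le

theorem Ell.rep {lam : ℝ} (hl : e.Good lam) {w : E → ℝ} (wm : Measurable w) {W : ℝ} (hW0 : 0 ≤ W)
    (hW : ∀ x, |w x| ≤ W) (wi : Integrable w) : ∃ u0 : E → ℝ, Continuous u0 ∧
    (∀ x, |u0 x| ≤ 2 * e.J lam * W) ∧ ∀ f g, XF f → e.Res lam f g → ∫ x, u0 x * f x = ∫ x, w x * g x := by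
  have hl0 : 0 < lam := by linarith [hl.one]
  have hΦ := e.Ph_good hl.one
  have hz := e.domz lam
  have hr := e.domr lam
  have hzT := hz.swap hΦ
  have hrT := hr.swap hΦ
  have hJ0 := e.J_nonneg lam
  have hJ := hl.half
  set zw : E → ℝ := Op (fun t x y => e.zker lam t y x) w with hzw
  have zwc : Continuous zw := Op_continuous_int hΦ hzT
    (PhiK_q (by linarith [hl.one]) e.Cd_pos.le) wm hW wi
  have zwb : ∀ x, |zw x| ≤ e.J lam * W := Op_bound hΦ hzT hW
  have rc : ∀ u : BoundedContinuousFunction E ℝ, Continuous (fun x => zw x + Op (fun t x y => e.rker lam t y x) u x) :=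
    fun u => zwc.add (Op_continuous hΦ hrT u.continuous (H := ‖u‖) u.norm_coe_le_norm)
  have rb : ∀ u : BoundedContinuousFunction E ℝ, ∀ x, ‖zw x + Op (fun t x y => e.rker lam t y x) u x‖ ≤ e.J lam * W + e.J lam * ‖u‖ := by
    intro u x
    refine (norm_add_le _ _).trans (add_le_add (zwb x) ?_)
    exact Op_bound hΦ hrT (H := ‖u‖) u.norm_coe_le_norm x
  set T : BoundedContinuousFunction E ℝ → BoundedContinuousFunction E ℝ := fun u =>
    BoundedContinuousFunction.ofNormedAddCommGroup _ (rc u) _ (rb u) with hT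
  have hcon : ContractingWith (1 / 2) T := by
    refine ⟨by rw [← NNReal.coe_lt_coe]; norm_num, LipschitzWith.of_dist_le_mul fun u v => ?_⟩
    rw [BoundedContinuousFunction.dist_le (by positivity)]
    intro x
    have h1 : Op (fun t x y => e.rker lam t y x) u x - Op (fun t x y => e.rker lam t y x) v x =
        Op (fun t x y => e.rker lam t y x) (fun y => u y - v y) x :=
      (Op_add hΦ hrT u.continuous.measurable (H := ‖u‖) u.norm_coe_le_norm v.continuous.measurable
        (H' := ‖v‖) v.norm_coe_le_norm x).symm
    have h2 := Op_bound hΦ hrT (h := fun y => u y - v y) (H := dist u v) (fun y => by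
      rw [← Real.dist_eq]; exact BoundedContinuousFunction.dist_coe_le_dist y) x
    have h3 : dist (T u x) (T v x) = |Op (fun t x y => e.rker lam t y x) (fun y => u y - v y) x| := by
      rw [Real.dist_eq, ← h1]
      show |(zw x + _) - (zw x + _)| = _
      rw [add_sub_add_left_eq_sub]
    rw [h3]
    refine h2.trans (mul_le_mul_of_nonneg_right ?_ dist_nonneg)
    have : (∫ p, e.Ph lam p ∂(nu0 E)) ≤ 1/2 := hl.half
    simpa using this
  obtain ⟨u0, hfix, -⟩ := hcon.exists_fixedPoint (0 : BoundedContinuousFunction E ℝ) (edist_ne_top _ _)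
  have hfx : ∀ x, u0 x = zw x + Op (fun t x y => e.rker lam t y x) u0 x := by
    intro x
    conv_lhs => rw [← hfix]
    rfl
  have hnorm : ‖u0‖ ≤ 2 * e.J lam * W := by
    have : ‖u0‖ ≤ e.J lam * W + e.J lam * ‖u0‖ := by
      rw [BoundedContinuousFunction.norm_le (by positivity)]
      intro x
      rw [hfx x]
      exact rb u0 x
    nlinarith [norm_nonneg u0]
  have hub : ∀ x, |u0 x| ≤ ‖u0‖ := u0.norm_coe_le_norm
  refine ⟨u0, u0.continuous, fun x => (hub x).trans hnorm, fun f g hf hg => ?_⟩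
  have key : ∀ ε > 0, |∫ x, u0 x * f x - w x * g x| ≤ ε * (‖u0‖ + ∫ x, |w x|) := by
    intro ε hε
    obtain ⟨h, hX, h1, h2⟩ := Ell.approx hl hf ε hε
    obtain ⟨H, hH0, hH⟩ := hX.bdd
    have hRX := hX.R hl
    have hres := e.Res_step hl.one hX
    have hcl := hg.close hl0 hε.le hres h1
    have e1 := Op_fubini hΦ hz wm wi hX.cont.measurable hH
    have e2 := Op_fubini hΦ hrT hX.cont.measurable hX.int u0.continuous.measurable hub
    have i1 : Integrable (fun x => u0 x * h x) := hX.int.bdd_mul u0.continuous.aestronglyMeasurable (Eventually.of_forall hub)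
    have i2 : Integrable (fun x => u0 x * Op (e.rker lam) h x) := hRX.int.bdd_mul u0.continuous.aestronglyMeasurable (Eventually.of_forall hub)
    have ROc : Continuous (Op (fun t x y => e.rker lam t y x) u0) := Op_continuous hΦ hrT u0.continuous hub
    have i3 : Integrable (fun x => h x * Op (fun t x y => e.rker lam t y x) u0 x) := by
      have := hX.int.bdd_mul ROc.aestronglyMeasurable (Eventually.of_forall (Op_bound hΦ hrT hub))
      exact this.congr (Eventually.of_forall fun x => mul_comm _ _)
    have e3 : ∫ x, w x * Op (e.zker lam) h x = ∫ x, u0 x * (h x - Op (e.rker lam) h x) := by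
      rw [e1]
      have : ∀ y, Op (fun t x y => e.zker lam t y x) w y * h y =
          u0 y * h y - h y * Op (fun t x y => e.rker lam t y x) u0 y := by
        intro y
        have := hfx y
        rw [this]; simp only [hzw]; ring
      simp only [this, mul_sub]
      rw [integral_sub i1 i3, e2, integral_sub i1 i2]
      congr 2
      ext x; ring
    have gc := hg.continuous
    have gi : ∀ {g : E → ℝ} {B : ℝ}, Continuous g → (∀ x, |g x| ≤ B) → Integrable (fun x => w x * g x) := by
      intro g B hc hB
      have := wi.bdd_mul hc.aestronglyMeasurable (Eventually.of_forall hB)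
      exact this.congr (Eventually.of_forall fun x => mul_comm _ _)
    obtain ⟨F, hF0, hF⟩ := hf.bdd
    have j1 : Integrable (fun x => u0 x * f x) := hf.int.bdd_mul u0.continuous.aestronglyMeasurable (Eventually.of_forall hub)
    have j2 : Integrable (fun x => w x * g x) := gi gc (hg.bound hl0 hF0 hF)
    have j3 : Integrable (fun x => w x * Op (e.zker lam) h x) :=
      gi (Op_continuous hΦ hz hX.cont hH) (Op_bound hΦ hz hH)
    have j4 : Integrable (fun x => u0 x * (h x - Op (e.rker lam) h x)) := by
      simp only [mul_sub]; exact i1.sub i2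
    have e4 : ∫ x, u0 x * f x - w x * g x = (∫ x, u0 x * (f x - (h x - Op (e.rker lam) h x))) -
        ∫ x, w x * (g x - Op (e.zker lam) h x) := by
      have a1 : ∀ x, u0 x * (f x - (h x - Op (e.rker lam) h x)) = u0 x * f x - u0 x * (h x - Op (e.rker lam) h x) :=
        fun x => by ring
      have a2 : ∀ x, w x * (g x - Op (e.zker lam) h x) = w x * g x - w x * Op (e.zker lam) h x := fun x => by ring
      simp only [a1, a2]
      rw [integral_sub j1 j4, integral_sub j2 j3, integral_sub j1 j2, e3]
      ring
    rw [e4]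
    have b1 : |∫ x, u0 x * (f x - (h x - Op (e.rker lam) h x))| ≤ ‖u0‖ * ε := by
      refine (abs_integral_le_integral_abs).trans ?_
      have : ∫ x, |u0 x * (f x - (h x - Op (e.rker lam) h x))| ≤ ∫ x, ‖u0‖ * |f x - (h x - Op (e.rker lam) h x)| := by
        refine integral_mono_of_nonneg (Eventually.of_forall fun x => abs_nonneg _)
          ((hf.sub (hX.sub hRX)).int.abs.const_mul _) (Eventually.of_forall fun x => ?_)
        dsimp only
        rw [abs_mul]
        exact mul_le_mul_of_nonneg_right (hub x) (abs_nonneg _)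
      rw [integral_const_mul] at this
      exact this.trans (mul_le_mul_of_nonneg_left h2 (norm_nonneg _))
    have b2 : |∫ x, w x * (g x - Op (e.zker lam) h x)| ≤ (∫ x, |w x|) * ε := by
      refine (abs_integral_le_integral_abs).trans ?_
      rw [← integral_mul_const]
      refine integral_mono_of_nonneg (Eventually.of_forall fun x => abs_nonneg _)
          (wi.abs.mul_const _) (Eventually.of_forall fun x => ?_)
      dsimp only
      rw [abs_mul]
      exact mul_le_mul_of_nonneg_left ((hcl x).trans (div_le_self hε.le hl.one.le)) (abs_nonneg _)
    refine (abs_sub _ _).trans ?_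
    linarith
  obtain ⟨F, hF0, hF⟩ := hf.bdd
  have j1 : Integrable (fun x => u0 x * f x) := hf.int.bdd_mul u0.continuous.aestronglyMeasurable (Eventually.of_forall hub)
  have j2 : Integrable (fun x => w x * g x) := by
    have := wi.bdd_mul hg.continuous.aestronglyMeasurable (Eventually.of_forall (hg.bound hl0 hF0 hF))
    exact this.congr (Eventually.of_forall fun x => mul_comm _ _)
  rw [← sub_eq_zero, ← integral_sub j1 j2]
  have hS : 0 ≤ ‖u0‖ + ∫ x, |w x| := add_nonneg (norm_nonneg _) (integral_nonneg fun x => abs_nonneg _)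
  by_contra hne
  have hpos := abs_pos.2 hne
  set d := |∫ x, u0 x * f x - w x * g x|
  set S := ‖u0‖ + ∫ x, |w x|
  have := key (d / (2 * (S + 1))) (by positivity)
  have h7 : d / (2 * (S + 1)) * S ≤ d / 2 := by
    rw [div_mul_eq_mul_div, div_le_div_iff₀ (by positivity) (by norm_num)]
    nlinarith
  linarith

/-- small mass -/
theorem Ell.Res.mass {lam : ℝ} (hl : e.Good lam) {X : Set E} (hX : MeasurableSet X) (hXb : Bornology.IsBounded X)
    {φ g : E → ℝ} (hφ : XF φ) (h0 : ∀ x, 0 ≤ φ x) (hg : e.Res lam φ g) :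
    ∫ x in X, g x ≤ 2 * e.J lam * ∫ x, φ x := by
  haveI : ProperSpace E := FiniteDimensional.proper ℝ E
  have wi : Integrable (X.indicator (fun _ : E => (1:ℝ))) := by
    rw [integrable_indicator_iff hX]
    exact integrableOn_const hXb.measure_lt_top.ne
  obtain ⟨u0, c, b, r⟩ := Ell.rep hl (measurable_const.indicator hX) (W := 1) zero_le_one (fun x => by
    by_cases hx : x ∈ X <;> simp [hx]) wi
  have := r φ g hφ hg
  have e1 : ∫ x, X.indicator (fun _ : E => (1:ℝ)) x * g x = ∫ x in X, g x := by
    rw [← integral_indicator hX]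
    congr 1; ext x
    by_cases hx : x ∈ X <;> simp [hx]
  rw [← e1, ← this, ← integral_const_mul]
  refine integral_mono (hφ.int.bdd_mul c.aestronglyMeasurable (Eventually.of_forall b)) (hφ.int.const_mul _) fun x => ?_
  have := (abs_le.1 (b x)).2
  exact mul_le_mul_of_nonneg_right (by linarith) (h0 x)

end Resolvent

end Part5

section Part6
set_option linter.unusedSectionVars false
set_option linter.style.haveILetI false
set_option synthInstance.maxHeartbeats 400000
set_option maxSynthPendingDepth 3

section Mollify

variable {E : Type*} [NormedAddCommGroup E] [NormedSpace ℝ E] [FiniteDimensional ℝ E]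
  [MeasureSpace E] [BorelSpace E] [(volume : Measure E).IsAddHaarMeasure]
variable {F : Type*} [NormedAddCommGroup F] [NormedSpace ℝ F] [CompleteSpace F]

noncomputable def molli (φ : ContDiffBump (0 : E)) (g : E → F) (x : E) : F :=
  convolution (φ.normed volume) g (ContinuousLinearMap.lsmul ℝ ℝ) volume x

theorem molli_fderiv (φ : ContDiffBump (0 : E)) {g : E → F} (hg : ContDiff ℝ 1 g) (hc : HasCompactSupport g) (x : E) :
    HasFDerivAt (molli φ g) (molli φ (fderiv ℝ g) x) x := by
  have hl : LocallyIntegrable (φ.normed (volume : Measure E)) volume :=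
    (φ.continuous_normed).locallyIntegrable
  have h := hc.hasFDerivAt_convolution_right (ContinuousLinearMap.lsmul ℝ ℝ) hl hg x
  exact h

theorem molli_close (φ : ContDiffBump (0 : E)) {g : E → F} (hg : Continuous g) {ε δ : ℝ}
    (h : ∀ x y, dist x y < δ → dist (g x) (g y) ≤ ε) (hφ : φ.rOut ≤ δ) (x : E) : dist (molli φ g x) (g x) ≤ ε :=
  φ.dist_normed_convolution_le hg.aestronglyMeasurable fun y hy => h y x ((mem_ball.1 hy).trans_le hφ)

theorem molli_smooth (φ : ContDiffBump (0 : E)) {g : E → F} (hg : Continuous g) : ContDiff ℝ (⊤ : ℕ∞) (molli φ g) :=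
  φ.hasCompactSupport_normed.contDiff_convolution_left (ContinuousLinearMap.lsmul ℝ ℝ) φ.contDiff_normed hg.locallyIntegrable

theorem molli_nonneg (φ : ContDiffBump (0 : E)) {g : E → ℝ} (hg : ∀ x, 0 ≤ g x) (x : E) : 0 ≤ molli φ g x :=
  integral_nonneg fun t => mul_nonneg (φ.nonneg_normed _) (hg _)

theorem molli_supp (φ : ContDiffBump (0 : E)) {g : E → F} {δ : ℝ} (hφ : φ.rOut ≤ δ) :
    tsupport (molli φ g) ⊆ cthickening δ (tsupport g) := by
  refine closure_minimal ?_ isClosed_cthickening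
  intro x hx
  obtain ⟨a, ha, b, hb, rfl⟩ := Set.mem_add.1 (support_convolution_subset (ContinuousLinearMap.lsmul ℝ ℝ) hx)
  rw [φ.support_normed_eq] at ha
  refine mem_cthickening_of_dist_le _ b _ _ (subset_closure hb) ?_
  rw [dist_eq_norm, add_sub_cancel_right]
  exact ((mem_ball_zero_iff.1 ha).le).trans hφ

theorem uc_cs {g : E → F} (hg : Continuous g) (hc : HasCompactSupport g) {ε : ℝ} (hε : 0 < ε) :
    ∃ δ > 0, ∀ x y, dist x y < δ → dist (g x) (g y) ≤ ε := by
  obtain ⟨δ, hδ, h⟩ := Metric.uniformContinuous_iff.1 (hc.uniformContinuous_of_continuous hg) ε hε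
  exact ⟨δ, hδ, fun x y hxy => (h hxy).le⟩

theorem exists_bump {δ : ℝ} (hδ : 0 < δ) : ∃ φ : ContDiffBump (0 : E), φ.rOut ≤ δ :=
  ⟨⟨δ / 2, δ, by positivity, by linarith⟩, le_rfl⟩

theorem mollify0 {f : E → ℝ} (hf : Continuous f) (hc : HasCompactSupport f) {ε : ℝ} (hε : 0 < ε) :
    ∃ f' : E → ℝ, ContDiff ℝ (⊤ : ℕ∞) f' ∧ HasCompactSupport f' ∧ ∀ x, |f' x - f x| ≤ ε := by
  haveI : ProperSpace E := FiniteDimensional.proper ℝ E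
  obtain ⟨δ, hδ, h⟩ := uc_cs hf hc hε
  obtain ⟨φ, hφ⟩ := exists_bump (E := E) hδ
  exact ⟨molli φ f, molli_smooth φ hf, (IsCompact.cthickening hc).of_isClosed_subset isClosed_closure (molli_supp φ hφ), molli_close φ hf h hφ⟩

theorem mollify2 {f : E → ℝ} (hf : ContDiff ℝ 2 f) (hc : HasCompactSupport f) {ε δ0 : ℝ} (hε : 0 < ε) (hδ0 : 0 < δ0) :
    ∃ f' : E → ℝ, ContDiff ℝ (⊤ : ℕ∞) f' ∧ HasCompactSupport f' ∧ tsupport f' ⊆ cthickening δ0 (tsupport f) ∧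
      ((∀ x, 0 ≤ f x) → ∀ x, 0 ≤ f' x) ∧ (∀ x, |f' x - f x| ≤ ε) ∧
      ∀ x, ‖fderiv ℝ (fderiv ℝ f') x - fderiv ℝ (fderiv ℝ f) x‖ ≤ ε := by
  haveI : ProperSpace E := FiniteDimensional.proper ℝ E
  obtain ⟨δ, hδ, h⟩ := uc_cs hf.continuous hc hε
  have hc1 : HasCompactSupport (fderiv ℝ f) := hc.fderiv ℝ
  obtain ⟨δ', hδ', h'⟩ := uc_cs (fd2c hf) (hc1.fderiv ℝ) hε
  obtain ⟨φ, hφ⟩ := exists_bump (E := E) (lt_min hδ0 (lt_min hδ hδ'))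
  have a0 : φ.rOut ≤ δ0 := hφ.trans (min_le_left _ _)
  have a1 : φ.rOut ≤ δ := hφ.trans ((min_le_right _ _).trans (min_le_left _ _))
  have a2 : φ.rOut ≤ δ' := hφ.trans ((min_le_right _ _).trans (min_le_right _ _))
  refine ⟨molli φ f, molli_smooth φ hf.continuous, (IsCompact.cthickening hc).of_isClosed_subset isClosed_closure (molli_supp φ a0),
    molli_supp φ a0, molli_nonneg φ, molli_close φ hf.continuous h a1, fun x => ?_⟩
  rw [fd2_eq (molli_fderiv φ (hf.of_le (by norm_num)) hc) (molli_fderiv φ (fd1c hf) hc1), ← dist_eq_norm]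
  exact molli_close φ (fd2c hf) h' a2 x

end Mollify

end Part6

section Part7
set_option linter.unusedSectionVars false
set_option linter.style.haveILetI false
set_option synthInstance.maxHeartbeats 400000
set_option maxSynthPendingDepth 3

theorem le_eps {x y c : ℝ} (h : ∀ ε > 0, x ≤ y + ε * c) : x ≤ y := by
  have : Tendsto (fun ε : ℝ => y + ε * c) (𝓝[>] 0) (𝓝 (y + 0 * c)) :=
    (Continuous.tendsto (by fun_prop) 0).mono_left nhdsWithin_le_nhds
  simpa using ge_of_tendsto this (eventually_nhdsWithin_of_forall fun ε hε => h ε hε)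

noncomputable def betaF (k : ℝ) (s : ℝ) : ℝ := ∫ t in (0:ℝ)..s, Real.smoothTransition (k * t)

theorem betaF_cont (k : ℝ) : Continuous fun t => Real.smoothTransition (k * t) :=
  Real.smoothTransition.continuous.comp (continuous_const.mul continuous_id)

theorem betaF_deriv (k s : ℝ) : HasDerivAt (betaF k) (Real.smoothTransition (k * s)) s :=
  intervalIntegral.integral_hasDerivAt_right ((betaF_cont k).intervalIntegrable _ _)
    ((betaF_cont k).stronglyMeasurableAtFilter _ _) (betaF_cont k).continuousAt

theorem betaF_deriv2 (k s : ℝ) : HasDerivAt (fun s => Real.smoothTransition (k * s)) (deriv (fun s => Real.smoothTransition (k * s)) s) s := by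
  have : ContDiff ℝ 1 (fun s => Real.smoothTransition (k * s)) :=
    (Real.smoothTransition.contDiff (n := 1)).comp (contDiff_const.mul contDiff_id)
  exact (this.differentiable (by norm_num) s).hasDerivAt

theorem betaF_contDiff (k : ℝ) : ContDiff ℝ 2 (betaF k) := by
  have h : deriv (betaF k) = fun s => Real.smoothTransition (k * s) := by ext s; exact (betaF_deriv k s).deriv
  rw [show (2 : WithTop ℕ∞) = 1 + 1 by norm_num, contDiff_succ_iff_deriv]
  refine ⟨fun s => (betaF_deriv k s).differentiableAt, by simp, ?_⟩
  rw [h]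
  exact (Real.smoothTransition.contDiff (n := 1)).comp (contDiff_const.mul contDiff_id)

theorem betaF_nonpos {k s : ℝ} (hk : 0 < k) (hs : s ≤ 0) : betaF k s = 0 := by
  unfold betaF
  rw [intervalIntegral.integral_symm, intervalIntegral.integral_congr (g := fun _ => (0:ℝ))]
  · simp
  · intro t ht
    rw [Set.uIcc_of_le hs] at ht
    exact Real.smoothTransition.zero_of_nonpos (by nlinarith [ht.2])

theorem betaF_nonneg {k s : ℝ} (hk : 0 < k) : 0 ≤ betaF k s := by
  rcases le_total s 0 with h | h
  · rw [betaF_nonpos hk h]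
  · exact intervalIntegral.integral_nonneg h fun t _ => Real.smoothTransition.nonneg _

section DS

variable {E : Type*} [NormedAddCommGroup E] [NormedSpace ℝ E] [FiniteDimensional ℝ E]
  [MeasureSpace E] [BorelSpace E] [(volume : Measure E).IsAddHaarMeasure]
variable {m : ℕ} (e : Ell E m)

theorem Ell.M_congr {f g : E → ℝ} {x : E} (h : f =ᶠ[𝓝 x] g) : e.M f x = e.M g x := by
  unfold Ell.M
  rw [(h.fderiv (𝕜 := ℝ)).fderiv_eq]

theorem Ell.M_const (c : ℝ) (x : E) : e.M (fun _ => c) x = 0 := by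
  unfold Ell.M; simp

theorem Ell.M_off {f : E → ℝ} {x : E} (h : x ∉ tsupport f) : e.M f x = 0 := by
  rw [e.M_congr (notMem_tsupport_iff_eventuallyEq.1 h)]
  exact e.M_const 0 x

theorem Ell.M_cs {f : E → ℝ} (h : HasCompactSupport f) : HasCompactSupport (e.M f) :=
  HasCompactSupport.of_support_subset_isCompact h fun x hx => by
    by_contra h'; exact hx (e.M_off h')

theorem Ell.M_bdd {f : E → ℝ} (hf : ContDiff ℝ 2 f) (h : HasCompactSupport f) : ∃ C, 0 ≤ C ∧ ∀ x, |e.M f x| ≤ C := by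
  obtain ⟨C, hC⟩ := (e.M_cs h).exists_bound_of_continuous (e.M_cont hf)
  exact ⟨C, (norm_nonneg _).trans (hC 0), hC⟩

theorem Ell.M_comp {h : E → ℝ} (hh : ContDiff ℝ 2 h) {k : ℝ} (hk : 0 < k) (x : E) :
    Real.smoothTransition (k * h x) * e.M h x ≤ e.M (fun x => betaF k (h x)) x := by
  set b := fun s => Real.smoothTransition (k * s) with hb
  have d1 : ∀ x, HasFDerivAt (fun x => betaF k (h x)) (b (h x) • fderiv ℝ h x) x := fun x =>
    (betaF_deriv k (h x)).comp_hasFDerivAt x (fd1 hh x).hasFDerivAt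
  have d2 : ∀ x, HasFDerivAt (fun x => b (h x)) (deriv b (h x) • fderiv ℝ h x) x := fun x =>
    (betaF_deriv2 k (h x)).comp_hasFDerivAt x (fd1 hh x).hasFDerivAt
  have d3 : ∀ x, HasFDerivAt (fun x => b (h x) • fderiv ℝ h x)
      (b (h x) • fderiv ℝ (fderiv ℝ h) x + (deriv b (h x) • fderiv ℝ h x).smulRight (fderiv ℝ h x)) x := fun x =>
    (d2 x).smul (fd2 hh x).hasFDerivAt
  have hb0 : 0 ≤ deriv b (h x) := by
    have : Monotone b := fun s t hst => Real.smoothTransition.monotone (mul_le_mul_of_nonneg_left hst hk.le)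
    exact this.deriv_nonneg
  unfold Ell.M
  rw [fd2_eq d1 d3, map_add, map_smul, smul_eq_mul]
  have := e.pos x ((deriv b (h x) • fderiv ℝ h x).smulRight (fderiv ℝ h x)) (fun u w => by simp; ring)
    (fun u => by
      simp only [ContinuousLinearMap.smulRight_apply, _root_.smul_apply, smul_eq_mul]
      nlinarith [mul_nonneg hb0 (mul_self_nonneg (fderiv ℝ h x u))])
  linarith

def Ell.DSub (Ω : Set E) (v : E → ℝ) : Prop :=
  LocallyIntegrableOn v Ω ∧ ∀ ω : E → ℝ, ContDiff ℝ 2 ω → HasCompactSupport ω → tsupport ω ⊆ Ω →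
    (∀ x, 0 ≤ ω x) → 0 ≤ ∫ x, v x * e.M ω x

theorem int_cs {v f : E → ℝ} {Ω K : Set E} (hv : LocallyIntegrableOn v Ω) (hK : IsCompact K) (hKΩ : K ⊆ Ω)
    (hf : Continuous f) (h0 : ∀ x, x ∉ K → f x = 0) : Integrable fun x => v x * f x := by
  have h1 : IntegrableOn v K := hv.integrableOn_compact_subset hKΩ hK
  have h2 : IntegrableOn (fun x => v x * f x) K := by
    obtain ⟨C, hC⟩ := hK.exists_bound_of_continuousOn hf.continuousOn
    have := h1.mul_bdd (g := f) (c := C) hf.aestronglyMeasurable ((ae_restrict_iff' hK.measurableSet).2 (Eventually.of_forall hC))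
    exact this
  refine (integrableOn_iff_integrable_of_support_subset ?_).1 h2
  intro x hx
  by_contra h
  exact hx (by simp [h0 x h])

theorem Ell.DSub.of_smooth {Ω : Set E} (hΩ : IsOpen Ω) {v : E → ℝ} (hv : LocallyIntegrableOn v Ω)
    (h : ∀ ω : E → ℝ, ContDiff ℝ (⊤ : ℕ∞) ω → HasCompactSupport ω → tsupport ω ⊆ Ω →
    (∀ x, 0 ≤ ω x) → 0 ≤ ∫ x, v x * e.M ω x) : e.DSub Ω v := by
  haveI : ProperSpace E := FiniteDimensional.proper ℝ E
  refine ⟨hv, fun ω h1 h2 h3 h4 => ?_⟩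
  obtain ⟨δ, hδ, hδΩ⟩ := IsCompact.exists_cthickening_subset_open h2 hΩ h3
  set K := cthickening δ (tsupport ω)
  have hK : IsCompact K := IsCompact.cthickening h2
  have hvK : IntegrableOn v K := hv.integrableOn_compact_subset hδΩ hK
  refine le_eps (c := e.B * ∫ x in K, |v x|) fun ε hε => ?_
  obtain ⟨ω', a1, a2, a3, a4, a5, a6⟩ := mollify2 h1 h2 hε hδ
  have b := h ω' a1 a2 (a3.trans hδΩ) (a4 h4)
  have a1' : ContDiff ℝ 2 ω' := contDiff_infty.1 a1 2
  have c1 : ∀ x, x ∉ K → e.M ω' x = 0 := fun x hx => e.M_off fun hx' => hx (a3 hx')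
  have c2 : ∀ x, x ∉ K → e.M ω x = 0 := fun x hx => e.M_off fun hx' => hx (self_subset_cthickening _ hx')
  have i1 := int_cs hv hK hδΩ (e.M_cont a1') c1
  have i2 := int_cs hv hK hδΩ (e.M_cont h1) c2
  have key : ∫ x, (v x * e.M ω' x - v x * e.M ω x) ≤ ∫ x in K, |v x| * (e.B * ε) := by
    rw [← setIntegral_eq_integral_of_forall_compl_eq_zero (s := K) (fun x hx => by rw [c1 x hx, c2 x hx]; ring)]
    refine setIntegral_mono (i1.sub i2).integrableOn (hvK.abs.mul_const _) fun x => ?_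
    have : |e.M ω' x - e.M ω x| ≤ e.B * ε := by
      unfold Ell.M
      rw [← map_sub]
      exact (e.bdd x _).trans (mul_le_mul_of_nonneg_left (a6 x) e.B0)
    calc v x * e.M ω' x - v x * e.M ω x = v x * (e.M ω' x - e.M ω x) := by ring
      _ ≤ |v x| * |e.M ω' x - e.M ω x| := by rw [← abs_mul]; exact le_abs_self _
      _ ≤ _ := mul_le_mul_of_nonneg_left this (abs_nonneg _)
  rw [integral_sub i1 i2, integral_mul_const] at key
  nlinarith

theorem beta_pt {v p g1 g lam ε k : ℝ} (hv : v ≤ 0) (hp : 0 ≤ p) (hl : 0 < lam) (hε : 0 < ε) (hk : k = 1 / ε) (hg : |g1 - g| ≤ ε) :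
    v * Real.smoothTransition (k * g1) * (lam * g1 - p) ≤ v * (lam * g - p) + |v| * (lam * (2 * ε)) := by
  set t := Real.smoothTransition (k * g1)
  have t0 : 0 ≤ t := Real.smoothTransition.nonneg _
  have t1 : t ≤ 1 := Real.smoothTransition.le_one _
  have hb : g1 - t * g1 ≤ ε := by
    rcases le_total g1 0 with h | h
    · nlinarith
    · rcases le_total g1 ε with h' | h'
      · nlinarith
      · have : t = 1 := Real.smoothTransition.one_of_one_le (by rw [hk, one_div, ← div_eq_inv_mul, le_div_iff₀ hε]; linarith)
        rw [this]; linarith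
  rw [abs_of_nonpos hv]
  have h1 : g - t * g1 ≤ 2 * ε := by linarith [(abs_le.1 hg).1]
  have h2 : -v * (lam * (g - t * g1)) ≤ -v * (lam * (2 * ε)) :=
    mul_le_mul_of_nonneg_left (mul_le_mul_of_nonneg_left h1 hl.le) (by linarith)
  have h3 : 0 ≤ -v * (p * (1 - t)) := mul_nonneg (by linarith) (mul_nonneg hp (by linarith))
  nlinarith

theorem Ell.DSub.key {Ω : Set E} {v : E → ℝ} (hv : e.DSub Ω v) (hv0 : ∀ x ∈ Ω, v x ≤ 0) {χ : E → ℝ}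
    (hχ : ContDiff ℝ 2 χ) (hχc : HasCompactSupport χ) (hχs : tsupport χ ⊆ Ω) (h01 : ∀ x, χ x ≤ 1)
    {C : ℝ} (hC : ∀ x, |e.M χ x| ≤ C) {lam : ℝ} (hl : 0 < lam) {φ g : E → ℝ} (hφc : Continuous φ) (hr : e.Res lam φ g)
    (φ0 : ∀ x, 0 ≤ φ x) (hφB : ∀ x, χ x ≠ 1 → φ x = 0) {a : ℝ} (ha : 0 ≤ a) (hga : ∀ x, χ x ≠ 1 → g x ≤ a) :
    -(C * a * ∫ x in tsupport χ, |v x|) ≤ ∫ x in {x | χ x = 1}, v x * (lam * g x - φ x) := by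
  set K := tsupport χ with hKd
  have hK : IsCompact K := hχc
  have hvK : IntegrableOn v K := hv.1.integrableOn_compact_subset hχs hK
  have hBK : {x | χ x = 1} ⊆ K := fun x hx => subset_tsupport χ (by simp [Function.mem_support, show χ x = 1 from hx])
  have hBc : IsClosed {x | χ x = 1} := isClosed_eq hχ.continuous continuous_const
  have hC0 : 0 ≤ C := (abs_nonneg _).trans (hC 0)
  have hgc := hr.continuous
  rw [neg_le_iff_add_nonneg]
  refine le_eps (c := (lam * 2 + 1 + 2 * C) * ∫ x in K, |v x|) fun ε hε => ?_
  obtain ⟨g1, g1c, -, g1a, g1b⟩ := hr ε hε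
  set h : E → ℝ := fun x => g1 x + (a + 2 * ε) * (χ x + (-1)) with hh
  have hhC : ContDiff ℝ 2 h := g1c.add (contDiff_const.mul (hχ.add contDiff_const))
  have hMh : ∀ x, e.M h x = e.M g1 x + (a + 2 * ε) * e.M χ x := by
    intro x
    rw [hh, e.M_add g1c (contDiff_const.mul (hχ.add contDiff_const)), e.M_smul (hχ.add contDiff_const),
      e.M_add hχ contDiff_const, e.M_const, add_zero]
  set k := 1 / ε with hk
  have hk0 : 0 < k := by positivity
  have hneg : ∀ x, χ x = 0 → h x ≤ 0 := by
    intro x hx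
    have h1 := hga x (by rw [hx]; norm_num)
    have h2 := (abs_le.1 (g1a x)).2
    simp only [hh, hx]
    linarith
  set τ : E → ℝ := fun x => betaF k (h x) with hτ
  have hτC : ContDiff ℝ 2 τ := (betaF_contDiff k).comp hhC
  have hτs : tsupport τ ⊆ K := by
    refine closure_mono fun x hx => ?_
    by_contra hx'
    exact hx (betaF_nonpos hk0 (hneg x (by simpa using hx')))
  have hτc : HasCompactSupport τ := hK.of_isClosed_subset isClosed_closure hτs
  have h0 := hv.2 τ hτC hτc (hτs.trans hχs) fun x => betaF_nonneg hk0
  have hoff : ∀ x, x ∉ K → e.M τ x = 0 := fun x hx => e.M_off fun hx' => hx (hτs hx')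
  have i1 := int_cs hv.1 hK hχs (e.M_cont hτC) hoff
  have i2 : IntegrableOn (fun x => v x * (lam * g x - φ x)) {x | χ x = 1} := by
    have hBcp : IsCompact {x | χ x = 1} := hK.of_isClosed_subset hBc hBK
    obtain ⟨C', hC'⟩ := hBcp.exists_bound_of_continuousOn (f := fun x => lam * g x - φ x) (by fun_prop)
    exact (hvK.mono_set hBK).mul_bdd (c := C') (by fun_prop) ((ae_restrict_iff' hBcp.measurableSet).2 (Eventually.of_forall hC'))
  set δ := lam * (2 * ε) + ε + (a + 2 * ε) * C with hδ
  have key : ∫ x in K, v x * e.M τ x ≤ ∫ x in K, ({x | χ x = 1}.indicator (fun x => v x * (lam * g x - φ x)) x + |v x| * δ) := by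
    refine setIntegral_mono_on i1.integrableOn ?_ hK.measurableSet ?_
    · exact ((integrable_indicator_iff hBc.measurableSet).2 i2).integrableOn.add (hvK.abs.mul_const _)
    · intro x hx
      have vx := hv0 x (hχs hx)
      set t := Real.smoothTransition (k * h x) with ht
      have t0 : 0 ≤ t := Real.smoothTransition.nonneg _
      have t1 : t ≤ 1 := Real.smoothTransition.le_one _
      have s1 : v x * e.M τ x ≤ v x * (t * e.M h x) := mul_le_mul_of_nonpos_left (e.M_comp hhC hk0 x) vx
      have s2 : lam * g1 x - φ x - ε - (a + 2 * ε) * C ≤ e.M h x := by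
        rw [hMh]
        have q1 := (abs_le.1 (g1b x)).2
        have q2 : (a + 2 * ε) * (-C) ≤ (a + 2 * ε) * e.M χ x := mul_le_mul_of_nonneg_left (abs_le.1 (hC x)).1 (by positivity)
        linarith
      have s3 : v x * (t * e.M h x) ≤ v x * (t * (lam * g1 x - φ x - ε - (a + 2 * ε) * C)) :=
        mul_le_mul_of_nonpos_left (mul_le_mul_of_nonneg_left s2 t0) vx
      have s4 : -(v x) * (t * (ε + (a + 2 * ε) * C)) ≤ -(v x) * (ε + (a + 2 * ε) * C) :=
        mul_le_mul_of_nonneg_left (mul_le_of_le_one_left (by positivity) t1) (by linarith)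
      have s5 : v x * e.M τ x ≤ v x * t * (lam * g1 x - φ x) + |v x| * (ε + (a + 2 * ε) * C) := by
        rw [abs_of_nonpos vx]; nlinarith
      by_cases hx1 : χ x = 1
      · rw [Set.indicator_of_mem (show x ∈ {x | χ x = 1} from hx1)]
        have hhx : h x = g1 x := by simp [hh, hx1]
        rw [ht, hhx] at s5
        have := beta_pt vx (φ0 x) hl hε hk (g1a x)
        rw [hδ]; linarith
      · rw [Set.indicator_of_notMem (show x ∉ {x | χ x = 1} from hx1)]
        rw [hφB x hx1] at s5
        have : v x * t * (lam * g1 x - 0) ≤ 0 := by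
          rcases le_or_gt (h x) 0 with hneg | hpos
          · rw [ht, Real.smoothTransition.zero_of_nonpos (by nlinarith)]; simp
          · have : h x ≤ g1 x := by
              have : (a + 2 * ε) * (χ x + (-1)) ≤ 0 := mul_nonpos_of_nonneg_of_nonpos (by positivity) (by linarith [h01 x])
              simp only [hh]; linarith
            exact mul_nonpos_of_nonpos_of_nonneg (mul_nonpos_of_nonpos_of_nonneg vx t0) (by nlinarith)
        have : 0 ≤ |v x| * (lam * (2 * ε)) := by positivity
        rw [hδ]; linarith
  rw [setIntegral_eq_integral_of_forall_compl_eq_zero (s := K) (fun x hx => by rw [hoff x hx, mul_zero]),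
    integral_add ((integrable_indicator_iff hBc.measurableSet).2 i2).integrableOn (hvK.abs.mul_const _),
    setIntegral_indicator hBc.measurableSet, Set.inter_eq_right.2 hBK, integral_mul_const] at key
  rw [hδ] at key
  linarith

end DS

end Part7

section Part8
set_option linter.unusedSectionVars false
set_option linter.style.haveILetI false
set_option synthInstance.maxHeartbeats 400000
set_option maxSynthPendingDepth 3

section T1

variable {E : Type*} [NormedAddCommGroup E] [NormedSpace ℝ E] [FiniteDimensional ℝ E]

theorem exists_cut {K U : Set E} (hK : IsCompact K) (hU : IsOpen U) (hKU : K ⊆ U) :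
    ∃ θ : E → ℝ, ContDiff ℝ (⊤ : ℕ∞) θ ∧ HasCompactSupport θ ∧ tsupport θ ⊆ U ∧ (∀ x, 0 ≤ θ x) ∧ (∀ x, θ x ≤ 1) ∧
      K ⊆ interior {x | θ x = 1} := by
  haveI : ProperSpace E := FiniteDimensional.proper ℝ E
  obtain ⟨δ, hδ, hδΩ⟩ := hK.exists_cthickening_subset_open hU hKU
  have hc : IsCompact (cthickening δ K) := hK.cthickening
  obtain ⟨f, h1, h2, h3⟩ := exists_contMDiffMap_one_nhds_of_subset_interior (n := (⊤ : ℕ∞)) (modelWithCornersSelf ℝ E) hK.isClosed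
    (t := cthickening δ K) ((self_subset_thickening hδ K).trans (isOpen_thickening.subset_interior_iff.2 (thickening_subset_cthickening δ K)))
  have hs : tsupport f ⊆ cthickening δ K := closure_minimal (fun x hx => by
    by_contra h; exact hx (h2 x h)) isClosed_cthickening
  refine ⟨f, f.contMDiff.contDiff, hc.of_isClosed_subset isClosed_closure hs, hs.trans hδΩ, fun x => (h3 x).1, fun x => (h3 x).2, ?_⟩
  exact subset_interior_iff_mem_nhdsSet.2 h1

variable  [MeasureSpace E] [BorelSpace E] [(volume : Measure E).IsAddHaarMeasure]
variable {m : ℕ} (e : Ell E m)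

theorem smooth2 {f : E → ℝ} (h : ContDiff ℝ (⊤ : ℕ∞) f) : ContDiff ℝ 2 f := contDiff_infty.1 h 2

theorem cs_zero {f : E → ℝ} (h : HasCompactSupport f) : Tendsto f (cocompact E) (𝓝 0) := by
  refine tendsto_nhds_of_eventually_eq ?_
  filter_upwards [IsCompact.compl_mem_cocompact h] with x hx
  exact image_eq_zero_of_notMem_tsupport hx

theorem Ell.decay_step {lam : ℝ} (hl : 0 < lam) {θ θ' g g' : E → ℝ} (hθ : ContDiff ℝ 2 θ) (hc : HasCompactSupport θ) {C : ℝ}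
    (hC : ∀ x, e.M θ x ≤ C * θ' x) (h : e.Res lam θ g) (h' : e.Res lam θ' g') (x : E) :
    g x ≤ 1 / lam * θ x + C / lam * g' x := by
  have h1 := ((Ell.Res.of_c2 (e := e) (lam := lam) hθ (cs_zero hc)).smul (1 / lam)).add (h'.smul (C / lam))
  have := h.mono hl le_rfl h1 (fun x => by
    have h2 : 1 / lam * (lam * θ x - e.M θ x) + C / lam * θ' x + 0 = θ x + (C * θ' x - e.M θ x) / lam := by field_simp; ring
    rw [h2]
    have : 0 ≤ (C * θ' x - e.M θ x) / lam := div_nonneg (by linarith [hC x]) hl.le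
    linarith) x
  simpa using this

theorem Ell.decay {K U : Set E} (hK : IsCompact K) (hU : IsOpen U) (hKU : K ⊆ U) :
    ∃ C : ℝ, 0 ≤ C ∧ ∀ lam, e.Good lam → ∀ N : ℝ, 0 ≤ N → ∀ φ g, e.Res lam φ g → (∀ x, φ x ≤ N) → (∀ x, x ∉ K → φ x ≤ 0) →
      ∀ x, x ∉ U → g x ≤ C * N / lam ^ 3 := by
  obtain ⟨θ0, a1, a2, a3, a4, a5, a6⟩ := exists_cut hK hU hKU
  obtain ⟨θ1, b1, b2, b3, b4, b5, b6⟩ := exists_cut a2 hU a3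
  obtain ⟨θ2, c1, c2, c3, c4, c5, c6⟩ := exists_cut b2 hU b3
  obtain ⟨C0, hC0, hM0⟩ := e.M_bdd (smooth2 a1) a2
  obtain ⟨C1, hC1, hM1⟩ := e.M_bdd (smooth2 b1) b2
  have gen : ∀ {θ θ' : E → ℝ} {C : ℝ}, (∀ x, |e.M θ x| ≤ C) → (∀ x, 0 ≤ θ' x) → 0 ≤ C → tsupport θ ⊆ interior {x | θ' x = 1} →
      ∀ x, e.M θ x ≤ C * θ' x := by
    intro θ θ' C h1 h2 h3 h4 x
    by_cases hx : x ∈ tsupport θ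
    · have hh : x ∈ {x | θ' x = 1} := interior_subset (h4 hx)
      rw [show θ' x = 1 from hh, mul_one]
      exact (le_abs_self _).trans (h1 x)
    · rw [e.M_off hx]; exact mul_nonneg h3 (h2 x)
  refine ⟨C0 * C1, by positivity, fun lam hl N hN φ g hr hφ1 hφ2 x hx => ?_⟩
  have hl0 : 0 < lam := by linarith [hl.one]
  obtain ⟨g0, hg0⟩ := Ell.Res_exists hl (XF.of_cs a1.continuous a2)
  obtain ⟨g1, hg1⟩ := Ell.Res_exists hl (XF.of_cs b1.continuous b2)
  obtain ⟨g2, hg2⟩ := Ell.Res_exists hl (XF.of_cs c1.continuous c2)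
  have s0 : g x ≤ N * g0 x := by
    have := hr.mono hl0 le_rfl (hg0.smul N) (fun y => by
      by_cases hy : y ∈ K
      · have hh : y ∈ {x | θ0 x = 1} := interior_subset (a6 hy)
        rw [show θ0 y = 1 from hh]; simpa using hφ1 y
      · have := mul_nonneg hN (a4 y); linarith [hφ2 y hy]) x
    simpa using this
  have s1 := e.decay_step hl0 (smooth2 a1) a2 (gen hM0 b4 hC0 b6) hg0 hg1 x
  have s2 := e.decay_step hl0 (smooth2 b1) b2 (gen hM1 c4 hC1 c6) hg1 hg2 x
  have s3 := (abs_le.1 (hg2.bound hl0 zero_le_one (fun y => by rw [abs_of_nonneg (c4 y)]; exact c5 y) x)).2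
  rw [image_eq_zero_of_notMem_tsupport (fun h => hx (a3 h)), mul_zero, zero_add] at s1
  rw [image_eq_zero_of_notMem_tsupport (fun h => hx (b3 h)), mul_zero, zero_add] at s2
  calc g x ≤ N * (C0 / lam * (C1 / lam * (1 / lam))) := by
        refine s0.trans (mul_le_mul_of_nonneg_left (s1.trans (mul_le_mul_of_nonneg_left (s2.trans ?_) (by positivity))) hN)
        exact mul_le_mul_of_nonneg_left s3 (by positivity)
    _ = _ := by field_simp

theorem Ell.S_tendsto {f : E → ℝ} (hf : Continuous f) (hc : HasCompactSupport f) {ε : ℝ} (hε : 0 < ε) :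
    ∀ᶠ lam in atTop, ∀ g, e.Res lam f g → ∀ x, |lam * g x - f x| ≤ ε := by
  obtain ⟨f', h1, h2, h3⟩ := mollify0 hf hc (show 0 < ε / 3 by positivity)
  obtain ⟨C, hC0, hC⟩ := e.M_bdd (smooth2 h1) h2
  filter_upwards [eventually_gt_atTop 0, eventually_ge_atTop (3 * C / ε)] with lam hl hlC g hg x
  have s1 := hg.smul lam
  have s2 := Ell.Res.of_c2 (e := e) (lam := lam) (smooth2 h1) (cs_zero h2)
  have s3 := s1.close hl (β := lam * (ε / 3) + C) (by positivity) s2 (fun y => by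
    have q1 := abs_le.1 (h3 y)
    have q2 := abs_le.1 (hC y)
    rw [abs_le]; constructor <;> nlinarith) x
  have s4 : (lam * (ε / 3) + C) / lam ≤ 2 * (ε / 3) := by
    rw [div_le_iff₀ hl]
    rw [div_le_iff₀ hε] at hlC
    linarith
  have q1 := abs_le.1 (h3 x)
  have q2 := abs_le.1 (s3.trans s4)
  rw [abs_le]; constructor <;> linarith

theorem lemD {g0 : E → ℝ} (hg : Integrable g0) {ε : ℝ} (hε : 0 < ε) :
    ∃ θ : E → ℝ, Continuous θ ∧ (∀ x, 0 ≤ θ x) ∧ (∀ x, θ x ≤ 1) ∧ ∫ x, max (g0 x) 0 ≤ (∫ x, g0 x * θ x) + ε := by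
  haveI : ProperSpace E := FiniteDimensional.proper ℝ E
  obtain ⟨h, h1, h2, h3, h4⟩ := hg.exists_hasCompactSupport_integral_sub_le (show 0 < ε / 3 by positivity)
  set θ : ℕ → E → ℝ := fun j x => min 1 (j * max (h x) 0) with hθ
  have c : ∀ j, Continuous (θ j) := fun j => by fun_prop
  have p0 : ∀ j x, 0 ≤ θ j x := fun j x => le_min zero_le_one (by positivity)
  have p1 : ∀ j x, θ j x ≤ 1 := fun j x => min_le_left _ _
  have hlim : Tendsto (fun j => ∫ x, h x * θ j x) atTop (𝓝 (∫ x, max (h x) 0)) := by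
    refine tendsto_integral_of_dominated_convergence (fun x => |h x|) (fun j => (h3.mul (c j)).aestronglyMeasurable) h4.abs
      (fun j => Eventually.of_forall fun x => ?_) (Eventually.of_forall fun x => ?_)
    · rw [Real.norm_eq_abs, abs_mul, abs_of_nonneg (p0 j x)]
      exact mul_le_of_le_one_right (abs_nonneg _) (p1 j x)
    · rcases le_or_gt (h x) 0 with hx | hx
      · simp [hθ, hx]
      · refine tendsto_nhds_of_eventually_eq ?_
        filter_upwards [eventually_ge_atTop (Nat.ceil (1 / h x))] with j hj
        have : 1 ≤ j * h x := by
          have := Nat.ceil_le.1 hj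
          rwa [div_le_iff₀ hx] at this
        simp only [hθ, max_eq_left hx.le, min_eq_left this, mul_one]
  obtain ⟨j, hj⟩ := (hlim.eventually (lt_mem_nhds (show (∫ x, max (h x) 0) - ε / 3 < _ by linarith))).exists
  have ib : ∀ {f : E → ℝ}, Integrable f → Integrable fun x => f x * θ j x := fun hf =>
    hf.mul_bdd (c := 1) (c j).aestronglyMeasurable (Eventually.of_forall fun x => by
      rw [Real.norm_eq_abs, abs_of_nonneg (p0 j x)]; exact p1 j x)
  have hd : Integrable fun x => ‖g0 x - h x‖ := (hg.sub h4).norm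
  refine ⟨θ j, c j, p0 j, p1 j, ?_⟩
  have q1 : ∫ x, max (g0 x) 0 ≤ ∫ x, (max (h x) 0 + ‖g0 x - h x‖) :=
    integral_mono hg.pos_part (h4.pos_part.add hd) fun x => by
      have := le_abs_self (g0 x - h x)
      rw [Real.norm_eq_abs]
      exact max_le (by linarith [le_max_left (h x) 0]) (by positivity)
  rw [integral_add h4.pos_part hd] at q1
  have q2 : ∫ x, h x * θ j x ≤ ∫ x, (g0 x * θ j x + ‖g0 x - h x‖) :=
    integral_mono (ib h4) ((ib hg).add hd) fun x => by
      have := neg_abs_le (g0 x - h x)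
      have := abs_nonneg (g0 x - h x)
      rw [Real.norm_eq_abs]
      nlinarith [p0 j x, p1 j x]
  rw [integral_add (ib hg) hd] at q2
  linarith

variable {e}

theorem locInt_max {Ω : Set E} (hΩ : IsOpen Ω) {v1 v2 : E → ℝ} (h1 : LocallyIntegrableOn v1 Ω) (h2 : LocallyIntegrableOn v2 Ω) :
    LocallyIntegrableOn (fun x => max (v1 x) (v2 x)) Ω := by
  haveI : ProperSpace E := FiniteDimensional.proper ℝ E
  rw [locallyIntegrableOn_iff hΩ.isLocallyClosed] at *
  exact fun k hk hkc => (h1 k hk hkc).sup (h2 k hk hkc)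

theorem Ell.DSub.max {Ω : Set E} (hΩ : IsOpen Ω) {v1 v2 : E → ℝ} (h1 : e.DSub Ω v1) (h2 : e.DSub Ω v2)
    (n1 : ∀ x ∈ Ω, v1 x ≤ 0) (n2 : ∀ x ∈ Ω, v2 x ≤ 0) : e.DSub Ω (fun x => Max.max (v1 x) (v2 x)) := by
  have hli := locInt_max hΩ h1.1 h2.1
  refine ⟨hli, fun ω ω1 ω2 ω3 ω4 => ?_⟩
  obtain ⟨N, hN⟩ := ω2.exists_bound_of_continuous ω1.continuous
  have hN0 : 0 ≤ N := (norm_nonneg _).trans (hN 0)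
  have hN' : ∀ x, ω x ≤ N := fun x => (le_abs_self _).trans (hN x)
  obtain ⟨χ, x1, x2, x3, x4, x5, x6⟩ := exists_cut ω2 hΩ ω3
  set U := interior {x | χ x = 1} with hU
  obtain ⟨C0, hC0, hdec⟩ := e.decay ω2 isOpen_interior x6
  obtain ⟨C, hC, hMχ⟩ := e.M_bdd (smooth2 x1) x2
  set B := {x | χ x = 1} with hB
  have hBc : IsClosed B := isClosed_eq x1.continuous continuous_const
  have hBK : B ⊆ tsupport χ := fun x hx => subset_tsupport χ (by simp [Function.mem_support, show χ x = 1 from hx])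
  have hBcp : IsCompact B := IsCompact.of_isClosed_subset x2 hBc hBK
  have ωB : ∀ x, x ∉ B → ω x = 0 := fun x hx => image_eq_zero_of_notMem_tsupport fun h => hx (interior_subset (x6 h))
  have ib : ∀ {v f : E → ℝ}, LocallyIntegrableOn v Ω → Continuous f → IntegrableOn (fun x => v x * f x) B := by
    intro v f hv hf
    obtain ⟨C', hC'⟩ := hBcp.exists_bound_of_continuousOn hf.continuousOn
    exact (hv.integrableOn_compact_subset (hBK.trans x3) hBcp).mul_bdd (c := C') (by fun_prop) ((ae_restrict_iff' hBcp.measurableSet).2 (Eventually.of_forall hC'))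
  set I := (∫ x in tsupport χ, |v1 x|) + (∫ x in tsupport χ, |v2 x|) with hI
  have hI0 : 0 ≤ I := add_nonneg (integral_nonneg fun _ => abs_nonneg _) (integral_nonneg fun _ => abs_nonneg _)
  have claim : ∀ lam, e.Good lam → ∀ g, e.Res lam ω g →
      -(C * (C0 * N / lam ^ 3) * I) ≤ ∫ x in B, Max.max (v1 x) (v2 x) * (lam * g x - ω x) := by
    intro lam hl g hg
    have hl0 : 0 < lam := by linarith [hl.one]
    refine le_eps (c := 1) fun ε hε => ?_
    have ig0 : Integrable fun x => (v1 x - v2 x) * ω x :=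
      int_cs (h1.1.sub h2.1) ω2 ω3 ω1.continuous fun x hx => image_eq_zero_of_notMem_tsupport hx
    obtain ⟨θ, t1, t2, t3, t4⟩ := lemD ig0 hε
    have sub1 : ∀ f : E → ℝ, Continuous f → (∀ x, 0 ≤ f x) → (∀ x, f x ≤ 1) → ∃ g, e.Res lam (fun x => f x * ω x) g ∧
        (∀ x, 0 ≤ g x) ∧ (∀ x, χ x ≠ 1 → g x ≤ C0 * N / lam ^ 3) := by
      intro f f1 f2 f3
      obtain ⟨g, hg⟩ := Ell.Res_exists hl (f := fun x => f x * ω x) (XF.of_cs (f1.mul ω1.continuous) ω2.mul_left)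
      refine ⟨g, hg, hg.nonneg hl0 fun x => mul_nonneg (f2 x) (ω4 x), fun x hx => ?_⟩
      refine hdec lam hl N hN0 _ g hg (fun y => (mul_le_of_le_one_left (ω4 y) (f3 y)).trans (hN' y))
        (fun y hy => by simp [image_eq_zero_of_notMem_tsupport hy]) x fun h => hx (show x ∈ B from interior_subset h)
    obtain ⟨g1, r1, p1, d1⟩ := sub1 θ t1 t2 t3
    obtain ⟨g2, r2, p2, d2⟩ := sub1 (fun x => 1 - θ x) (by fun_prop) (fun x => by linarith [t3 x]) (fun x => by linarith [t2 x])
    have hgg : ∀ x, g x = g1 x + g2 x := by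
      intro x
      have := hg.close hl0 le_rfl (r1.add r2) (fun y => by ring_nf; simp) x
      rw [zero_div, abs_nonpos_iff] at this
      linarith
    have hCN : 0 ≤ C0 * N / lam ^ 3 := by positivity
    have k1 := h1.key e n1 (smooth2 x1) x2 x3 x5 hMχ hl0 (φ := fun x => θ x * ω x) (t1.mul ω1.continuous) r1 (fun x => mul_nonneg (t2 x) (ω4 x))
      (fun x hx => by rw [ωB x hx, mul_zero]) hCN d1
    have k2 := h2.key e n2 (smooth2 x1) x2 x3 x5 hMχ hl0 (φ := fun x => (1 - θ x) * ω x) ((continuous_const.sub t1).mul ω1.continuous) r2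
      (fun x => mul_nonneg (by linarith [t3 x]) (ω4 x)) (fun x hx => by rw [ωB x hx, mul_zero]) hCN d2
    set r : E → ℝ := fun x => (v1 x - v2 x) * ω x * θ x - Max.max ((v1 x - v2 x) * ω x) 0 with hr
    have ir1 : Integrable fun x => (v1 x - v2 x) * ω x * θ x :=
      ig0.mul_bdd (c := 1) t1.aestronglyMeasurable (Eventually.of_forall fun x => by
        rw [Real.norm_eq_abs, abs_of_nonneg (t2 x)]; exact t3 x)
    have ir : Integrable r := ir1.sub ig0.pos_part
    have hr1 : -ε ≤ ∫ x in B, r x := by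
      rw [setIntegral_eq_integral_of_forall_compl_eq_zero (s := B) (fun x hx => by simp [hr, ωB x hx]), hr,
        integral_sub ir1 ig0.pos_part]
      linarith
    have gc1 := r1.continuous
    have gc2 := r2.continuous
    have gc := hg.continuous
    have j1 : IntegrableOn (fun x => v1 x * (lam * g1 x - θ x * ω x)) B := ib h1.1 (by have := ω1.continuous; fun_prop)
    have j2 : IntegrableOn (fun x => v2 x * (lam * g2 x - (1 - θ x) * ω x)) B := ib h2.1 (by have := ω1.continuous; fun_prop)
    have j3 : IntegrableOn (fun x => Max.max (v1 x) (v2 x) * (lam * g x - ω x)) B := ib hli (by have := ω1.continuous; fun_prop)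
    have key : ∫ x in B, (v1 x * (lam * g1 x - θ x * ω x) + v2 x * (lam * g2 x - (1 - θ x) * ω x) + r x) ≤
        ∫ x in B, Max.max (v1 x) (v2 x) * (lam * g x - ω x) := by
      refine setIntegral_mono ((j1.add j2).add ir.integrableOn) j3 fun x => ?_
      have e1 : Max.max ((v1 x - v2 x) * ω x) 0 = Max.max (v1 x) (v2 x) * ω x - v2 x * ω x := by
        rcases le_total (v1 x) (v2 x) with h | h
        · rw [max_eq_right h, max_eq_right (mul_nonpos_of_nonpos_of_nonneg (by linarith) (ω4 x))]; ring
        · rw [max_eq_left h, max_eq_left (mul_nonneg (by linarith) (ω4 x))]; ring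
      have e2 := mul_le_mul_of_nonneg_right (le_max_left (v1 x) (v2 x)) (mul_nonneg hl0.le (p1 x))
      have e3 := mul_le_mul_of_nonneg_right (le_max_right (v1 x) (v2 x)) (mul_nonneg hl0.le (p2 x))
      simp only [hr, e1, hgg x]
      nlinarith
    have j12 : IntegrableOn (fun x => v1 x * (lam * g1 x - θ x * ω x) + v2 x * (lam * g2 x - (1 - θ x) * ω x)) B := j1.add j2
    rw [integral_add j12 ir.integrableOn, integral_add j1 j2] at key
    rw [hI]
    linarith
  have iv : IntegrableOn (fun x => Max.max (v1 x) (v2 x)) B := hli.integrableOn_compact_subset (hBK.trans x3) hBcp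
  have MB : ∀ x, x ∉ B → e.M ω x = 0 := fun x hx => e.M_off fun h => hx (interior_subset (x6 h))
  rw [← setIntegral_eq_integral_of_forall_compl_eq_zero (s := B) (fun x hx => by rw [MB x hx, mul_zero])]
  refine le_eps (c := C * (C0 * N) * I + ∫ x in B, |Max.max (v1 x) (v2 x)|) fun ε hε => ?_
  obtain ⟨lam, hgood, hlε, hS⟩ := (e.good_ev.and ((eventually_ge_atTop (1 / ε)).and (e.S_tendsto (e.M_cont ω1) (e.M_cs ω2) hε))).exists
  have hl1 := hgood.one
  have hl0 : 0 < lam := by linarith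
  obtain ⟨gM, hgM⟩ := Ell.Res_exists hgood (XF.of_cs (e.M_cont ω1) (e.M_cs ω2))
  have hres : e.Res lam ω (fun x => 1 / lam * (ω x + gM x)) := by
    have := ((Ell.Res.of_c2 (e := e) (lam := lam) ω1 (cs_zero ω2)).add hgM).smul (1 / lam)
    exact this.congr_left fun x => by field_simp; ring
  have c1 := claim lam hgood _ hres
  have c2 : ∀ x, lam * (1 / lam * (ω x + gM x)) - ω x = gM x := fun x => by field_simp; ring
  simp only [c2] at c1
  have hgc := hgM.continuous
  have j1 : IntegrableOn (fun x => Max.max (v1 x) (v2 x) * gM x) B := ib hli hgc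
  have j2 : IntegrableOn (fun x => Max.max (v1 x) (v2 x) * e.M ω x) B := ib hli (e.M_cont ω1)
  have c3 : ∫ x in B, lam * (Max.max (v1 x) (v2 x) * gM x) ≤ ∫ x in B, (Max.max (v1 x) (v2 x) * e.M ω x + ε * |Max.max (v1 x) (v2 x)|) := by
    refine setIntegral_mono (j1.const_mul _) (j2.add (iv.abs.const_mul _)) fun x => ?_
    have := hS gM hgM x
    have q : Max.max (v1 x) (v2 x) * (lam * gM x - e.M ω x) ≤ |Max.max (v1 x) (v2 x)| * ε := by
      refine (le_abs_self _).trans ?_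
      rw [abs_mul]
      exact mul_le_mul_of_nonneg_left this (abs_nonneg _)
    nlinarith
  rw [integral_const_mul, integral_add j2 (iv.abs.const_mul _), integral_const_mul] at c3
  have c4 : lam * -(C * (C0 * N / lam ^ 3) * I) ≤ lam * ∫ x in B, Max.max (v1 x) (v2 x) * gM x := mul_le_mul_of_nonneg_left c1 hl0.le
  have c5 : lam * -(C * (C0 * N / lam ^ 3) * I) = -(C * (C0 * N) * I * (1 / lam ^ 2)) := by field_simp
  have c6 : 1 / lam ^ 2 ≤ ε := by
    rw [div_le_iff₀ hε] at hlε
    rw [div_le_iff₀ (by positivity)]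
    nlinarith
  have c7 : C * (C0 * N) * I * (1 / lam ^ 2) ≤ C * (C0 * N) * I * ε := mul_le_mul_of_nonneg_left c6 (by positivity)
  nlinarith

end T1

end Part8

section Part9
set_option linter.unusedSectionVars false
set_option linter.style.haveILetI false
set_option synthInstance.maxHeartbeats 400000
set_option maxSynthPendingDepth 3

section T2

variable {E : Type*} [NormedAddCommGroup E] [NormedSpace ℝ E] [FiniteDimensional ℝ E]
variable  [MeasureSpace E] [BorelSpace E] [(volume : Measure E).IsAddHaarMeasure]
variable {m : ℕ} (e : Ell E m)

/-- self-adjointness on `D` -/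
def Ell.SA (D : Set E) : Prop := ∀ f g : E → ℝ, ContDiff ℝ 2 f → ContDiff ℝ 2 g → HasCompactSupport g → tsupport g ⊆ D →
  ∫ x, f x * e.M g x = ∫ x, g x * e.M f x

variable {e}

theorem Ell.DSub.of_c2 {D : Set E} (hs : e.SA D) {f : E → ℝ} (hf : ContDiff ℝ 2 f) (h : ∀ x ∈ D, 0 ≤ e.M f x) : e.DSub D f := by
  refine ⟨(hf.continuous.locallyIntegrable).locallyIntegrableOn D, fun ω h1 h2 h3 h4 => ?_⟩
  rw [hs f ω hf h1 h2 h3]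
  refine integral_nonneg fun x => ?_
  by_cases hx : x ∈ tsupport ω
  · exact mul_nonneg (h4 x) (h x (h3 hx))
  · simp [image_eq_zero_of_notMem_tsupport hx]

theorem Ell.DSub.int {D : Set E} {v : E → ℝ} (hv : LocallyIntegrableOn v D) {ω : E → ℝ} (h1 : ContDiff ℝ 2 ω) (h2 : HasCompactSupport ω)
    (h3 : tsupport ω ⊆ D) : Integrable fun x => v x * e.M ω x :=
  int_cs hv h2 h3 (e.M_cont h1) fun _ hx => e.M_off hx

theorem Ell.DSub.add {D : Set E} {v w : E → ℝ} (hv : e.DSub D v) (hw : e.DSub D w) : e.DSub D (fun x => v x + w x) := by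
  refine ⟨hv.1.add hw.1, fun ω h1 h2 h3 h4 => ?_⟩
  simp only [add_mul]
  rw [integral_add (Ell.DSub.int hv.1 h1 h2 h3) (Ell.DSub.int hw.1 h1 h2 h3)]
  exact add_nonneg (hv.2 ω h1 h2 h3 h4) (hw.2 ω h1 h2 h3 h4)

theorem Ell.DSub.lower {D : Set E} (hD : IsOpen D) (hs : e.SA D) {v p θ : E → ℝ} {Mc Bp : ℝ} (hMc : 0 ≤ Mc)
    (hv : e.DSub D v) (hv2 : ∀ x ∈ D, v x ≤ 0) (hp : ContDiff ℝ 2 p) (hp0 : ∀ x ∈ D, p x ≤ 0)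
    (hp1 : ∀ x ∈ D, 1 ≤ e.M p x) (hp2 : ∀ x ∈ D, e.M p x ≤ Bp) (hB : 0 ≤ Bp) (hθ : ContDiff ℝ 2 θ) (hθc : HasCompactSupport θ) (hθ0 : ∀ x, 0 ≤ θ x) :
    ∃ C' : ℝ, 0 ≤ C' ∧ ∀ τ : E → ℝ, ContDiff ℝ 2 τ → HasCompactSupport τ → tsupport τ ⊆ D → (∀ x, 0 ≤ τ x) →
      -(C' * ∫ x, τ x) ≤ ∫ x, Max.max (v x) (-Mc * θ x) * e.M τ x := by
  obtain ⟨C, hC, hMθ⟩ := e.M_bdd hθ hθc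
  have hq : ContDiff ℝ 2 fun x => Mc * C * p x := contDiff_const.mul hp
  have hMq : ∀ x, e.M (fun x => Mc * C * p x) x = Mc * C * e.M p x := e.M_smul hp _
  have hr : ContDiff ℝ 2 fun x => -Mc * θ x := contDiff_const.mul hθ
  have hMr : ∀ x, e.M (fun x => -Mc * θ x) x = -Mc * e.M θ x := e.M_smul hθ _
  have hMC : 0 ≤ Mc * C := by positivity
  have d0 : e.DSub D (fun x => Mc * C * p x) := Ell.DSub.of_c2 hs hq fun x hx => by
    rw [hMq]; exact mul_nonneg hMC (by linarith [hp1 x hx])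
  have d1 := hv.add d0
  have d2 : e.DSub D (fun x => -Mc * θ x + Mc * C * p x) := Ell.DSub.of_c2 hs (hr.add hq) fun x hx => by
    rw [e.M_add hr hq, hMr, hMq]
    have h1 := mul_le_mul_of_nonneg_left (abs_le.1 (hMθ x)).2 hMc
    have h2 := mul_le_mul_of_nonneg_left (hp1 x hx) hMC
    nlinarith
  have qn : ∀ x ∈ D, Mc * C * p x ≤ 0 := fun x hx => mul_nonpos_of_nonneg_of_nonpos hMC (hp0 x hx)
  have d3 := Ell.DSub.max hD d1 d2 (fun x hx => add_nonpos (hv2 x hx) (qn x hx))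
    (fun x hx => add_nonpos (by have := mul_nonneg hMc (hθ0 x); linarith) (qn x hx))
  have lW := locInt_max hD hv.1 ((hr.continuous.locallyIntegrable).locallyIntegrableOn D)
  refine ⟨Mc * C * Bp, by positivity, fun τ h1 h2 h3 h4 => ?_⟩
  have q := d3.2 τ h1 h2 h3 h4
  have q2 : ∀ x, Max.max (v x + Mc * C * p x) (-Mc * θ x + Mc * C * p x) = Max.max (v x) (-Mc * θ x) + Mc * C * p x := fun x =>
    max_add_add_right _ _ _
  simp only [q2, add_mul] at q
  rw [integral_add (Ell.DSub.int lW h1 h2 h3) (Ell.DSub.int d0.1 h1 h2 h3), hs _ τ hq h1 h2 h3] at q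
  have q3 : ∫ x, τ x * e.M (fun x => Mc * C * p x) x ≤ ∫ x, Mc * C * Bp * τ x := by
    refine integral_mono ?_ ((h1.continuous.integrable_of_hasCompactSupport h2).const_mul _) fun x => ?_
    · exact (h1.continuous.mul (e.M_cont hq)).integrable_of_hasCompactSupport h2.mul_right
    · by_cases hx : x ∈ tsupport τ
      · have := mul_le_mul_of_nonneg_left (hp2 x (h3 hx)) hMC
        have := mul_le_mul_of_nonneg_left this (h4 x)
        simp only [hMq]
        linarith
      · simp [image_eq_zero_of_notMem_tsupport hx]
  rw [integral_const_mul] at q3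
  linarith

theorem Ell.Res.dual {D : Set E} (hs : e.SA D) {lam : ℝ} {P φ g : E → ℝ} (hP : ContDiff ℝ 2 P) (hc : HasCompactSupport P) (ht : tsupport P ⊆ D)
    (hφ : Continuous φ) (hg : e.Res lam φ g) : lam * ∫ x, P x * g x = (∫ x, P x * φ x) + ∫ x, g x * e.M P x := by
  have gc := hg.continuous
  have iP : ∀ {f : E → ℝ}, Continuous f → Integrable fun x => P x * f x := fun hf =>
    (hP.continuous.mul hf).integrable_of_hasCompactSupport hc.mul_right
  have iM : ∀ {f : E → ℝ}, Continuous f → Integrable fun x => f x * e.M P x := fun hf =>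
    (hf.mul (e.M_cont hP)).integrable_of_hasCompactSupport (e.M_cs hc).mul_left
  have iPa : Integrable fun x => |P x| := (hP.continuous.integrable_of_hasCompactSupport hc).abs
  have iMa : Integrable fun x => |e.M P x| := ((e.M_cont hP).integrable_of_hasCompactSupport (e.M_cs hc)).abs
  have key : |lam * (∫ x, P x * g x) - (∫ x, P x * φ x) - ∫ x, g x * e.M P x| ≤ 0 := by
    refine le_eps (c := (1 + |lam|) * (∫ x, |P x|) + ∫ x, |e.M P x|) fun ε hε => ?_
    obtain ⟨g1, h1, -, h3, h4⟩ := hg ε hε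
    have e1 : lam * (∫ x, P x * g x) - (∫ x, P x * φ x) - ∫ x, g x * e.M P x =
        ∫ x, (P x * (lam * (g x - g1 x) + (lam * g1 x - e.M g1 x - φ x)) - (g x - g1 x) * e.M P x) := by
      have s1 : ∫ x, P x * (lam * (g x - g1 x) + (lam * g1 x - e.M g1 x - φ x)) =
          lam * (∫ x, P x * g x) - (∫ x, P x * e.M g1 x) - ∫ x, P x * φ x := by
        rw [← integral_const_mul, ← integral_sub ((iP gc).const_mul _) (iP (e.M_cont h1)), ← integral_sub _ (iP hφ)]
        · exact integral_congr_ae (Eventually.of_forall fun x => by ring)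
        · exact ((iP gc).const_mul _).sub (iP (e.M_cont h1))
      rw [integral_sub (iP _) (iM _), s1]
      · simp only [sub_mul]
        rw [integral_sub (iM gc) (iM h1.continuous), hs g1 P h1 hP hc ht]
        ring
      · have := e.M_cont h1
        have := h1.continuous
        fun_prop
      · exact gc.sub h1.continuous
    rw [e1, zero_add]
    have e2 : ε * ((1 + |lam|) * (∫ x, |P x|) + ∫ x, |e.M P x|) = ∫ x, (ε * (1 + |lam|) * |P x| + ε * |e.M P x|) := by
      rw [integral_add (iPa.const_mul _) (iMa.const_mul _), integral_const_mul, integral_const_mul]; ring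
    rw [e2, ← Real.norm_eq_abs]
    refine (norm_integral_le_of_norm_le ((iPa.const_mul _).add (iMa.const_mul _)) (Eventually.of_forall fun x => ?_))
    rw [Real.norm_eq_abs]
    refine (abs_sub _ _).trans (add_le_add ?_ ?_)
    · rw [abs_mul, mul_comm]
      refine mul_le_mul_of_nonneg_right ?_ (abs_nonneg _)
      refine (abs_add_le _ _).trans ?_
      rw [abs_mul, abs_sub_comm]
      have := mul_le_mul_of_nonneg_left (h3 x) (abs_nonneg lam)
      linarith [h4 x]
    · rw [abs_mul, abs_sub_comm]
      exact mul_le_mul_of_nonneg_right (h3 x) (abs_nonneg _)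
  have := abs_nonpos_iff.1 key
  linarith

theorem nonpos_of_test {f : E → ℝ} (hf : Continuous f) {O : Set E} (hO : IsOpen O)
    (h : ∀ φ : E → ℝ, ContDiff ℝ (⊤ : ℕ∞) φ → HasCompactSupport φ → tsupport φ ⊆ O → (∀ x, 0 ≤ φ x) → ∫ x, f x * φ x ≤ 0) :
    ∀ y ∈ O, f y ≤ 0 := by
  intro y hy
  by_contra hc
  push Not at hc
  obtain ⟨φ, a1, a2, a3, a4, a5, a6⟩ := exists_cut (K := {y}) (U := O ∩ {x | 0 < f x}) isCompact_singleton
    (hO.inter (isOpen_lt continuous_const hf)) (by simp [hy, hc])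
  have h1 := h φ a1 a2 (a3.trans Set.inter_subset_left) a4
  have h2 : 0 < ∫ x, f x * φ x := by
    refine Continuous.integral_pos_of_hasCompactSupport_nonneg_nonzero (x := y) (hf.mul a1.continuous) a2.mul_left (fun x => ?_) ?_
    · by_cases hx : x ∈ tsupport φ
      · exact mul_nonneg (le_of_lt (a3 hx).2) (a4 x)
      · simp [image_eq_zero_of_notMem_tsupport hx]
    · have : y ∈ {x | φ x = 1} := interior_subset (a6 (by simp))
      rw [show φ y = 1 from this]; simpa using hc.ne'
  linarith

end T2

end Part9

section Part10
set_option linter.unusedSectionVars false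
set_option linter.style.haveILetI false
set_option synthInstance.maxHeartbeats 400000
set_option maxSynthPendingDepth 3

section T3

variable {E : Type*} [NormedAddCommGroup E] [NormedSpace ℝ E] [FiniteDimensional ℝ E]
variable  [MeasureSpace E] [BorelSpace E] [(volume : Measure E).IsAddHaarMeasure]
variable {m : ℕ} {e : Ell E m}

theorem mem_one {θ : E → ℝ} {K : Set E} (h : K ⊆ interior {x | θ x = 1}) {x : E} (hx : x ∈ K) : θ x = 1 := by
  have : x ∈ {x | θ x = 1} := interior_subset (h hx)
  exact this

theorem ev_one {θ : E → ℝ} {K : Set E} (h : K ⊆ interior {x | θ x = 1}) {x : E} (hx : x ∈ K) : ∀ᶠ y in 𝓝 x, θ y = 1 := by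
  filter_upwards [isOpen_interior.mem_nhds (h hx)] with y hy
  have : y ∈ {x | θ x = 1} := interior_subset hy
  exact this

theorem bdd_int {W : E → ℝ} (Wm : Measurable W) {T : Set E} (hT : IsCompact T) (h0 : ∀ x, x ∉ T → W x = 0) {Mc : ℝ} (hW : ∀ x, |W x| ≤ Mc) :
    Integrable W := by
  rw [← integrableOn_iff_integrable_of_support_subset (s := T) (fun x hx => by by_contra h; exact hx (h0 x h))]
  exact Measure.integrableOn_of_bounded hT.measure_lt_top.ne Wm.aestronglyMeasurable (M := Mc) (Eventually.of_forall hW)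

theorem Ell.T2W {D : Set E} (hD : IsOpen D) (hs : e.SA D) {v p : E → ℝ} {Mc Bp : ℝ} (hMc : 0 ≤ Mc) (vm : Measurable v)
    (v0 : ∀ x, x ∉ D → v x = 0) (lb : ∀ x, -Mc ≤ v x) (ub : ∀ x, v x ≤ 0)
    (hv : e.DSub D v) (hp : ContDiff ℝ 2 p) (hp0 : ∀ x ∈ D, p x ≤ 0)
    (hp1 : ∀ x ∈ D, 1 ≤ e.M p x) (hp2 : ∀ x ∈ D, e.M p x ≤ Bp) (hB : 0 ≤ Bp) {K1 : Set E} (hK1 : IsCompact K1) (hKD : K1 ⊆ D) :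
    ∃ (W P : E → ℝ) (C' : ℝ) (T : Set E), Measurable W ∧ (∀ x, |W x| ≤ Mc) ∧ (∀ x, W x ≤ 0) ∧ IsCompact T ∧ (∀ x, x ∉ T → W x = 0) ∧
      (∀ x ∈ K1, W x = v x) ∧ ContDiff ℝ 2 P ∧ HasCompactSupport P ∧ tsupport P ⊆ D ∧ tsupport P ⊆ T ∧ (∀ x, 0 ≤ P x) ∧ (∀ x ∈ K1, P x = 0) ∧ 0 ≤ C' ∧
      ∀ τ : E → ℝ, ContDiff ℝ 2 τ → HasCompactSupport τ → (∀ x, 0 ≤ τ x) → -(C' * ∫ x, P x * τ x) ≤ ∫ x, W x * e.M τ x := by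
  obtain ⟨θ, a1, a2, a3, a4, a5, a6⟩ := exists_cut hK1 hD hKD
  obtain ⟨ζ, b1, b2, b3, b4, b5, b6⟩ := exists_cut a2 hD a3
  obtain ⟨ξ, c1, c2, c3, c4, c5, c6⟩ := exists_cut hK1 isOpen_interior a6
  obtain ⟨C', hC', hlow⟩ := Ell.DSub.lower hD hs hMc hv (fun x _ => ub x) hp hp0 hp1 hp2 hB (smooth2 a1) a2 a4
  have hW0 : ∀ x, θ x = 0 → Max.max (v x) (-Mc * θ x) = 0 := fun x hx => by rw [hx, mul_zero]; exact max_eq_right (ub x)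
  have hW1 : ∀ x, θ x = 1 → Max.max (v x) (-Mc * θ x) = v x := fun x hx => by rw [hx, mul_one]; exact max_eq_left (lb x)
  set W : E → ℝ := fun x => Max.max (v x) (-Mc * θ x) with hWd
  have hWn : ∀ x, W x ≤ 0 := fun x => max_le (ub x) (by have := mul_nonneg hMc (a4 x); linarith)
  have hWb : ∀ x, |W x| ≤ Mc := fun x => abs_le.2 ⟨(lb x).trans (le_max_left _ _), (hWn x).trans hMc⟩
  have hWm : Measurable W := vm.max (by have := a1.continuous.measurable; fun_prop)
  have θζ : ∀ x, ζ x ≠ 1 → θ x = 0 := fun x hx => by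
    by_contra h
    exact hx (mem_one b6 (subset_tsupport θ h))
  have hWT : ∀ x, x ∉ tsupport ζ → W x = 0 := fun x hx => hW0 x (θζ x (by rw [image_eq_zero_of_notMem_tsupport hx]; norm_num))
  have hPts : tsupport (fun x => ζ x * (1 - ξ x)) ⊆ tsupport ζ := tsupport_mul_subset_left
  have iW : Integrable W := bdd_int hWm b2 hWT hWb
  have ζξ : ∀ x, ζ x * ξ x = ξ x := fun x => by
    by_cases h : ξ x = 0
    · simp [h]
    · have h1 : x ∈ {x | θ x = 1} := interior_subset (c3 (subset_tsupport ξ h))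
      have h2 : ζ x = 1 := by by_contra h'; have := θζ x h'; rw [show θ x = 1 from h1] at this; norm_num at this
      rw [h2, one_mul]
  refine ⟨W, fun x => ζ x * (1 - ξ x), C', tsupport ζ, hWm, hWb, hWn, b2, hWT, fun x hx => hW1 x (mem_one a6 hx),
    smooth2 (b1.mul (contDiff_const.sub c1)), b2.mul_right, hPts.trans b3, hPts, fun x => mul_nonneg (b4 x) (by linarith [c5 x]),
    fun x hx => by simp [mem_one c6 hx], hC', fun τ t1 t2 t3 => ?_⟩
  have iWM : ∀ {f : E → ℝ}, ContDiff ℝ 2 f → HasCompactSupport f → Integrable fun x => W x * e.M f x := fun {f} h1 h2 => by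
    obtain ⟨C, -, hC⟩ := e.M_bdd h1 h2
    exact iW.mul_bdd (c := C) (e.M_cont h1).aestronglyMeasurable (Eventually.of_forall hC)
  have s1 : ContDiff ℝ 2 fun x => τ x * (1 - ζ x) := t1.mul (contDiff_const.sub (smooth2 b1))
  have s2 : ContDiff ℝ 2 fun x => τ x * ξ x := t1.mul (smooth2 c1)
  have s3 : ContDiff ℝ 2 fun x => ζ x * (1 - ξ x) * τ x := (smooth2 (b1.mul (contDiff_const.sub c1))).mul t1
  have k1 : HasCompactSupport fun x => τ x * (1 - ζ x) := t2.mul_right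
  have k2 : HasCompactSupport fun x => τ x * ξ x := t2.mul_right
  have k3 : HasCompactSupport fun x => ζ x * (1 - ξ x) * τ x := t2.mul_left
  have hM : ∀ x, e.M τ x = e.M (fun x => τ x * (1 - ζ x)) x + e.M (fun x => τ x * ξ x) x + e.M (fun x => ζ x * (1 - ξ x) * τ x) x := fun x => by
    rw [← e.M_add s1 s2, ← e.M_add (s1.add s2) s3]
    congr 1
    funext y
    linear_combination τ y * ζξ y
  have z1 : ∀ x, W x * e.M (fun x => τ x * (1 - ζ x)) x = 0 := fun x => by
    by_cases h : θ x = 0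
    · rw [show W x = 0 from hW0 x h, zero_mul]
    · have : (fun x => τ x * (1 - ζ x)) =ᶠ[𝓝 x] fun _ => 0 := by
        filter_upwards [ev_one b6 (subset_tsupport θ h)] with y hy
        simp [hy]
      rw [e.M_congr this, e.M_const, mul_zero]
  have z2 : ∀ x, W x * e.M (fun x => τ x * ξ x) x = v x * e.M (fun x => τ x * ξ x) x := fun x => by
    by_cases h : x ∈ tsupport ξ
    · have h1 : x ∈ {x | θ x = 1} := interior_subset (c3 h)
      rw [show W x = v x from hW1 x h1]
    · have : x ∉ tsupport (fun x => τ x * ξ x) := fun h' => h (tsupport_mul_subset_right h')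
      rw [e.M_off this, mul_zero, mul_zero]
  have q : ∫ x, W x * e.M τ x = (∫ x, v x * e.M (fun x => τ x * ξ x) x) + ∫ x, W x * e.M (fun x => ζ x * (1 - ξ x) * τ x) x := by
    rw [← integral_add]
    · refine integral_congr_ae (Eventually.of_forall fun x => ?_)
      have h1 := z1 x
      have h2 := z2 x
      simp only [hM x]
      linear_combination h1 + h2
    · exact (iWM s2 k2).congr (Eventually.of_forall z2)
    · exact iWM s3 k3
  have h1 : tsupport (fun x => τ x * ξ x) ⊆ D := (tsupport_mul_subset_right (f := τ) (g := ξ)).trans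
    (c3.trans (interior_subset.trans fun x hx => a3 (subset_tsupport θ (by
      rw [Function.mem_support, show θ x = 1 from hx]; norm_num))))
  have h2 : tsupport (fun x => ζ x * (1 - ξ x) * τ x) ⊆ D :=
    ((tsupport_mul_subset_left (f := fun x => ζ x * (1 - ξ x)) (g := τ)).trans hPts).trans b3
  have r1 := hv.2 _ s2 k2 h1 fun x => mul_nonneg (t3 x) (c4 x)
  have r2 := hlow _ s3 k3 h2 fun x => mul_nonneg (mul_nonneg (b4 x) (by linarith [c5 x])) (t3 x)
  rw [q]
  linarith

theorem Ell.T2c {W P : E → ℝ} {C' Mc : ℝ} {T : Set E} (hWm : Measurable W) (hWb : ∀ x, |W x| ≤ Mc) (hT : IsCompact T)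
    (hWT : ∀ x, x ∉ T → W x = 0) (hP : ContDiff ℝ 2 P) (hPc : HasCompactSupport P) (hPT : tsupport P ⊆ T) (hP0 : ∀ x, 0 ≤ P x) (hC' : 0 ≤ C')
    (H : ∀ τ : E → ℝ, ContDiff ℝ 2 τ → HasCompactSupport τ → (∀ x, 0 ≤ τ x) → -(C' * ∫ x, P x * τ x) ≤ ∫ x, W x * e.M τ x)
    {lam : ℝ} (hl : 0 < lam) {φ g : E → ℝ} (hφ : Continuous φ) (hφ0 : ∀ x, 0 ≤ φ x) (hg : e.Res lam φ g) :
    -(C' * ∫ x, P x * g x) ≤ ∫ x, W x * (lam * g x - φ x) := by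
  obtain ⟨χ, a1, a2, a3, a4, a5, a6⟩ := exists_cut hT isOpen_univ (Set.subset_univ T)
  have iW : Integrable W := bdd_int hWm hT hWT hWb
  have gc := hg.continuous
  have iWf : ∀ {f : E → ℝ}, Continuous f → Integrable fun x => W x * f x := fun {f} hf => by
    refine (int_cs (f := fun x => f x * χ x) (iW.locallyIntegrable.locallyIntegrableOn Set.univ) a2 a3 (hf.mul a1.continuous)
      (fun x hx => by simp [image_eq_zero_of_notMem_tsupport hx])).congr (Eventually.of_forall fun x => ?_)
    by_cases hx : x ∈ T
    · simp [mem_one a6 hx]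
    · simp [hWT x hx]
  have iPf : ∀ {f : E → ℝ}, Continuous f → Integrable fun x => P x * f x := fun hf =>
    (hP.continuous.mul hf).integrable_of_hasCompactSupport hPc.mul_right
  have iP : Integrable P := hP.continuous.integrable_of_hasCompactSupport hPc
  refine le_eps (c := (1 + lam) * (∫ x, |W x|) + C' * (2 * ∫ x, P x)) fun ε hε => ?_
  obtain ⟨g1, h1, -, h3, h4⟩ := hg ε hε
  have hge : ContDiff ℝ 2 fun x => g1 x + ε := h1.add contDiff_const
  have hτ : ContDiff ℝ 2 fun x => χ x * (g1 x + ε) := (smooth2 a1).mul hge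
  have q1 := H _ hτ a2.mul_right fun x => mul_nonneg (a4 x) (by
    have := (abs_le.1 (h3 x)).1; have := hg.nonneg hl hφ0 x; linarith)
  have q2 : ∫ x, W x * e.M (fun x => χ x * (g1 x + ε)) x ≤ ∫ x, (W x * (lam * g x - φ x) + ε * (1 + lam) * |W x|) := by
    refine integral_mono (iWf (e.M_cont hτ)) ((iWf (by fun_prop)).add (iW.abs.const_mul _)) fun x => ?_
    by_cases hx : x ∈ T
    · have e1 : e.M (fun x => χ x * (g1 x + ε)) x = e.M g1 x := by
        have : (fun x => χ x * (g1 x + ε)) =ᶠ[𝓝 x] fun x => g1 x + ε := by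
          filter_upwards [ev_one a6 hx] with y hy
          simp [hy]
        rw [e.M_congr this, e.M_add h1 contDiff_const, e.M_const, add_zero]
      have e2 : |e.M g1 x - (lam * g x - φ x)| ≤ ε * (1 + lam) := by
        have i1 := abs_le.1 (h3 x)
        have i2 := abs_le.1 (h4 x)
        rw [abs_le]; constructor <;> nlinarith
      have e3 : W x * (e.M g1 x - (lam * g x - φ x)) ≤ |W x| * (ε * (1 + lam)) := by
        refine (le_abs_self _).trans ?_
        rw [abs_mul]; exact mul_le_mul_of_nonneg_left e2 (abs_nonneg _)
      simp only [e1]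
      linarith
    · simp [hWT x hx]
  rw [integral_add (iWf (by fun_prop)) (iW.abs.const_mul _), integral_const_mul] at q2
  have q3 : ∫ x, P x * (χ x * (g1 x + ε)) ≤ ∫ x, (P x * g x + 2 * ε * P x) := by
    have := h1.continuous
    have := a1.continuous
    refine integral_mono (iPf (by fun_prop)) ((iPf gc).add (iP.const_mul _)) fun x => ?_
    by_cases hx : x ∈ T
    · simp only [mem_one a6 hx]
      have := mul_le_mul_of_nonneg_left (abs_le.1 (h3 x)).2 (hP0 x)
      linarith
    · simp [image_eq_zero_of_notMem_tsupport fun h => hx (hPT h)]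
  rw [integral_add (iPf gc) (iP.const_mul _), integral_const_mul] at q3
  have q4 := mul_le_mul_of_nonneg_left q3 hC'
  linarith

theorem Ell.T2 {D : Set E} (hD : IsOpen D) (hs : e.SA D) {v p : E → ℝ} {Mc Bp : ℝ} (hMc : 0 ≤ Mc) (vm : Measurable v)
    (v0 : ∀ x, x ∉ D → v x = 0) (lb : ∀ x, -Mc ≤ v x) (ub : ∀ x, v x ≤ 0)
    (hv : e.DSub D v) (hp : ContDiff ℝ 2 p) (hp0 : ∀ x ∈ D, p x ≤ 0)
    (hp1 : ∀ x ∈ D, 1 ≤ e.M p x) (hp2 : ∀ x ∈ D, e.M p x ≤ Bp) (hB : 0 ≤ Bp) {K1 : Set E} (hK1 : IsCompact K1) (hKD : K1 ⊆ D) :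
    ∃ C : ℝ, 0 ≤ C ∧ ∀ lam, e.Good lam → ∃ u : E → ℝ, Continuous u ∧ (∀ x, u x ≤ 0) ∧
      (∀ φ : E → ℝ, Continuous φ → (∀ x, 0 ≤ φ x) → HasCompactSupport φ → tsupport φ ⊆ K1 →
        (∫ x, v x * φ x) - C * e.J lam * (∫ x, φ x) ≤ ∫ x, u x * φ x) ∧
      (∀ ω : E → ℝ, ContDiff ℝ 2 ω → (∀ x, 0 ≤ ω x) → HasCompactSupport ω → tsupport ω ⊆ K1 →
        - (C * e.J lam * (∫ x, ω x)) ≤ ∫ x, u x * e.M ω x) ∧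
      (∀ (p0 : E → ℝ) (C0 s : ℝ), ContDiff ℝ 2 p0 → HasCompactSupport p0 → tsupport p0 ⊆ K1 → (∀ x, 0 ≤ p0 x) → (∀ x, p0 x ≤ 1) →
        (∀ x, |e.M p0 x| ≤ C0) → s ≤ 0 → (∀ x, p0 x ≠ 0 → v x ≤ s) → ∀ y ∈ interior {x | p0 x = 1}, u y ≤ s * (1 - 2 * C0 * e.J lam)) := by
  obtain ⟨W, P, C', T, hWm, hWb, hWn, hT, hWT, hWv, hP, hPc, hPD, hPT, hP0, hPK, hC', H⟩ :=
    Ell.T2W hD hs hMc vm v0 lb ub hv hp hp0 hp1 hp2 hB hK1 hKD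
  obtain ⟨CP, hCP, hMP⟩ := e.M_bdd hP hPc
  have iW : Integrable W := bdd_int hWm hT hWT hWb
  refine ⟨C' * (CP * 2), by positivity, fun lam hl => ?_⟩
  have hl0 : 0 < lam := by linarith [hl.one]
  have hJ := e.J_nonneg lam
  obtain ⟨u0, uc, ub0, hrep⟩ := Ell.rep hl hWm hMc hWb iW
  have massM : ∀ {Q φ g : E → ℝ} {C0 : ℝ}, ContDiff ℝ 2 Q → HasCompactSupport Q → (∀ x, |e.M Q x| ≤ C0) → Continuous φ → HasCompactSupport φ →
      (∀ x, 0 ≤ φ x) → e.Res lam φ g → |∫ x, g x * e.M Q x| ≤ C0 * 2 * e.J lam * ∫ x, φ x := by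
    intro Q φ g C0 h1 h2 h3 h4 h5 h6 h7
    have g0 := h7.nonneg hl0 h6
    have gc := h7.continuous
    have hC0 : 0 ≤ C0 := (abs_nonneg _).trans (h3 0)
    have hm := h7.mass hl (X := tsupport Q) (isClosed_tsupport Q).measurableSet h2.isBounded (XF.of_cs h4 h5) h6
    rw [← setIntegral_eq_integral_of_forall_compl_eq_zero (s := tsupport Q) (fun x hx => by rw [e.M_off hx, mul_zero])]
    have : |∫ x in tsupport Q, g x * e.M Q x| ≤ ∫ x in tsupport Q, C0 * g x := by
      rw [← Real.norm_eq_abs]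
      refine norm_integral_le_of_norm_le ((gc.continuousOn.integrableOn_compact h2).const_mul _) (Eventually.of_forall fun x => ?_)
      rw [Real.norm_eq_abs, abs_mul, abs_of_nonneg (g0 x), mul_comm]
      exact mul_le_mul_of_nonneg_right (h3 x) (g0 x)
    rw [integral_const_mul] at this
    have := mul_le_mul_of_nonneg_left hm hC0
    linarith
  have iWf : ∀ {f : E → ℝ}, Continuous f → HasCompactSupport f → Integrable fun x => W x * f x := fun {f} hf hc => by
    obtain ⟨C, hC⟩ := hc.exists_bound_of_continuous hf
    exact iW.mul_bdd (c := C) hf.aestronglyMeasurable (Eventually.of_forall hC)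
  have iWg : ∀ {g : E → ℝ}, Continuous g → Integrable fun x => W x * g x := fun {g} gc => by
    obtain ⟨C, hC⟩ := hT.exists_bound_of_continuousOn gc.continuousOn
    refine bdd_int (hWm.mul gc.measurable) hT (fun x hx => by simp [hWT x hx]) (Mc := Mc * |C|) fun x => ?_
    rw [abs_mul]
    by_cases hx : x ∈ T
    · exact mul_le_mul (hWb x) ((hC x hx).trans (le_abs_self C)) (abs_nonneg _) hMc
    · rw [hWT x hx, abs_zero, zero_mul]; positivity
  have low : ∀ φ : E → ℝ, Continuous φ → (∀ x, 0 ≤ φ x) → HasCompactSupport φ → tsupport φ ⊆ K1 →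
      -(C' * (CP * 2) * e.J lam * ∫ x, φ x) ≤ lam * ((∫ x, lam * u0 x * φ x) - ∫ x, W x * φ x) := by
    intro φ h1 h2 h3 h4
    obtain ⟨g, hg⟩ := Ell.Res_exists hl (XF.of_cs h1 h3)
    have q1 := Ell.T2c hWm hWb hT hWT hP hPc hPT hP0 hC' H hl0 h1 h2 hg
    have q2 := hg.dual hs hP hPc hPD h1
    have q3 : ∫ x, P x * φ x = 0 := by
      rw [← integral_zero E ℝ (μ := volume)]
      refine integral_congr_ae (Eventually.of_forall fun x => ?_)
      by_cases hx : x ∈ tsupport φ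
      · simp [hPK x (h4 hx)]
      · simp [image_eq_zero_of_notMem_tsupport hx]
    have q4 := (abs_le.1 (massM hP hPc hMP h1 h3 h2 hg)).2
    have q5 := hrep φ g (XF.of_cs h1 h3) hg
    have gc := hg.continuous
    have q6 : ∫ x, W x * (lam * g x - φ x) = lam * (∫ x, W x * g x) - ∫ x, W x * φ x := by
      rw [← integral_const_mul, ← integral_sub ((iWg gc).const_mul _) (iWf h1 h3)]
      exact integral_congr_ae (Eventually.of_forall fun x => by ring)
    have q7 : ∫ x, lam * u0 x * φ x = lam * ∫ x, u0 x * φ x := by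
      rw [← integral_const_mul]
      exact integral_congr_ae (Eventually.of_forall fun x => by ring)
    rw [q7, q5, ← q6]
    rw [q3, zero_add] at q2
    have q8 := mul_le_mul_of_nonneg_left q1 hl0.le
    have q9 := mul_le_mul_of_nonneg_left q4 hC'
    have q10 : lam * -(C' * ∫ x, P x * g x) = -(C' * (lam * ∫ x, P x * g x)) := by ring
    rw [q10, q2] at q8
    linarith
  have q7 : ∀ φ : E → ℝ, ∫ x, lam * u0 x * φ x = lam * ∫ x, u0 x * φ x := fun φ => by
    rw [← integral_const_mul]
    exact integral_congr_ae (Eventually.of_forall fun x => by ring)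
  have iu : ∀ {f : E → ℝ}, Continuous f → HasCompactSupport f → Integrable fun x => u0 x * f x := fun hf hc =>
    (uc.mul hf).integrable_of_hasCompactSupport hc.mul_left
  refine ⟨fun x => lam * u0 x, continuous_const.mul uc, ?_, ?_, ?_, ?_⟩
  · intro x
    refine nonpos_of_test (f := fun x => lam * u0 x) (continuous_const.mul uc) isOpen_univ (fun φ h1 h2 _ h4 => ?_) x trivial
    obtain ⟨g, hg⟩ := Ell.Res_exists hl (XF.of_cs h1.continuous h2)
    rw [q7, hrep φ g (XF.of_cs h1.continuous h2) hg]
    exact mul_nonpos_of_nonneg_of_nonpos hl0.le (integral_nonpos fun x =>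
      mul_nonpos_of_nonpos_of_nonneg (hWn x) (hg.nonneg hl0 h4 x))
  · intro φ h1 h2 h3 h4
    have q := low φ h1 h2 h3 h4
    have e1 : ∫ x, v x * φ x = ∫ x, W x * φ x := integral_congr_ae (Eventually.of_forall fun x => by
      by_cases hx : x ∈ tsupport φ
      · simp [hWv x (h4 hx)]
      · simp [image_eq_zero_of_notMem_tsupport hx])
    have hX : 0 ≤ C' * (CP * 2) * e.J lam * ∫ x, φ x := mul_nonneg (by positivity) (integral_nonneg h2)
    rw [e1]
    by_contra hc
    push Not at hc
    have : lam * ((∫ x, lam * u0 x * φ x) - ∫ x, W x * φ x) < lam * -(C' * (CP * 2) * e.J lam * ∫ x, φ x) :=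
      mul_lt_mul_of_pos_left (by linarith) hl0
    nlinarith [hl.one]
  · intro ω h1 h2 h3 h4
    have q := low ω h1.continuous h2 h3 h4
    have cM := e.M_cont h1
    have c1 := h1.continuous
    have hc : HasCompactSupport fun x => lam * ω x - e.M ω x := (h3.mul_left).sub (e.M_cs h3)
    have q1 := hrep _ ω (XF.of_cs (by fun_prop) hc) (Ell.Res.of_c2 (e := e) (lam := lam) h1 (cs_zero h3))
    have q2 : ∫ x, u0 x * (lam * ω x - e.M ω x) = lam * (∫ x, u0 x * ω x) - ∫ x, u0 x * e.M ω x := by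
      rw [← integral_const_mul, ← integral_sub ((iu c1 h3).const_mul _) (iu cM (e.M_cs h3))]
      exact integral_congr_ae (Eventually.of_forall fun x => by ring)
    rw [q7, ← q1, q2] at q
    rw [q7]
    linarith
  · intro p0 C0 s h1 h2 h3 h4 h5 h6 hs0 h7 y hy
    have := nonpos_of_test (f := fun x => lam * u0 x - s * (1 - 2 * C0 * e.J lam)) (by fun_prop) (O := interior {x | p0 x = 1}) isOpen_interior
      (fun φ k1 k2 k3 k4 => ?_) y hy
    · linarith
    obtain ⟨g, hg⟩ := Ell.Res_exists hl (XF.of_cs k1.continuous k2)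
    have g0 := hg.nonneg hl0 k4
    have gc := hg.continuous
    have iφ := k1.continuous.integrable_of_hasCompactSupport (μ := volume) k2
    have e1 : ∫ x, (lam * u0 x - s * (1 - 2 * C0 * e.J lam)) * φ x = lam * (∫ x, W x * g x) - s * (1 - 2 * C0 * e.J lam) * ∫ x, φ x := by
      rw [← hrep φ g (XF.of_cs k1.continuous k2) hg, ← integral_const_mul, ← integral_const_mul,
        ← integral_sub ((iu k1.continuous k2).const_mul _) (iφ.const_mul _)]
      exact integral_congr_ae (Eventually.of_forall fun x => by ring)
    have ipg : Integrable fun x => p0 x * g x := (h1.continuous.mul gc).integrable_of_hasCompactSupport h2.mul_right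
    have e2 : ∫ x, W x * g x ≤ s * ∫ x, p0 x * g x := by
      rw [← integral_const_mul]
      refine integral_mono (iWg gc) (ipg.const_mul _) fun x => ?_
      by_cases hx : p0 x = 0
      · simp only [hx, zero_mul, mul_zero]
        exact mul_nonpos_of_nonpos_of_nonneg (hWn x) (g0 x)
      · have i1 : W x ≤ s := by
          rw [hWv x (h3 (subset_tsupport p0 hx))]; exact h7 x hx
        have i2 := mul_le_mul_of_nonneg_right i1 (g0 x)
        have i3 : s ≤ s * p0 x := by nlinarith [h5 x]
        have i4 := mul_le_mul_of_nonneg_right i3 (g0 x)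
        simp only [← mul_assoc]
        linarith
    have e3 := hg.dual hs h1 h2 (h3.trans hKD) k1.continuous
    have e4 : ∫ x, p0 x * φ x = ∫ x, φ x := integral_congr_ae (Eventually.of_forall fun x => by
      by_cases hx : x ∈ tsupport φ
      · have : x ∈ {x | p0 x = 1} := interior_subset (k3 hx)
        simp [show p0 x = 1 from this]
      · simp [image_eq_zero_of_notMem_tsupport hx])
    have e5 := (abs_le.1 (massM h1 h2 h6 k1.continuous k2 k4 hg)).1
    rw [e1]
    have e6 := mul_le_mul_of_nonneg_left e2 hl0.le
    have e7 : lam * (s * ∫ x, p0 x * g x) = s * (lam * ∫ x, p0 x * g x) := by ring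
    rw [e7, e3, e4] at e6
    have e8 : s * ((∫ x, φ x) + ∫ x, g x * e.M p0 x) ≤ s * ((∫ x, φ x) - C0 * 2 * e.J lam * ∫ x, φ x) :=
      mul_le_mul_of_nonpos_left (by linarith) hs0
    linarith

end T3

end Part10

section Part11
set_option linter.unusedSectionVars false
set_option linter.style.haveILetI false
set_option synthInstance.maxHeartbeats 400000
set_option maxSynthPendingDepth 3

section Concrete

variable {n : ℕ}

abbrev Bil (n : ℕ) := Cn n →L[ℝ] Cn n →L[ℝ] ℝ

noncomputable def evb (u w : Cn n) : Bil n →L[ℝ] ℝ :=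
  (ContinuousLinearMap.apply ℝ ℝ w).comp (ContinuousLinearMap.apply ℝ (Cn n →L[ℝ] ℝ) u)

theorem evb_apply (u w : Cn n) (T : Bil n) : evb u w T = T u w := rfl

noncomputable def e1 (j : Fin n) : Cn n := Pi.single j 1
noncomputable def eI (j : Fin n) : Cn n := Pi.single j Complex.I

noncomputable def rr (j k : Fin n) : Bil n →L[ℝ] ℝ :=
  (1/4 : ℝ) • (evb (e1 k) (e1 j) + evb (eI k) (eI j))
noncomputable def ii (j k : Fin n) : Bil n →L[ℝ] ℝ :=
  (1/4 : ℝ) • (evb (eI k) (e1 j) - evb (e1 k) (eI j))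

theorem rr_apply (j k : Fin n) (T : Bil n) :
    rr j k T = (T (e1 k) (e1 j) + T (eI k) (eI j)) / 4 := by
  simp [rr, evb_apply]; ring
theorem ii_apply (j k : Fin n) (T : Bil n) :
    ii j k T = (T (eI k) (e1 j) - T (e1 k) (eI j)) / 4 := by
  simp [ii, evb_apply]; ring

noncomputable def lf (a : Matrix (Fin n) (Fin n) ℂ) : Bil n →L[ℝ] ℝ :=
  ∑ j, ∑ k, ((a j k).re • rr j k - (a j k).im • ii j k)

theorem lf_apply (a : Matrix (Fin n) (Fin n) ℂ) (T : Bil n) :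
    lf a T = ∑ j, ∑ k, ((a j k).re * rr j k T - (a j k).im * ii j k T) := by
  simp [lf, _root_.sum_apply]

noncomputable def xx (k : Fin n) : Cn n →L[ℝ] ℝ := Complex.reCLM.comp (ContinuousLinearMap.proj k)
noncomputable def yy (k : Fin n) : Cn n →L[ℝ] ℝ := Complex.imCLM.comp (ContinuousLinearMap.proj k)

noncomputable def bR (j k : Fin n) : Bil n := (xx k).smulRight (xx j) + (yy k).smulRight (yy j)
noncomputable def bS (j k : Fin n) : Bil n := (yy k).smulRight (xx j) - (xx k).smulRight (yy j)

noncomputable def bf (q : Matrix (Fin n) (Fin n) ℂ) : Bil n :=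
  ∑ j, ∑ k, ((q j k).re • bR j k - (q j k).im • bS j k)

theorem bf_apply0 (q : Matrix (Fin n) (Fin n) ℂ) (u w : Cn n) :
    bf q u w = ∑ j, ∑ k, ((q j k).re * ((u k).re * (w j).re + (u k).im * (w j).im)
      - (q j k).im * ((u k).im * (w j).re - (u k).re * (w j).im)) := by
  simp [bf, bR, bS, xx, yy, _root_.sum_apply, mul_add]

theorem bf_apply (q : Matrix (Fin n) (Fin n) ℂ) (u w : Cn n) :
    bf q u w = ∑ j, ((Matrix.mulVec q u j).re * (w j).re + (Matrix.mulVec q u j).im * (w j).im) := by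
  rw [bf_apply0]
  refine Finset.sum_congr rfl fun j _ => ?_
  simp only [Matrix.mulVec, dotProduct, Complex.re_sum, Complex.im_sum, Finset.sum_mul,
    ← Finset.sum_add_distrib, Complex.mul_re, Complex.mul_im]
  refine Finset.sum_congr rfl fun k _ => ?_
  ring

theorem bf_dot (q : Matrix (Fin n) (Fin n) ℂ) (u w : Cn n) :
    bf q u w = (star w ⬝ᵥ Matrix.mulVec q u).re := by
  rw [bf_apply]
  simp only [dotProduct, Complex.re_sum, Complex.mul_re, Pi.star_apply, Complex.star_def, Complex.conj_re, Complex.conj_im]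
  refine Finset.sum_congr rfl fun k _ => ?_
  ring

theorem lf_bf (a q : Matrix (Fin n) (Fin n) ℂ) (hq : q.IsHermitian) (haq : a * q = 1) :
    lf a (bf q) = n / 2 := by
  have h1 : ∀ j k, bf q (e1 k) (e1 j) = (q j k).re := by
    intro j k
    rw [bf_apply]
    simp [e1, Pi.single_apply, apply_ite Complex.re, apply_ite Complex.im]
  have h2 : ∀ j k, bf q (eI k) (eI j) = (q j k).re := by
    intro j k
    rw [bf_apply]
    simp [eI, Pi.single_apply, apply_ite Complex.re, apply_ite Complex.im]
  have h3 : ∀ j k, bf q (eI k) (e1 j) = -(q j k).im := by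
    intro j k
    rw [bf_apply]
    simp [eI, e1, Pi.single_apply, apply_ite Complex.re, apply_ite Complex.im]
  have h4 : ∀ j k, bf q (e1 k) (eI j) = (q j k).im := by
    intro j k
    rw [bf_apply]
    simp [eI, e1, Pi.single_apply, apply_ite Complex.re, apply_ite Complex.im]
  have h5 : (Matrix.trace (a * q)).re = n := by simp [haq]
  rw [lf_apply]
  simp only [rr_apply, ii_apply, h1, h2, h3, h4]
  rw [← h5, Matrix.trace]
  simp only [Matrix.diag, Matrix.mul_apply, Complex.re_sum, Finset.sum_div]
  refine Finset.sum_congr rfl fun j _ => Finset.sum_congr rfl fun k _ => ?_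
  rw [← hq.apply j k]
  simp only [Complex.mul_re, Complex.star_def, Complex.conj_re, Complex.conj_im]
  ring

theorem lf_bb (a q : Matrix (Fin n) (Fin n) ℂ) (haq : a * q = 1) (u : Cn n) :
    lf a ((bf q u).smulRight (bf q u)) = bf q u u / 4 := by
  set c : Cn n := Matrix.mulVec q u with hc
  have h1 : ∀ j, bf q u (e1 j) = (c j).re := by
    intro j
    rw [bf_apply]
    simp [e1, Pi.single_apply, hc, apply_ite Complex.re, apply_ite Complex.im]
  have h2 : ∀ j, bf q u (eI j) = (c j).im := by
    intro j
    rw [bf_apply]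
    simp [eI, Pi.single_apply, hc, apply_ite Complex.re, apply_ite Complex.im]
  have h3 : bf q u u = (star c ⬝ᵥ Matrix.mulVec a c).re := by
    rw [hc, Matrix.mulVec_mulVec, haq, Matrix.one_mulVec, bf_apply]
    simp only [dotProduct, Complex.re_sum, Complex.mul_re, Pi.star_apply, Complex.star_def, Complex.conj_re, Complex.conj_im]
    refine Finset.sum_congr rfl fun k _ => ?_
    ring
  rw [h3, lf_apply]
  simp only [rr_apply, ii_apply, ContinuousLinearMap.smulRight_apply, _root_.smul_apply, h1, h2, smul_eq_mul]
  simp only [dotProduct, Matrix.mulVec, Complex.re_sum, Finset.mul_sum, Finset.sum_div]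
  refine Finset.sum_congr rfl fun j _ => Finset.sum_congr rfl fun k _ => ?_
  simp only [Complex.mul_re, Complex.mul_im, Pi.star_apply, Complex.star_def, Complex.conj_re, Complex.conj_im]
  ring

theorem cn_expand (w : Cn n) : w = ∑ k, ((w k).re • e1 k + (w k).im • eI k) := by
  funext i
  simp only [Finset.sum_apply, Pi.add_apply, Pi.smul_apply, e1, eI, Pi.single_apply]
  rw [Finset.sum_eq_single i]
  · simp
  · intro b _ hb
    simp [hb.symm]
  · simp

theorem cn_expandI (w : Cn n) : Complex.I • w = ∑ k, ((w k).re • eI k - (w k).im • e1 k) := by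
  funext i
  simp only [Finset.sum_apply, Pi.sub_apply, Pi.smul_apply, e1, eI, Pi.single_apply]
  rw [Finset.sum_eq_single i]
  · simp
    apply Complex.ext <;> simp
  · intro b _ hb
    simp [hb.symm]
  · simp

theorem lf_rank (T : Bil n) (w : Cn n) :
    lf (Matrix.of fun j k => w j * star (w k)) T = (T w w + T (Complex.I • w) (Complex.I • w)) / 4 := by
  have e : T w w = ∑ k, ∑ j, T ((w k).re • e1 k + (w k).im • eI k) ((w j).re • e1 j + (w j).im • eI j) := by
    conv_lhs => rw [cn_expand w]
    simp only [map_sum, _root_.sum_apply]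
    exact Finset.sum_comm
  have e' : T (Complex.I • w) (Complex.I • w) = ∑ k, ∑ j, T ((w k).re • eI k - (w k).im • e1 k) ((w j).re • eI j - (w j).im • e1 j) := by
    rw [cn_expandI w]
    simp only [map_sum, _root_.sum_apply]
    exact Finset.sum_comm
  rw [e, e', lf_apply, Finset.sum_comm]
  simp only [← Finset.sum_add_distrib, Finset.sum_div]
  refine Finset.sum_congr rfl fun k _ => Finset.sum_congr rfl fun j _ => ?_
  simp only [Matrix.of_apply, rr_apply, ii_apply, map_add, map_sub, map_smul, _root_.add_apply,
    _root_.sub_apply, _root_.smul_apply, smul_eq_mul,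
    Complex.mul_re, Complex.mul_im, Complex.star_def, Complex.conj_re, Complex.conj_im]
  ring

theorem lf_sum {ι : Type*} (s : Finset ι) (a : ι → Matrix (Fin n) (Fin n) ℂ) (T : Bil n) :
    lf (Matrix.of fun j k => ∑ i ∈ s, a i j k) T = ∑ i ∈ s, lf (a i) T := by
  simp only [lf_apply, Matrix.of_apply, Complex.re_sum, Complex.im_sum, Finset.sum_mul]
  rw [Finset.sum_comm (s := s)]
  refine Finset.sum_congr rfl fun k _ => ?_
  rw [Finset.sum_comm (s := s)]
  refine Finset.sum_congr rfl fun j _ => ?_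
  rw [Finset.sum_sub_distrib]

open scoped ComplexOrder MatrixOrder Matrix.Norms.L2Operator in
theorem lf_pos (a : Matrix (Fin n) (Fin n) ℂ) (ha : a.PosDef) (T : Bil n) (hT : ∀ u, 0 ≤ T u u) :
    0 ≤ lf a T := by
  obtain ⟨B, hB⟩ := CStarAlgebra.nonneg_iff_eq_star_mul_self.mp ha.posSemidef.nonneg
  have h : a = Matrix.of fun j k => ∑ i, (Matrix.of fun j k => (star (B i j)) * star (star (B i k))) j k := by
    ext j k
    rw [hB, Matrix.mul_apply]
    simp [Matrix.star_apply]
  rw [h, lf_sum]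
  refine Finset.sum_nonneg fun i _ => ?_
  rw [lf_rank T (fun j => star (B i j))]
  have := hT (fun j => star (B i j))
  have := hT (Complex.I • fun j => star (B i j))
  positivity

end Concrete

end Part11

section Part12
set_option linter.unusedSectionVars false
set_option linter.style.haveILetI false
set_option synthInstance.maxHeartbeats 400000
set_option maxSynthPendingDepth 3

section Concrete2

variable {n : ℕ}

noncomputable def AlphaForm.mat (A : AlphaForm n) (x : Cn n) : Matrix (Fin n) (Fin n) ℂ :=
  Matrix.of fun j k => A.coeff j k x

open scoped ComplexOrder in
theorem AlphaForm.mat_posDef (A : AlphaForm n) (x : Cn n) : (A.mat x).PosDef := by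
  have hh : (A.mat x).IsHermitian := by
    ext j k
    simp only [AlphaForm.mat, Matrix.conjTranspose_apply, Matrix.of_apply, Complex.star_def]
    rw [A.hermitian j k x, starRingEnd_self_apply]
  refine Matrix.PosDef.of_dotProduct_mulVec_pos hh fun w hw => ?_
  rw [Complex.pos_iff]
  constructor
  · have := A.strictlyPositive x (star w) (by simpa using hw)
    refine this.trans_eq ?_
    congr 1
    simp only [dotProduct, Matrix.mulVec, AlphaForm.mat, Matrix.of_apply, Finset.mul_sum]
    refine Finset.sum_congr rfl fun j _ => Finset.sum_congr rfl fun k _ => ?_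
    simp only [Pi.star_apply, Complex.star_def, starRingEnd_self_apply]
    ring
  · exact (hh.im_star_dotProduct_mulVec_self w).symm

noncomputable def aP (A : AlphaForm n) (χ : Cn n → ℝ) (x : Cn n) : Matrix (Fin n) (Fin n) ℂ :=
  (1 - χ x) • 1 + χ x • A.mat x

theorem aP_apply (A : AlphaForm n) (χ : Cn n → ℝ) (x : Cn n) (j k : Fin n) :
    aP A χ x j k = (1 : Matrix (Fin n) (Fin n) ℂ) j k
      + χ x • (A.coeff j k x - (1 : Matrix (Fin n) (Fin n) ℂ) j k) := by
  simp only [aP, Matrix.add_apply, Matrix.smul_apply, AlphaForm.mat, Matrix.of_apply, Complex.real_smul]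
  push_cast
  ring

open scoped ComplexOrder in
theorem aP_posDef (A : AlphaForm n) {χ : Cn n → ℝ} (h0 : ∀ x, 0 ≤ χ x) (h1 : ∀ x, χ x ≤ 1) (x : Cn n) :
    (aP A χ x).PosDef := by
  rcases (h1 x).lt_or_eq with h | h
  · refine Matrix.PosDef.add_posSemidef (Matrix.PosDef.one.smul (by linarith)) ?_
    exact (A.mat_posDef x).posSemidef.smul (h0 x)
  · rw [aP, h]
    simpa using A.mat_posDef x

theorem lf_add (a c : Matrix (Fin n) (Fin n) ℂ) : lf (a + c) = lf a + lf c := by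
  simp only [lf, ← Finset.sum_add_distrib]
  refine Finset.sum_congr rfl fun j _ => Finset.sum_congr rfl fun k _ => ?_
  simp only [Matrix.add_apply, Complex.add_re, Complex.add_im, add_smul]
  abel

theorem bf_cont {X : Type*} [TopologicalSpace X] {q : X → Matrix (Fin n) (Fin n) ℂ} (hq : Continuous q) :
    Continuous fun x => bf (q x) := by
  unfold bf
  refine continuous_finsetSum _ fun j _ => continuous_finsetSum _ fun k _ => ?_
  have h : Continuous fun x => q x j k := hq.matrix_elem j k
  exact ((Complex.continuous_re.comp h).smul continuous_const).sub
    ((Complex.continuous_im.comp h).smul continuous_const)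

open scoped ComplexOrder in
theorem bf_pos {q : Matrix (Fin n) (Fin n) ℂ} (hq : q.PosDef) {u : Cn n} (hu : u ≠ 0) : 0 < bf q u u := by
  rw [bf_dot]
  exact (Complex.pos_iff.1 (hq.dotProduct_mulVec_pos hu)).1

open scoped ComplexOrder in
theorem exists_ell (A : AlphaForm n) {D : Set (Cn n)} (hb : Bornology.IsBounded D) :
    ∃ e : Ell (Cn n) n, ∀ z ∈ D, e.l z = lf (A.mat z) := by
  obtain ⟨χ, hχ, hχc, -, hχ0, hχ1, hχK⟩ := exists_cut (hb.isCompact_closure) isOpen_univ (Set.subset_univ _)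
  have hpd := aP_posDef A hχ0 hχ1
  have hcc : ∀ j k, ContDiff ℝ 1 (fun x => χ x • (A.coeff j k x - (1 : Matrix (Fin n) (Fin n) ℂ) j k)) := by
    intro j k
    exact (contDiff_infty.1 hχ 1).smul ((A.contDiff j k).sub contDiff_const)
  have hac : Continuous (aP A χ) := by
    refine continuous_matrix fun j k => ?_
    simp only [aP_apply]
    exact continuous_const.add (hcc j k).continuous
  set g : Cn n → (Bil n →L[ℝ] ℝ) := fun x => lf (Matrix.of fun j k => χ x • (A.coeff j k x - (1 : Matrix (Fin n) (Fin n) ℂ) j k)) with hg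
  have hag : ∀ x, lf (aP A χ x) = lf 1 + g x := by
    intro x
    rw [hg, ← lf_add]
    congr 1
    ext j k
    rw [aP_apply]; rfl
  have hg1 : ContDiff ℝ 1 g := by
    rw [hg]
    unfold lf
    refine ContDiff.sum fun j _ => ContDiff.sum fun k _ => ?_
    exact ((Complex.reCLM.contDiff.comp (hcc j k)).smul contDiff_const).sub
      ((Complex.imCLM.contDiff.comp (hcc j k)).smul contDiff_const)
  have hgc : HasCompactSupport g := by
    refine hχc.mono fun x hx => ?_
    by_contra h
    have h0 : χ x = 0 := by simpa using h
    apply hx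
    rw [hg]
    simp [h0, lf]
  obtain ⟨L, hL⟩ := hg1.lipschitzWith_of_hasCompactSupport hgc one_ne_zero
  obtain ⟨B1, hB1⟩ := hgc.exists_bound_of_continuous hg1.continuous
  have hinv : ∀ x, aP A χ x * (aP A χ x)⁻¹ = 1 := fun x =>
    Matrix.mul_nonsing_inv _ ((Matrix.isUnit_iff_isUnit_det _).1 (hpd x).isUnit)
  have hqc : Continuous fun x => (aP A χ x)⁻¹ := by
    have : (fun x => (aP A χ x)⁻¹) = fun x => ((aP A χ x).det)⁻¹ • (aP A χ x).adjugate := by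
      funext x
      rw [Matrix.inv_def, Ring.inverse_eq_inv']
    rw [this]
    refine Continuous.smul (Continuous.inv₀ hac.matrix_det fun x => ?_) hac.matrix_adjugate
    exact ((Matrix.isUnit_iff_isUnit_det _).1 (hpd x).isUnit).ne_zero
  have hbc : Continuous fun x => bf ((aP A χ x)⁻¹) := bf_cont hqc
  have hoff : ∀ x, x ∉ tsupport χ → aP A χ x = 1 := by
    intro x hx
    rw [aP, image_eq_zero_of_notMem_tsupport hx]
    simp
  have hbs : HasCompactSupport fun x => bf ((aP A χ x)⁻¹) - bf (1 : Matrix (Fin n) (Fin n) ℂ) := by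
    refine HasCompactSupport.intro hχc fun x hx => ?_
    rw [hoff x hx, inv_one, sub_self]
  obtain ⟨B2, hB2⟩ := hbs.exists_bound_of_continuous (hbc.sub continuous_const)
  have hQ : IsCompact (((fun x => bf ((aP A χ x)⁻¹)) '' tsupport χ) ∪ {bf (1 : Matrix (Fin n) (Fin n) ℂ)}) :=
    (hχc.isCompact.image hbc).union isCompact_singleton
  have hmem : ∀ x, bf ((aP A χ x)⁻¹) ∈ (((fun x => bf ((aP A χ x)⁻¹)) '' tsupport χ) ∪ {bf (1 : Matrix (Fin n) (Fin n) ℂ)}) := by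
    intro x
    by_cases hx : x ∈ tsupport χ
    · exact Or.inl ⟨x, hx, rfl⟩
    · right
      rw [hoff x hx, inv_one]; rfl
  have hev : Continuous fun p : Bil n × Cn n => p.1 p.2 p.2 :=
    (continuous_fst.clm_apply continuous_snd).clm_apply continuous_snd
  obtain ⟨c0, hc0, hc0'⟩ := (hQ.prod (isCompact_sphere (0 : Cn n) 1)).exists_forall_le' (a := 0) hev.continuousOn (by
    rintro ⟨T, u⟩ ⟨hT, hu⟩
    have hu0 : u ≠ 0 := by
      rintro rfl
      simp at hu
    rcases hT with ⟨x, -, rfl⟩ | hT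
    · exact bf_pos (hpd x).inv hu0
    · simp only at hT
      rw [Set.mem_singleton_iff] at hT
      show 0 < T u u
      rw [hT]
      exact bf_pos Matrix.PosDef.one hu0)
  have hBB1 := (norm_nonneg (g 0)).trans (hB1 0)
  have hBB2 := (norm_nonneg _).trans (hB2 0)
  refine ⟨{
    l := fun x => lf (aP A χ x)
    b := fun x => bf ((aP A χ x)⁻¹)
    L := L
    B := (‖lf (1 : Matrix (Fin n) (Fin n) ℂ)‖ + B1) + (‖bf (1 : Matrix (Fin n) (Fin n) ℂ)‖ + B2)
    c0 := c0
    L0 := L.2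
    B0 := by positivity
    c0pos := hc0
    hdim := by
      rw [Module.finrank_pi_fintype]
      simp [Complex.finrank_real_complex, mul_comm]
    lip := by
      intro x y T
      rw [hag, hag]
      have h1 : (lf (1 : Matrix (Fin n) (Fin n) ℂ) + g x) T - (lf (1 : Matrix (Fin n) (Fin n) ℂ) + g y) T = (g x - g y) T := by
        simp
      rw [h1, ← Real.norm_eq_abs]
      refine ((g x - g y).le_opNorm T).trans ?_
      refine mul_le_mul_of_nonneg_right ?_ (norm_nonneg _)
      have := hL.dist_le_mul x y
      rwa [dist_eq_norm, dist_eq_norm] at this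
    bdd := by
      intro x T
      rw [hag, ← Real.norm_eq_abs]
      refine (ContinuousLinearMap.le_opNorm _ T).trans (mul_le_mul_of_nonneg_right ?_ (norm_nonneg _))
      have h1 := norm_add_le (lf (1 : Matrix (Fin n) (Fin n) ℂ)) (g x)
      have h2 := hB1 x
      have h3 := norm_nonneg (bf (1 : Matrix (Fin n) (Fin n) ℂ))
      linarith
    bbdd := by
      intro x
      have h1 := norm_add_le (bf (1 : Matrix (Fin n) (Fin n) ℂ)) (bf ((aP A χ x)⁻¹) - bf (1 : Matrix (Fin n) (Fin n) ℂ))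
      rw [add_sub_cancel] at h1
      have h2 := hB2 x
      have h3 := norm_nonneg (lf (1 : Matrix (Fin n) (Fin n) ℂ))
      linarith
    bcont := hbc
    bsymm := by
      intro x u w
      have hq := (hpd x).inv.isHermitian
      set q := (aP A χ x)⁻¹
      rw [bf_apply0, bf_apply0, Finset.sum_comm]
      refine Finset.sum_congr rfl fun j _ => Finset.sum_congr rfl fun k _ => ?_
      rw [← hq.apply j k]
      simp only [Complex.star_def, Complex.conj_re, Complex.conj_im]
      ring
    bpos := by
      intro x u
      by_cases hu : u = 0
      · simp [hu]
      have hn : 0 < ‖u‖ := norm_pos_iff.2 hu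
      have := hc0' (bf ((aP A χ x)⁻¹), ‖u‖⁻¹ • u) ⟨hmem x, by simp [norm_smul, hn.ne']⟩
      simp only [map_smul, _root_.smul_apply, smul_eq_mul] at this
      calc c0 * ‖u‖ ^ 2 ≤ (‖u‖⁻¹ * (‖u‖⁻¹ * bf ((aP A χ x)⁻¹) u u)) * ‖u‖ ^ 2 :=
            mul_le_mul_of_nonneg_right this (by positivity)
        _ = _ := by field_simp
    lb := fun x => lf_bf _ _ (hpd x).inv.isHermitian (hinv x)
    lbb := fun x u => lf_bb _ _ (hinv x) u
    pos := fun x T _ hT => lf_pos _ (hpd x) T hT }, ?_⟩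
  intro z hz
  have h1 : χ z = 1 := by
    have : z ∈ {x | χ x = 1} := interior_subset (hχK (subset_closure hz))
    exact this
  show lf (aP A χ z) = _
  rw [aP, h1]
  simp

end Concrete2

end Part12

section Part13
set_option linter.unusedSectionVars false
set_option linter.style.haveILetI false
set_option synthInstance.maxHeartbeats 400000
set_option maxSynthPendingDepth 3

section Concrete3

variable {n : ℕ}

theorem fd_ofReal {f : Cn n → ℝ} {z : Cn n} (hf : DifferentiableAt ℝ f z) (v : Cn n) :
    fderiv ℝ (fun w => (f w : ℂ)) z v = (fderiv ℝ f z v : ℂ) := by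
  have h : HasFDerivAt (fun w => (f w : ℂ)) (Complex.ofRealCLM.comp (fderiv ℝ f z)) z :=
    Complex.ofRealCLM.hasFDerivAt.comp z hf.hasFDerivAt
  rw [h.fderiv]; rfl

theorem wdz_ofReal {f : Cn n → ℝ} (hf : ContDiff ℝ 1 f) (j : Fin n) (z : Cn n) :
    wdz j (fun w => (f w : ℂ)) z = ((fderiv ℝ f z (e1 j) / 2 : ℝ) : ℂ) - Complex.I * ((fderiv ℝ f z (eI j) / 2 : ℝ) : ℂ) := by
  have hd := hf.differentiable one_ne_zero z
  rw [wdz, fd_ofReal hd, fd_ofReal hd]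
  push_cast [e1, eI]
  ring

theorem wdzbar_wdz {f : Cn n → ℝ} (hf : ContDiff ℝ 2 f) (j k : Fin n) (z : Cn n) :
    wdzbar k (wdz j (fun w => (f w : ℂ))) z =
      ((rr j k (fderiv ℝ (fderiv ℝ f) z) : ℝ) : ℂ) + Complex.I * ((ii j k (fderiv ℝ (fderiv ℝ f) z) : ℝ) : ℂ) := by
  have hf1 : ContDiff ℝ 1 f := hf.of_le one_le_two
  have hfd : Differentiable ℝ (fderiv ℝ f) :=
    (hf.fderiv_right (m := 1) (by norm_num)).differentiable one_ne_zero
  have h : ∀ v : Cn n, HasFDerivAt (fun w => ((fderiv ℝ f w v / 2 : ℝ) : ℂ))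
      (Complex.ofRealCLM.comp ((1/2 : ℝ) • ((ContinuousLinearMap.apply ℝ ℝ v).comp (fderiv ℝ (fderiv ℝ f) z)))) z := by
    intro v
    have h1 : HasFDerivAt (fun w => fderiv ℝ f w v) ((ContinuousLinearMap.apply ℝ ℝ v).comp (fderiv ℝ (fderiv ℝ f) z)) z :=
      (ContinuousLinearMap.apply ℝ ℝ v).hasFDerivAt.comp z (hfd z).hasFDerivAt
    have h2 := h1.const_mul (1/2 : ℝ)
    have h3 := (Complex.ofRealCLM.hasFDerivAt (x := (1/2 : ℝ) * fderiv ℝ f z v)).comp z h2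
    refine h3.congr_of_eventuallyEq (Eventually.of_forall fun w => ?_)
    simp only [Function.comp, Complex.ofRealCLM_apply]
    push_cast; ring
  have hw : wdz j (fun w => (f w : ℂ)) = fun z => ((fderiv ℝ f z (e1 j) / 2 : ℝ) : ℂ) - Complex.I * ((fderiv ℝ f z (eI j) / 2 : ℝ) : ℂ) :=
    funext fun z => wdz_ofReal hf1 j z
  have hh := (h (e1 j)).sub ((h (eI j)).const_mul Complex.I)
  rw [hw, wdzbar]
  have := hh.fderiv
  simp only [Pi.sub_def] at this
  rw [this, rr_apply, ii_apply]
  simp only [_root_.sub_apply, _root_.smul_apply, ContinuousLinearMap.comp_apply,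
    Complex.ofRealCLM_apply, ContinuousLinearMap.apply_apply, smul_eq_mul, e1, eI]
  push_cast
  linear_combination (-(fderiv ℝ (fderiv ℝ f) z (Pi.single k Complex.I) (Pi.single j Complex.I) : ℂ) / 4) * Complex.I_sq

theorem alphaOpR_eq (A : AlphaForm n) {f : Cn n → ℝ} (hf : ContDiff ℝ 2 f) (z : Cn n) :
    alphaOpR A f z = lf (A.mat z) (fderiv ℝ (fderiv ℝ f) z) := by
  rw [alphaOpR, alphaOp, lf_apply]
  simp only [Complex.re_sum]
  refine Finset.sum_congr rfl fun j _ => Finset.sum_congr rfl fun k _ => ?_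
  rw [wdzbar_wdz hf]
  simp [AlphaForm.mat]

end Concrete3

end Part13

section Part14
set_option linter.unusedSectionVars false
set_option linter.style.haveILetI false
set_option synthInstance.maxHeartbeats 400000
set_option maxSynthPendingDepth 3

section Concrete4

variable {n : ℕ}

theorem fdv_cont {P : Cn n → ℂ} (hP : ContDiff ℝ 1 P) (v : Cn n) : Continuous fun z => fderiv ℝ P z v :=
  (hP.continuous_fderiv one_ne_zero).clm_apply continuous_const

theorem fdv_cs {P : Cn n → ℂ} (hP : HasCompactSupport P) (v : Cn n) : HasCompactSupport fun z => fderiv ℝ P z v :=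
  hP.fderiv_apply (𝕜 := ℝ) v

theorem wdzbar_cont {P : Cn n → ℂ} (hP : ContDiff ℝ 1 P) (k : Fin n) : Continuous (wdzbar k P) := by
  unfold wdzbar
  exact ((fdv_cont hP _).add (continuous_const.mul (fdv_cont hP _))).div_const _

theorem wdzbar_cs {P : Cn n → ℂ} (hP : HasCompactSupport P) (k : Fin n) : HasCompactSupport (wdzbar k P) := by
  refine HasCompactSupport.intro hP fun x hx => ?_
  have : fderiv ℝ P x = 0 := by
    have h := (notMem_tsupport_iff_eventuallyEq.1 hx).fderiv_eq (𝕜 := ℝ)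
    rw [h]; exact fderiv_const_apply (0 : ℂ)
  simp [wdzbar, this]

theorem wdz_cs {P : Cn n → ℂ} (hP : HasCompactSupport P) (k : Fin n) : HasCompactSupport (wdz k P) := by
  refine HasCompactSupport.intro hP fun x hx => ?_
  have : fderiv ℝ P x = 0 := by
    have h := (notMem_tsupport_iff_eventuallyEq.1 hx).fderiv_eq (𝕜 := ℝ)
    rw [h]; exact fderiv_const_apply (0 : ℂ)
  simp [wdz, this]

theorem int_mul_cs {P Q : Cn n → ℂ} (hP : Continuous P) (hQ : Continuous Q)
    (h : HasCompactSupport P ∨ HasCompactSupport Q) : Integrable fun z => P z * Q z := by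
  refine (hP.mul hQ).integrable_of_hasCompactSupport ?_
  rcases h with h | h
  · exact h.mul_right
  · exact h.mul_left

theorem ibp_v {P Q : Cn n → ℂ} (hP : ContDiff ℝ 1 P) (hQ : ContDiff ℝ 1 Q)
    (h : HasCompactSupport P ∨ HasCompactSupport Q) (v : Cn n) :
    ∫ z, P z * fderiv ℝ Q z v = - ∫ z, fderiv ℝ P z v * Q z := by
  refine integral_mul_fderiv_eq_neg_fderiv_mul_of_integrable
    (int_mul_cs (fdv_cont hP v) hQ.continuous (h.imp (fun h => fdv_cs h v) id))
    (int_mul_cs hP.continuous (fdv_cont hQ v) (h.imp id (fun h => fdv_cs h v)))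
    (int_mul_cs hP.continuous hQ.continuous h)
    (fun x _ => hP.differentiable one_ne_zero x) (fun x _ => hQ.differentiable one_ne_zero x)

theorem ibp_bar {P Q : Cn n → ℂ} (hP : ContDiff ℝ 1 P) (hQ : ContDiff ℝ 1 Q)
    (h : HasCompactSupport P ∨ HasCompactSupport Q) (k : Fin n) :
    ∫ z, P z * wdzbar k Q z = - ∫ z, wdzbar k P z * Q z := by
  have i1 : ∀ v, Integrable fun z => P z * fderiv ℝ Q z v := fun v =>
    int_mul_cs hP.continuous (fdv_cont hQ v) (h.imp id (fun h => fdv_cs h v))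
  have i2 : ∀ v, Integrable fun z => fderiv ℝ P z v * Q z := fun v =>
    int_mul_cs (fdv_cont hP v) hQ.continuous (h.imp (fun h => fdv_cs h v) id)
  have e1 : ∀ z, P z * wdzbar k Q z = (1/2) * (P z * fderiv ℝ Q z (Pi.single k 1))
      + (Complex.I/2) * (P z * fderiv ℝ Q z (Pi.single k Complex.I)) := by
    intro z; rw [wdzbar]; ring
  have e2 : ∀ z, wdzbar k P z * Q z = (1/2) * (fderiv ℝ P z (Pi.single k 1) * Q z)
      + (Complex.I/2) * (fderiv ℝ P z (Pi.single k Complex.I) * Q z) := by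
    intro z; rw [wdzbar]; ring
  simp only [e1, e2]
  rw [integral_add ((i1 _).const_mul _) ((i1 _).const_mul _),
    integral_add ((i2 _).const_mul _) ((i2 _).const_mul _), integral_const_mul, integral_const_mul,
    integral_const_mul, integral_const_mul, ibp_v hP hQ h, ibp_v hP hQ h]
  ring

theorem wdzbar_mul {P Q : Cn n → ℂ} (hP : ContDiff ℝ 1 P) (hQ : ContDiff ℝ 1 Q) (k : Fin n) (z : Cn n) :
    wdzbar k (fun z => P z * Q z) z = wdzbar k P z * Q z + P z * wdzbar k Q z := by
  have h : fderiv ℝ (fun z => P z * Q z) z = P z • fderiv ℝ Q z + Q z • fderiv ℝ P z :=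
    fderiv_fun_mul (hP.differentiable one_ne_zero z) (hQ.differentiable one_ne_zero z)
  simp only [wdzbar, h, _root_.add_apply, _root_.smul_apply, smul_eq_mul]
  ring

theorem fd_conj {P : Cn n → ℂ} (hP : ContDiff ℝ 1 P) (z v : Cn n) :
    fderiv ℝ (fun w => starRingEnd ℂ (P w)) z v = starRingEnd ℂ (fderiv ℝ P z v) := by
  have h : HasFDerivAt (fun w => starRingEnd ℂ (P w)) (((Complex.conjCLE : ℂ ≃L[ℝ] ℂ) : ℂ →L[ℝ] ℂ).comp (fderiv ℝ P z)) z :=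
    ((Complex.conjCLE : ℂ ≃L[ℝ] ℂ) : ℂ →L[ℝ] ℂ).hasFDerivAt.comp z (hP.differentiable one_ne_zero z).hasFDerivAt
  rw [h.fderiv]; rfl

theorem wdzbar_conj {P : Cn n → ℂ} (hP : ContDiff ℝ 1 P) (k : Fin n) (z : Cn n) :
    wdzbar k (fun w => starRingEnd ℂ (P w)) z = starRingEnd ℂ (wdz k P z) := by
  rw [wdzbar, wdz, fd_conj hP, fd_conj hP]
  simp [Complex.conj_ofNat]

theorem AlphaForm.closed_bar (A : AlphaForm n) (j : Fin n) (z : Cn n) :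
    ∑ k, wdzbar k (A.coeff j k) z = 0 := by
  have h : ∀ k, wdzbar k (A.coeff j k) z = starRingEnd ℂ (wdz k (A.coeff k j) z) := by
    intro k
    rw [← wdzbar_conj (A.contDiff k j)]
    congr 1
    funext w
    exact A.hermitian k j w
  simp only [h]
  rw [← map_sum, A.closed, map_zero]

theorem wdz_c1 {f : Cn n → ℝ} (hf : ContDiff ℝ 2 f) (j : Fin n) :
    ContDiff ℝ 1 (wdz j (fun w => (f w : ℂ))) := by
  have hw : wdz j (fun w => (f w : ℂ)) = fun z => ((fderiv ℝ f z (e1 j) / 2 : ℝ) : ℂ) - Complex.I * ((fderiv ℝ f z (eI j) / 2 : ℝ) : ℂ) :=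
    funext fun z => wdz_ofReal (hf.of_le one_le_two) j z
  rw [hw]
  have h : ∀ v, ContDiff ℝ 1 fun z => ((fderiv ℝ f z v / 2 : ℝ) : ℂ) := fun v =>
    Complex.ofRealCLM.contDiff.comp (((hf.fderiv_right (m := 1) (by norm_num)).clm_apply contDiff_const).div_const 2)
  exact (h _).sub (contDiff_const.mul (h _))

theorem alpha_ibp (A : AlphaForm n) {f g : Cn n → ℝ} (hf : ContDiff ℝ 2 f) (hg : ContDiff ℝ 2 g)
    (h : HasCompactSupport f ∨ HasCompactSupport g) :
    ∫ z, f z * alphaOpR A g z = - ∫ z, (∑ j, ∑ k, A.coeff j k z * wdzbar k (fun w => (f w : ℂ)) z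
      * wdz j (fun w => (g w : ℂ)) z).re := by
  set F : Cn n → ℂ := fun w => (f w : ℂ) with hF
  set G : Cn n → ℂ := fun w => (g w : ℂ) with hG
  have hF1 : ContDiff ℝ 1 F := Complex.ofRealCLM.contDiff.comp (hf.of_le one_le_two)
  have h' : HasCompactSupport F ∨ HasCompactSupport G := by
    refine h.imp (fun h => ?_) (fun h => ?_)
    · exact h.comp_left Complex.ofReal_zero
    · exact h.comp_left Complex.ofReal_zero
  have hG1 : ∀ j, ContDiff ℝ 1 (wdz j G) := wdz_c1 hg
  have hFA : ∀ j k, ContDiff ℝ 1 fun z => F z * A.coeff j k z := fun j k => hF1.mul (A.contDiff j k)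
  have hcs : ∀ j k, HasCompactSupport (fun z => F z * A.coeff j k z) ∨ HasCompactSupport (wdz j G) := fun j k =>
    h'.imp (fun h => h.mul_right) (fun h => wdz_cs h j)
  have i1 : ∀ j k, Integrable fun z => F z * A.coeff j k z * wdzbar k (wdz j G) z := fun j k =>
    int_mul_cs (hFA j k).continuous (wdzbar_cont (hG1 j) k) ((hcs j k).imp id fun h => wdzbar_cs h k)
  have i2 : ∀ j k, Integrable fun z => wdzbar k (fun z => F z * A.coeff j k z) z * wdz j G z := fun j k =>
    int_mul_cs (wdzbar_cont (hFA j k) k) (hG1 j).continuous ((hcs j k).imp (fun h => wdzbar_cs h k) id)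
  have a1 : ∫ z, ∑ j, ∑ k, F z * A.coeff j k z * wdzbar k (wdz j G) z
      = - ∫ z, ∑ j, ∑ k, wdzbar k (fun z => F z * A.coeff j k z) z * wdz j G z := by
    rw [integral_finsetSum _ fun j _ => integrable_finsetSum _ fun k _ => i1 j k,
      integral_finsetSum _ fun j _ => integrable_finsetSum _ fun k _ => i2 j k, ← Finset.sum_neg_distrib]
    refine Finset.sum_congr rfl fun j _ => ?_
    rw [integral_finsetSum _ fun k _ => i1 j k,
      integral_finsetSum _ fun k _ => i2 j k, ← Finset.sum_neg_distrib]
    refine Finset.sum_congr rfl fun k _ => ?_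
    exact ibp_bar (hFA j k) (hG1 j) (hcs j k) k
  have a2 : ∀ z, ∑ j, ∑ k, wdzbar k (fun z => F z * A.coeff j k z) z * wdz j G z
      = ∑ j, ∑ k, A.coeff j k z * wdzbar k F z * wdz j G z := by
    intro z
    refine Finset.sum_congr rfl fun j _ => ?_
    have e : ∀ k, wdzbar k (fun z => F z * A.coeff j k z) z * wdz j G z
        = A.coeff j k z * wdzbar k F z * wdz j G z + F z * wdz j G z * wdzbar k (A.coeff j k) z := by
      intro k
      rw [wdzbar_mul hF1 (A.contDiff j k)]; ring
    simp only [e]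
    rw [Finset.sum_add_distrib, ← Finset.mul_sum, A.closed_bar, mul_zero, add_zero]
  have a3 : ∀ z, f z * alphaOpR A g z = (∑ j, ∑ k, F z * A.coeff j k z * wdzbar k (wdz j G) z).re := by
    intro z
    rw [alphaOpR, alphaOp, ← Complex.re_ofReal_mul, Finset.mul_sum]
    simp only [Finset.mul_sum, mul_assoc]
    rfl
  have I1 : Integrable fun z => ∑ j, ∑ k, F z * A.coeff j k z * wdzbar k (wdz j G) z :=
    integrable_finsetSum _ fun j _ => integrable_finsetSum _ fun k _ => i1 j k
  have I2 : Integrable fun z => ∑ j, ∑ k, A.coeff j k z * wdzbar k F z * wdz j G z := by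
    refine Integrable.congr (integrable_finsetSum Finset.univ fun j _ => integrable_finsetSum Finset.univ fun k _ => i2 j k)
      (Eventually.of_forall fun z => ?_)
    exact a2 z
  simp only [a3]
  have r1 := integral_re I1
  have r2 := integral_re I2
  simp only [RCLike.re_to_complex] at r1 r2
  rw [r1, r2, a1]
  simp only [a2, Complex.neg_re]

theorem alpha_sym (A : AlphaForm n) {f g : Cn n → ℝ} (hf : ContDiff ℝ 2 f) (hg : ContDiff ℝ 2 g)
    (h : HasCompactSupport g) :
    ∫ z, f z * alphaOpR A g z = ∫ z, g z * alphaOpR A f z := by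
  rw [alpha_ibp A hf hg (Or.inr h), alpha_ibp A hg hf (Or.inl h)]
  congr 2
  funext z
  have hb : ∀ (f : Cn n → ℝ), ContDiff ℝ 2 f → ∀ k, wdzbar k (fun w => (f w : ℂ)) z
      = starRingEnd ℂ (wdz k (fun w => (f w : ℂ)) z) := by
    intro f hf k
    have hc : ContDiff ℝ 1 (fun w => (f w : ℂ)) := Complex.ofRealCLM.contDiff.comp (hf.of_le one_le_two)
    rw [← wdzbar_conj hc]
    congr 1
    funext w
    exact (Complex.conj_ofReal _).symm
  rw [← Complex.conj_re]
  congr 1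
  simp only [map_sum]
  rw [Finset.sum_comm]
  refine Finset.sum_congr rfl fun j _ => Finset.sum_congr rfl fun k _ => ?_
  simp only [hb f hf, hb g hg, map_mul, starRingEnd_self_apply]
  rw [A.hermitian k j z]
  ring

theorem ell_M_eq (A : AlphaForm n) {D : Set (Cn n)} {e : Ell (Cn n) n} (he : ∀ z ∈ D, e.l z = lf (A.mat z))
    {f : Cn n → ℝ} (hf : ContDiff ℝ 2 f) {z : Cn n} (hz : z ∈ D) : e.M f z = alphaOpR A f z := by
  rw [alphaOpR_eq A hf, Ell.M, he z hz]

theorem alphaOpR_off (A : AlphaForm n) {f : Cn n → ℝ} {z : Cn n} (hf : ContDiff ℝ 2 f) (hz : z ∉ tsupport f) :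
    alphaOpR A f z = 0 := by
  rw [alphaOpR_eq A hf]
  have h := (notMem_tsupport_iff_eventuallyEq.1 hz)
  have h1 : fderiv ℝ f =ᶠ[𝓝 z] fun _ => 0 := by
    refine h.eventuallyEq_nhds.mono fun w hw => ?_
    rw [hw.fderiv_eq]; exact fderiv_const_apply (0 : ℝ)
  rw [h1.fderiv_eq]
  simp

theorem ell_SA (A : AlphaForm n) {D : Set (Cn n)} {e : Ell (Cn n) n} (he : ∀ z ∈ D, e.l z = lf (A.mat z)) :
    e.SA D := by
  intro f g hf hg hc ht
  have h1 : (fun z => f z * e.M g z) = fun z => f z * alphaOpR A g z := by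
    funext z
    by_cases hz : z ∈ tsupport g
    · rw [ell_M_eq A he hg (ht hz)]
    · rw [alphaOpR_off A hg hz, Ell.M_off e hz]
  have h2 : (fun z => g z * e.M f z) = fun z => g z * alphaOpR A f z := by
    funext z
    by_cases hz : z ∈ tsupport g
    · rw [ell_M_eq A he hf (ht hz)]
    · rw [image_eq_zero_of_notMem_tsupport hz, zero_mul, zero_mul]
  rw [h1, h2]
  exact alpha_sym A hf hg hc

end Concrete4

end Part14

section Part15
set_option linter.unusedSectionVars false
set_option linter.style.haveILetI false
set_option synthInstance.maxHeartbeats 400000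
set_option maxSynthPendingDepth 3

section Concrete5

variable {n : ℕ}

theorem bf_one_symm (u w : Cn n) : bf 1 u w = bf 1 w u := by
  rw [bf_apply, bf_apply]
  simp only [Matrix.one_mulVec]
  refine Finset.sum_congr rfl fun j _ => ?_
  ring

theorem quad_cd (T : Bil n) : ContDiff ℝ 2 fun x => T x x :=
  T.contDiff.clm_apply contDiff_id

theorem quad_fd (T : Bil n) (hT : ∀ u w, T u w = T w u) (x : Cn n) :
    fderiv ℝ (fderiv ℝ fun x => T x x) x = (2 : ℝ) • T := by
  have h1 : (fderiv ℝ fun x => T x x) = fun x => ((2 : ℝ) • T) x := by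
    funext x
    have := (T.hasFDerivAt (x := x)).clm_apply (hasFDerivAt_id (𝕜 := ℝ) x)
    have h2 := this.fderiv
    simp only [id] at h2
    rw [h2]
    ext u
    simp [hT u x, two_mul]
  rw [h1]
  exact ((2 : ℝ) • T).fderiv

theorem lf_one_trace (a : Matrix (Fin n) (Fin n) ℂ) : lf a (bf 1) = a.trace.re / 2 := by
  have h1 : ∀ j k : Fin n, bf 1 (e1 k) (e1 j) = (1 : Matrix (Fin n) (Fin n) ℂ) j k := by
    intro j k
    rw [bf_apply]
    simp [e1, Pi.single_apply, Matrix.one_apply, apply_ite Complex.re, apply_ite Complex.im]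
    split_ifs <;> simp
  have h2 : ∀ j k : Fin n, bf 1 (eI k) (eI j) = (1 : Matrix (Fin n) (Fin n) ℂ) j k := by
    intro j k
    rw [bf_apply]
    simp [eI, Pi.single_apply, Matrix.one_apply, apply_ite Complex.re, apply_ite Complex.im]
    split_ifs <;> simp
  have h3 : ∀ j k : Fin n, bf 1 (eI k) (e1 j) = 0 := by
    intro j k
    rw [bf_apply]
    simp [eI, e1, Pi.single_apply, Matrix.one_apply, apply_ite Complex.re, apply_ite Complex.im]
  have h4 : ∀ j k : Fin n, bf 1 (e1 k) (eI j) = 0 := by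
    intro j k
    rw [bf_apply]
    simp [eI, e1, Pi.single_apply, Matrix.one_apply, apply_ite Complex.re, apply_ite Complex.im]
  have h5 : ∀ j k : Fin n, rr j k (bf 1) = if j = k then 1/2 else 0 := by
    intro j k
    have h1' := h1 j k
    have h2' := h2 j k
    rw [rr_apply]
    split_ifs with h
    · subst h
      simp only [Matrix.one_apply_eq] at h1' h2'
      norm_cast at h1' h2'
      rw [h1', h2']; norm_num
    · rw [Matrix.one_apply_ne h] at h1' h2'
      norm_cast at h1' h2'
      rw [h1', h2']; norm_num
  have h6 : ∀ j k : Fin n, ii j k (bf 1) = 0 := by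
    intro j k
    rw [ii_apply, h3, h4]; norm_num
  rw [lf_apply, Matrix.trace]
  simp only [h5, h6, Matrix.diag, Complex.re_sum, Finset.sum_div]
  refine Finset.sum_congr rfl fun j _ => ?_
  simp
  ring

open scoped ComplexOrder in
theorem exists_p (hn : 0 < n) (A : AlphaForm n) {D : Set (Cn n)} (hb : Bornology.IsBounded D) {e : Ell (Cn n) n}
    (he : ∀ z ∈ D, e.l z = lf (A.mat z)) :
    ∃ (p : Cn n → ℝ) (Bp : ℝ), 0 ≤ Bp ∧ ContDiff ℝ 2 p ∧ (∀ x ∈ D, p x ≤ 0) ∧ (∀ x ∈ D, 1 ≤ e.M p x) ∧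
      (∀ x ∈ D, e.M p x ≤ Bp) := by
  haveI : Nonempty (Fin n) := ⟨⟨0, hn⟩⟩
  have htc : Continuous fun z => (A.mat z).trace.re := by
    unfold Matrix.trace
    simp only [Matrix.diag, AlphaForm.mat, Matrix.of_apply]
    exact Complex.continuous_re.comp (continuous_finsetSum _ fun j _ => (A.contDiff j j).continuous)
  have htp : ∀ z, 0 < (A.mat z).trace.re := fun z => (Complex.pos_iff.1 (A.mat_posDef z).trace_pos).1
  obtain ⟨c, hc, hc'⟩ := hb.isCompact_closure.exists_forall_le' (a := 0) htc.continuousOn (fun z _ => htp z)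
  have hqc := (quad_cd (bf (1 : Matrix (Fin n) (Fin n) ℂ))).continuous
  obtain ⟨R, hR⟩ := (hb.isCompact_closure.bddAbove_image hqc.continuousOn)
  have hR' : ∀ x ∈ D, bf 1 x x ≤ R := fun x hx => hR ⟨x, subset_closure hx, rfl⟩
  have hp2 : ContDiff ℝ 2 (fun x : Cn n => c⁻¹ * (bf 1 x x - R)) :=
    contDiff_const.mul ((quad_cd _).sub contDiff_const)
  have hM : ∀ x, e.M (fun x : Cn n => c⁻¹ * (bf 1 x x - R)) x = c⁻¹ * (2 * e.l x (bf 1)) := by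
    intro x
    rw [Ell.M_smul e ((quad_cd _).sub contDiff_const) c⁻¹ x, Ell.M_sub e (quad_cd _) contDiff_const,
      Ell.M_const e R x, sub_zero, Ell.M, quad_fd _ bf_one_symm]
    simp
  refine ⟨fun x => c⁻¹ * (bf 1 x x - R), c⁻¹ * (2 * (e.B * ‖bf (1 : Matrix (Fin n) (Fin n) ℂ)‖)), ?_, hp2, ?_, ?_, ?_⟩
  · have := e.B0
    positivity
  · intro x hx
    exact mul_nonpos_of_nonneg_of_nonpos (by positivity) (by linarith [hR' x hx])
  · intro x hx
    rw [hM, he x hx, lf_one_trace]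
    have := hc' x (subset_closure hx)
    rw [inv_mul_eq_div, le_div_iff₀ hc]
    linarith
  · intro x hx
    rw [hM]
    have := (le_abs_self _).trans (e.bdd x (bf 1))
    gcongr

end Concrete5

end Part15

section Part16
set_option linter.unusedSectionVars false
set_option linter.style.haveILetI false
set_option synthInstance.maxHeartbeats 400000
set_option maxSynthPendingDepth 3

section SHsec
variable {E : Type*} [NormedAddCommGroup E] [NormedSpace ℝ E] [FiniteDimensional ℝ E]
  [MeasureSpace E] [BorelSpace E] [(volume : Measure E).IsAddHaarMeasure]
variable {m : ℕ} {e : Ell E m}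

structure SH (e : Ell E m) (D : Set E) (u : E → ℝ) : Prop where
  usc : ∀ z ∈ D, ∀ a, u z < a → ∀ᶠ w in 𝓝 z, u w < a
  str : ∀ z ∈ D, ∀ S : Set E, (∃ N ∈ 𝓝 z, volume (N \ S) = 0) → ∀ a < u z, ∃ᶠ w in 𝓝[S] z, a < u w
  ds : e.DSub D u

theorem freq_conull {z : E} {S : Set E} (hS : ∃ N ∈ 𝓝 z, volume (N \ S) = 0) {P : E → Prop}
    (hP : ∀ᶠ w in 𝓝 z, P w) : ∃ᶠ w in 𝓝[S] z, P w := by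
  intro h
  obtain ⟨N, hN, hN0⟩ := hS
  rw [eventually_nhdsWithin_iff] at h
  have h2 := (h.and hP).and hN
  obtain ⟨O, hO, hOo, hz⟩ := _root_.eventually_nhds_iff.1 h2
  have hsub : O ⊆ N \ S := by
    intro w hw
    have h3 := hO w hw
    exact ⟨h3.2, fun hwS => h3.1.1 hwS h3.1.2⟩
  exact (hOo.measure_pos volume ⟨z, hz⟩).ne' (measure_mono_null hsub hN0)

theorem Ell.DSub.mono {D G : Set E} {u : E → ℝ} (h : e.DSub D u) (hG : G ⊆ D) : e.DSub G u :=
  ⟨h.1.mono_set hG, fun ω h1 h2 h3 h4 => h.2 ω h1 h2 (h3.trans hG) h4⟩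

theorem Ell.DSub.congr_on {D : Set E} {u v : E → ℝ} (hD : IsOpen D) (h : e.DSub D u) (huv : ∀ x ∈ D, u x = v x) : e.DSub D v := by
  refine ⟨?_, fun ω h1 h2 h3 h4 => ?_⟩
  · haveI : ProperSpace E := FiniteDimensional.proper ℝ E
    have h1 := h.1
    rw [locallyIntegrableOn_iff hD.isLocallyClosed] at h1 ⊢
    intro k hk hkc
    exact (h1 k hk hkc).congr_fun (fun x hx => huv x (hk hx)) hkc.measurableSet
  · have := h.2 ω h1 h2 h3 h4
    refine this.trans_eq (integral_congr_ae (Eventually.of_forall fun x => ?_))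
    show u x * _ = v x * _
    by_cases hx : x ∈ tsupport ω
    · rw [huv x (h3 hx)]
    · rw [e.M_off hx, mul_zero, mul_zero]

theorem Ell.DSub.union {G H : Set E} {u : E → ℝ} (hG : IsOpen G) (hH : IsOpen H)
    (h1 : e.DSub G u) (h2 : e.DSub H u) : e.DSub (G ∪ H) u := by
  refine ⟨?_, fun ω w1 w2 w3 w4 => ?_⟩
  · intro x hx
    rw [(hG.union hH).nhdsWithin_eq hx]
    rcases hx with hx | hx
    · have := h1.1 x hx
      rwa [hG.nhdsWithin_eq hx] at this
    · have := h2.1 x hx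
      rwa [hH.nhdsWithin_eq hx] at this
  · have hk : IsCompact (tsupport ω \ H) := w2.isCompact.diff hH
    obtain ⟨θ, t1, t2, t3, t4, t5, t6⟩ := exists_cut hk hG (fun x hx => (w3 hx.1).resolve_right hx.2)
    have t1' := smooth2 t1
    have f1 : ContDiff ℝ 2 fun x => θ x * ω x := t1'.mul w1
    have f2 : ContDiff ℝ 2 fun x => (1 - θ x) * ω x := (contDiff_const.sub t1').mul w1
    have c1 : HasCompactSupport fun x => θ x * ω x := w2.mul_left
    have c2 : HasCompactSupport fun x => (1 - θ x) * ω x := w2.mul_left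
    have s1 : tsupport (fun x => θ x * ω x) ⊆ G := (tsupport_mul_subset_left).trans t3
    have s2 : tsupport (fun x => (1 - θ x) * ω x) ⊆ H := by
      intro x hx
      by_contra hxH
      have hxω : x ∈ tsupport ω := tsupport_mul_subset_right hx
      have hxi := t6 ⟨hxω, hxH⟩
      refine (notMem_tsupport_iff_eventuallyEq.2 ?_) hx
      filter_upwards [isOpen_interior.mem_nhds hxi] with y hy
      have hy1 : y ∈ {x | θ x = 1} := interior_subset hy
      have hy2 : θ y = 1 := hy1
      simp [hy2]
    have q1 := h1.2 _ f1 c1 s1 fun x => mul_nonneg (t4 x) (w4 x)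
    have q2 := h2.2 _ f2 c2 s2 fun x => mul_nonneg (by linarith [t5 x]) (w4 x)
    have i1 : Integrable fun x => u x * e.M (fun x => θ x * ω x) x := Ell.DSub.int h1.1 f1 c1 s1
    have i2 : Integrable fun x => u x * e.M (fun x => (1 - θ x) * ω x) x := Ell.DSub.int h2.1 f2 c2 s2
    have : ∫ x, u x * e.M ω x = (∫ x, u x * e.M (fun x => θ x * ω x) x) + ∫ x, u x * e.M (fun x => (1 - θ x) * ω x) x := by
      rw [← integral_add i1 i2]
      refine integral_congr_ae (Eventually.of_forall fun x => ?_)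
      show u x * e.M ω x = u x * _ + u x * _
      rw [← mul_add, ← Ell.M_add e f1 f2]
      congr 2
      funext y
      ring
    rw [this]
    exact add_nonneg q1 q2

theorem Ell.DSub.cmul {D : Set E} {u : E → ℝ} (h : e.DSub D u) {c : ℝ} (hc : 0 ≤ c) : e.DSub D (fun x => c * u x) := by
  refine ⟨?_, fun ω h1 h2 h3 h4 => ?_⟩
  · exact h.1.smul c
  · simp only [mul_assoc]
    rw [integral_const_mul]
    exact mul_nonneg hc (h.2 ω h1 h2 h3 h4)

theorem SH.mono {D G : Set E} {u : E → ℝ} (h : SH e D u) (hG : G ⊆ D) : SH e G u :=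
  ⟨fun z hz => h.usc z (hG hz), fun z hz => h.str z (hG hz), h.ds.mono hG⟩

theorem SH.congr_on {D : Set E} {u v : E → ℝ} (hD : IsOpen D) (h : SH e D u) (huv : ∀ x ∈ D, u x = v x) : SH e D v := by
  refine ⟨fun z hz a ha => ?_, fun z hz S hS a ha => ?_, h.ds.congr_on hD huv⟩
  · filter_upwards [h.usc z hz a (by rwa [huv z hz]), hD.mem_nhds hz] with w hw hwD
    rwa [← huv w hwD]
  · have h1 := h.str z hz S hS a (by rwa [huv z hz])
    have h2 : ∀ᶠ w in 𝓝[S] z, w ∈ D := mem_nhdsWithin_of_mem_nhds (hD.mem_nhds hz)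
    refine (h1.and_eventually h2).mono fun w hw => ?_
    rw [← huv w hw.2]; exact hw.1

theorem SH.union {G H : Set E} {u : E → ℝ} (hG : IsOpen G) (hH : IsOpen H)
    (h1 : SH e G u) (h2 : SH e H u) : SH e (G ∪ H) u :=
  ⟨fun z hz => hz.elim (h1.usc z) (h2.usc z), fun z hz => hz.elim (h1.str z) (h2.str z), h1.ds.union hG hH h2.ds⟩

theorem SH.max {D : Set E} {u v : E → ℝ} (hD : IsOpen D) (hu : SH e D u) (hv : SH e D v)
    (nu : ∀ x ∈ D, u x ≤ 0) (nv : ∀ x ∈ D, v x ≤ 0) : SH e D (fun x => Max.max (u x) (v x)) := by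
  refine ⟨fun z hz a ha => ?_, fun z hz S hS a ha => ?_, Ell.DSub.max hD hu.ds hv.ds nu nv⟩
  · rw [max_lt_iff] at ha
    filter_upwards [hu.usc z hz a ha.1, hv.usc z hz a ha.2] with w h1 h2
    exact max_lt h1 h2
  · rcases lt_max_iff.1 ha with h | h
    · exact (hu.str z hz S hS a h).mono fun w hw => lt_max_of_lt_left hw
    · exact (hv.str z hz S hS a h).mono fun w hw => lt_max_of_lt_right hw

theorem SH.cmul {D : Set E} {u : E → ℝ} (h : SH e D u) {c : ℝ} (hc : 0 < c) : SH e D (fun x => c * u x) := by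
  refine ⟨fun z hz a ha => ?_, fun z hz S hS a ha => ?_, h.ds.cmul hc.le⟩
  · filter_upwards [h.usc z hz (a / c) (by rwa [lt_div_iff₀ hc, mul_comm])] with w hw
    rwa [lt_div_iff₀ hc, mul_comm] at hw
  · refine (h.str z hz S hS (a / c) (by rwa [div_lt_iff₀ hc, mul_comm])).mono fun w hw => ?_
    rwa [div_lt_iff₀ hc, mul_comm] at hw

theorem SH.of_cont {D : Set E} {u : E → ℝ} (hu : Continuous u) (h : e.DSub D u) : SH e D u :=
  ⟨fun _ _ _ ha => hu.continuousAt.eventually_lt continuousAt_const ha,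
   fun _ _ _ hS _ ha => freq_conull hS (continuousAt_const.eventually_lt hu.continuousAt ha), h⟩

theorem SH.const {D : Set E} (hs : e.SA D) (c : ℝ) : SH e D (fun _ => c) :=
  SH.of_cont continuous_const (Ell.DSub.of_c2 hs contDiff_const fun x _ => (e.M_const c x).ge)

/-- an a.e. bound against a continuous function is a bound everywhere -/
theorem SH.le_of_ae {D : Set E} {u : E → ℝ} (hD : IsOpen D) (h : SH e D u) {G : Set E} (hGo : IsOpen G) (hG : G ⊆ D)
    {f : E → ℝ} (hf : Continuous f) (hae : ∀ᵐ x, x ∈ G → u x ≤ f x) : ∀ x ∈ G, u x ≤ f x := by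
  intro z hz
  by_contra hlt
  push Not at hlt
  obtain ⟨a, ha1, ha2⟩ := exists_between hlt
  have hS : ∃ N ∈ 𝓝 z, volume (N \ {x | x ∈ G → u x ≤ f x}) = 0 :=
    ⟨Set.univ, univ_mem, measure_mono_null (fun x hx => hx.2) hae⟩
  have h1 := h.str z (hG hz) _ hS a ha2
  have h2 : ∀ᶠ w in 𝓝[{x | x ∈ G → u x ≤ f x}] z, w ∈ G ∧ f w < a ∧ w ∈ {x | x ∈ G → u x ≤ f x} := by
    refine Eventually.and (mem_nhdsWithin_of_mem_nhds (hGo.mem_nhds hz)) (Eventually.and ?_ self_mem_nhdsWithin)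
    exact mem_nhdsWithin_of_mem_nhds (hf.continuousAt.eventually_lt continuousAt_const ha1)
  obtain ⟨w, hw1, hw2, hw3, hw4⟩ := (h1.and_eventually h2).exists
  have hw5 : w ∈ G → u w ≤ f w := hw4
  linarith [hw5 hw2]

end SHsec

section SHiff
variable {n : ℕ}

theorem sh_iff (A : AlphaForm n) {D : Set (Cn n)} (hD : IsOpen D) {e : Ell (Cn n) n}
    (he : ∀ z ∈ D, e.l z = lf (A.mat z)) (u : Cn n → ℝ) : IsAlphaSubharmonic A D u ↔ SH e D u := by
  have key : ∀ ω : Cn n → ℝ, ContDiff ℝ (⊤ : ℕ∞) ω → tsupport ω ⊆ D →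
      ∫ z in D, u z * alphaOpR A ω z = ∫ z, u z * e.M ω z := by
    intro ω h1 h3
    have h2 := smooth2 h1
    rw [setIntegral_eq_integral_of_forall_compl_eq_zero]
    · refine integral_congr_ae (Eventually.of_forall fun z => ?_)
      show u z * _ = u z * _
      by_cases hz : z ∈ tsupport ω
      · rw [ell_M_eq A he h2 (h3 hz)]
      · rw [alphaOpR_off A h2 hz, Ell.M_off e hz]
    · intro z hz
      rw [alphaOpR_off A h2 (fun h => hz (h3 h)), mul_zero]
  constructor
  · rintro ⟨-, h2, h3, h4, h5⟩
    refine ⟨fun z hz a ha => ?_, fun z hz S hS a ha => ?_, ?_⟩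
    · have := h2 z hz (a : EReal) (EReal.coe_lt_coe_iff.2 ha)
      rw [hD.nhdsWithin_eq hz] at this
      filter_upwards [this] with w hw
      exact_mod_cast hw
    · have := h3 z hz S hS
      have h6 : ((a : ℝ) : EReal) < limsup (fun z => (u z : EReal)) (𝓝[S] z) := by
        rw [this]; exact EReal.coe_lt_coe_iff.2 ha
      refine (frequently_lt_of_lt_limsup (by isBoundedDefault) h6).mono fun w hw => ?_
      exact_mod_cast hw
    · simp only [EReal.toReal_coe] at h4 h5
      refine Ell.DSub.of_smooth e hD h4 fun ω w1 w2 w3 w4 => ?_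
      rw [← key ω w1 w3]
      exact h5 ω w1 w2 w3 w4
  · intro h
    have hus : ∀ z ∈ D, ∀ y : EReal, (u z : EReal) < y → ∀ᶠ w in 𝓝 z, (u w : EReal) < y := by
      intro z hz y hy
      obtain ⟨r, hr1, hr2⟩ := EReal.lt_iff_exists_real_btwn.1 hy
      filter_upwards [h.usc z hz r (by exact_mod_cast hr1)] with w hw
      exact lt_trans (by exact_mod_cast hw) hr2
    refine ⟨fun z _ => EReal.coe_ne_top _, ?_, ?_, ?_, ?_⟩
    · intro z hz y hy
      exact mem_nhdsWithin_of_mem_nhds (hus z hz y hy)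
    · intro z hz S hS
      refine le_antisymm ?_ ?_
      · rw [limsup_le_iff]
        intro y hy
        exact mem_nhdsWithin_of_mem_nhds (hus z hz y hy)
      · rw [le_limsup_iff]
        intro y hy
        obtain ⟨r, hr1, hr2⟩ := EReal.lt_iff_exists_real_btwn.1 hy
        refine (h.str z hz S hS r (EReal.coe_lt_coe_iff.1 hr2)).mono fun w hw => ?_
        exact lt_trans hr1 (by exact_mod_cast hw)
    · simpa only [EReal.toReal_coe] using h.ds.1
    · intro ω w1 w2 w3 w4
      simp only [EReal.toReal_coe]
      rw [key ω w1 w3]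
      exact h.ds.2 ω (smooth2 w1) w2 w3 w4

end SHiff

end Part16

section Part17
set_option linter.unusedSectionVars false
set_option linter.style.haveILetI false
set_option synthInstance.maxHeartbeats 400000
set_option maxSynthPendingDepth 3

section Env
variable {E : Type*} [NormedAddCommGroup E] [NormedSpace ℝ E] [FiniteDimensional ℝ E]
  [MeasureSpace E] [BorelSpace E] [(volume : Measure E).IsAddHaarMeasure]
variable {m : ℕ} {e : Ell E m}

structure UC (e : Ell E m) (K D : Set E) (ψ : E → ℝ) (u : E → ℝ) : Prop where
  sh : SH e D u
  le : ∀ z ∈ K, u z ≤ ψ z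
  neg : ∀ z ∈ D, u z < 0

theorem UC.max {K D : Set E} {ψ u v : E → ℝ} (hD : IsOpen D) (hu : UC e K D ψ u) (hv : UC e K D ψ v) :
    UC e K D ψ (fun x => Max.max (u x) (v x)) :=
  ⟨hu.sh.max hD hv.sh (fun x hx => (hu.neg x hx).le) (fun x hx => (hv.neg x hx).le),
   fun z hz => max_le (hu.le z hz) (hv.le z hz), fun z hz => max_lt (hu.neg z hz) (hv.neg z hz)⟩

theorem SH.meas {D : Set E} {u : E → ℝ} (hD : IsOpen D) (h : SH e D u) : Measurable (D.indicator u) := by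
  refine measurable_of_Iio fun a => ?_
  have ho : IsOpen ({x | u x < a} ∩ D) := by
    rw [isOpen_iff_mem_nhds]
    rintro x ⟨hx, hxD⟩
    exact inter_mem (h.usc x hxD a hx) (hD.mem_nhds hxD)
  have : D.indicator u ⁻¹' Set.Iio a = ({x | u x < a} ∩ D) ∪ ({x | (0:ℝ) < a} ∩ Dᶜ) := by
    ext x
    by_cases hx : x ∈ D <;> simp [hx]
  rw [this]
  exact ho.measurableSet.union ((MeasurableSet.const _).inter hD.measurableSet.compl)

theorem ind_int {D : Set E} (hb : Bornology.IsBounded D) (hD : IsOpen D) {f : E → ℝ} (hf : Measurable f) {Mc : ℝ}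
    (h0 : ∀ x ∉ D, f x = 0) (h1 : ∀ x, -Mc ≤ f x) (h2 : ∀ x, f x ≤ 0) : Integrable f := by
  have hi : Integrable (D.indicator fun _ => Mc) :=
    (integrable_indicator_iff hD.measurableSet).2 (integrableOn_const hb.measure_lt_top.ne)
  refine hi.mono' hf.aestronglyMeasurable (Eventually.of_forall fun x => ?_)
  by_cases hx : x ∈ D
  · rw [Set.indicator_of_mem hx, Real.norm_eq_abs, abs_le]
    exact ⟨h1 x, by linarith [h1 x, h2 x]⟩
  · rw [Set.indicator_of_notMem hx, h0 x hx, norm_zero]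

theorem exists_env {K D : Set E} {ψ : E → ℝ} (hD : IsOpen D) (hb : Bornology.IsBounded D) (hs : e.SA D)
    (hKD : K ⊆ D) {Mc : ℝ} (hMc : 0 < Mc) (hψ : ∀ x ∈ K, -Mc ≤ ψ x) :
    ∃ v : E → ℝ, Measurable v ∧ (∀ x ∉ D, v x = 0) ∧ (∀ x, -Mc ≤ v x) ∧ (∀ x, v x ≤ 0) ∧ e.DSub D v ∧
      (∀ u, UC e K D ψ u → ∀ᵐ x, x ∈ D → u x ≤ v x) ∧
      (∀ x ∈ D, ∀ s, (∀ u, UC e K D ψ u → u x ≤ s) → v x ≤ s) := by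
  set 𝒰 : Set (E → ℝ) := {u | UC e K D ψ u ∧ ∀ x ∈ D, -Mc ≤ u x} with h𝒰
  have hmem : ∀ u, UC e K D ψ u → ∀ x ∈ D, -Mc ≤ u x → True := fun _ _ _ _ _ => trivial
  have hcU : UC e K D ψ (fun _ => -Mc) := ⟨SH.const hs _, hψ, fun _ _ => by linarith⟩
  have hmax : ∀ u, UC e K D ψ u → (fun x => Max.max (u x) (-Mc)) ∈ 𝒰 := fun u hu =>
    ⟨hu.max hD hcU, fun x _ => le_max_right _ _⟩
  have hmax2 : ∀ u ∈ 𝒰, ∀ w ∈ 𝒰, (fun x => Max.max (u x) (w x)) ∈ 𝒰 := fun u hu w hw =>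
    ⟨hu.1.max hD hw.1, fun x hx => le_max_of_le_left (hu.2 x hx)⟩
  have hi1 : ∀ u ∈ 𝒰, ∀ x, -Mc ≤ D.indicator u x := by
    intro u hu x
    by_cases hx : x ∈ D
    · rw [Set.indicator_of_mem hx]; exact hu.2 x hx
    · rw [Set.indicator_of_notMem hx]; linarith
  have hi2 : ∀ u ∈ 𝒰, ∀ x, D.indicator u x ≤ 0 := by
    intro u hu x
    by_cases hx : x ∈ D
    · rw [Set.indicator_of_mem hx]; exact (hu.1.neg x hx).le
    · rw [Set.indicator_of_notMem hx]
  have hmeas : ∀ u ∈ 𝒰, Measurable (D.indicator u) := fun u hu => hu.1.sh.meas hD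
  have hint : ∀ u ∈ 𝒰, Integrable (D.indicator u) := fun u hu =>
    ind_int hb hD (hmeas u hu) (fun x hx => Set.indicator_of_notMem hx _) (hi1 u hu) (hi2 u hu)
  set S : Set ℝ := (fun u : E → ℝ => ∫ x, D.indicator u x) '' 𝒰 with hS
  have hSne : S.Nonempty := ⟨_, _, ⟨hcU, fun _ _ => le_rfl⟩, rfl⟩
  have hSb : BddAbove S := by
    refine ⟨0, ?_⟩
    rintro _ ⟨u, hu, rfl⟩
    exact integral_nonpos fun x => hi2 u hu x
  obtain ⟨t, -, htlim, htS⟩ := exists_seq_tendsto_sSup hSne hSb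
  choose a ha hat using htS
  set u : ℕ → E → ℝ := fun k => Nat.rec (a 0) (fun k f x => Max.max (f x) (a (k+1) x)) k with hu
  have husucc : ∀ k, u (k+1) = fun x => Max.max (u k x) (a (k+1) x) := fun k => rfl
  have huU : ∀ k, u k ∈ 𝒰 := by
    intro k
    induction k with
    | zero => exact ha 0
    | succ k ih => rw [husucc]; exact hmax2 _ ih _ (ha _)
  have hau : ∀ k x, a k x ≤ u k x := by
    intro k x
    cases k with
    | zero => exact le_rfl
    | succ k => rw [husucc]; exact le_max_right _ _
  have humono : ∀ x, Monotone fun k => D.indicator (u k) x := by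
    intro x
    refine monotone_nat_of_le_succ fun k => ?_
    by_cases hx : x ∈ D
    · rw [Set.indicator_of_mem hx, Set.indicator_of_mem hx, husucc]
      exact le_max_left _ _
    · rw [Set.indicator_of_notMem hx, Set.indicator_of_notMem hx]
  have hbdd : ∀ x, BddAbove (Set.range fun k => D.indicator (u k) x) := fun x => ⟨0, by
    rintro _ ⟨k, rfl⟩; exact hi2 _ (huU k) x⟩
  set v : E → ℝ := fun x => ⨆ k, D.indicator (u k) x with hv
  have hlim : ∀ x, Tendsto (fun k => D.indicator (u k) x) atTop (𝓝 (v x)) := fun x =>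
    tendsto_atTop_ciSup (humono x) (hbdd x)
  have hvm : Measurable v := Measurable.iSup fun k => hmeas _ (huU k)
  have hv0 : ∀ x ∉ D, v x = 0 := by
    intro x hx
    rw [hv]
    simp [Set.indicator_of_notMem hx]
  have hv1 : ∀ x, -Mc ≤ v x := fun x => (hi1 _ (huU 0) x).trans (le_ciSup (hbdd x) 0)
  have hv2 : ∀ x, v x ≤ 0 := fun x => ciSup_le fun k => hi2 _ (huU k) x
  have hvi : Integrable v := ind_int hb hD hvm hv0 hv1 hv2
  have hcI : Integrable (D.indicator fun _ => Mc) :=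
    (integrable_indicator_iff hD.measurableSet).2 (integrableOn_const hb.measure_lt_top.ne)
  have hbound : ∀ f : E → ℝ, f ∈ 𝒰 → ∀ x, ‖D.indicator f x‖ ≤ D.indicator (fun _ => Mc) x := by
    intro f hf x
    by_cases hx : x ∈ D
    · rw [Set.indicator_of_mem hx (fun _ => Mc), Real.norm_eq_abs, abs_le]
      exact ⟨hi1 f hf x, by linarith [hi1 f hf x, hi2 f hf x]⟩
    · rw [Set.indicator_of_notMem hx, Set.indicator_of_notMem hx, norm_zero]
  have hvS : sSup S ≤ ∫ x, v x := by
    refine le_of_tendsto htlim (Eventually.of_forall fun k => ?_)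
    rw [← hat k]
    refine integral_mono (hint _ (ha k)) hvi fun x => ?_
    refine le_trans ?_ (le_ciSup (hbdd x) k)
    by_cases hx : x ∈ D
    · simp only [Set.indicator_of_mem hx]; exact hau k x
    · simp only [Set.indicator_of_notMem hx]; exact le_rfl
  refine ⟨v, hvm, hv0, hv1, hv2, ?_, ?_, ?_⟩
  · refine ⟨hvi.locallyIntegrable.locallyIntegrableOn D, fun ω w1 w2 w3 w4 => ?_⟩
    have hMi : Integrable (e.M ω) := (e.M_cont w1).integrable_of_hasCompactSupport (e.M_cs w2)
    have hT : Tendsto (fun k => ∫ x, D.indicator (u k) x * e.M ω x) atTop (𝓝 (∫ x, v x * e.M ω x)) := by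
      refine tendsto_integral_of_dominated_convergence (fun x => Mc * ‖e.M ω x‖) ?_ (hMi.norm.const_mul _) ?_ ?_
      · exact fun k => (hmeas _ (huU k)).aestronglyMeasurable.mul hMi.aestronglyMeasurable
      · refine fun k => Eventually.of_forall fun x => ?_
        rw [norm_mul]
        refine mul_le_mul_of_nonneg_right ?_ (norm_nonneg _)
        rw [Real.norm_eq_abs, abs_le]
        exact ⟨hi1 _ (huU k) x, by linarith [hi2 _ (huU k) x]⟩
      · exact Eventually.of_forall fun x => (hlim x).mul_const _
    refine ge_of_tendsto hT (Eventually.of_forall fun k => ?_)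
    refine ((huU k).1.sh.ds.2 ω w1 w2 w3 w4).trans_eq ?_
    refine integral_congr_ae (Eventually.of_forall fun x => ?_)
    show u k x * _ = D.indicator (u k) x * _
    by_cases hx : x ∈ D
    · rw [Set.indicator_of_mem hx]
    · rw [e.M_off (fun h => hx (w3 h)), mul_zero, mul_zero]
  · intro f hf
    have hf' := hmax f hf
    set g : E → ℝ := fun x => Max.max (f x) (-Mc) with hg
    have hT : Tendsto (fun k => ∫ x, D.indicator (fun x => Max.max (g x) (u k x)) x) atTop
        (𝓝 (∫ x, Max.max (D.indicator g x) (v x))) := by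
      refine tendsto_integral_of_dominated_convergence (D.indicator fun _ => Mc) ?_ hcI ?_ ?_
      · exact fun k => (hmeas _ (hmax2 _ hf' _ (huU k))).aestronglyMeasurable
      · exact fun k => Eventually.of_forall fun x => hbound _ (hmax2 _ hf' _ (huU k)) x
      · refine Eventually.of_forall fun x => ?_
        have : (fun k => D.indicator (fun x => Max.max (g x) (u k x)) x) = fun k => Max.max (D.indicator g x) (D.indicator (u k) x) := by
          funext k
          by_cases hx : x ∈ D
          · simp only [Set.indicator_of_mem hx]
          · simp only [Set.indicator_of_notMem hx, max_self]
        rw [this]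
        exact tendsto_const_nhds.max (hlim x)
    have h1 : ∫ x, Max.max (D.indicator g x) (v x) ≤ sSup S := by
      refine le_of_tendsto hT (Eventually.of_forall fun k => ?_)
      exact le_csSup hSb ⟨_, hmax2 _ hf' _ (huU k), rfl⟩
    have hmi : Integrable fun x => Max.max (D.indicator g x) (v x) := (hint _ hf').sup hvi
    have h2 : ∫ x, (Max.max (D.indicator g x) (v x) - v x) = 0 := by
      refine le_antisymm ?_ (integral_nonneg fun x => sub_nonneg.2 (le_max_right _ _))
      rw [integral_sub hmi hvi]
      linarith
    rw [integral_eq_zero_iff_of_nonneg (fun x => sub_nonneg.2 (le_max_right _ _)) (hmi.sub hvi)] at h2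
    filter_upwards [h2] with x hx hxD
    have hx' : Max.max (D.indicator g x) (v x) - v x = 0 := hx
    have h3 : D.indicator g x ≤ v x := by
      have := le_max_left (D.indicator g x) (v x)
      linarith
    rw [Set.indicator_of_mem hxD] at h3
    exact (le_max_left _ _).trans h3
  · intro x hx s h
    refine ciSup_le fun k => ?_
    rw [Set.indicator_of_mem hx]
    exact h _ (huU k).1

/-- distributional inequality implies an a.e. inequality -/
theorem ae_nonpos_of_test {h : E → ℝ} (hh : LocallyIntegrable h) {G : Set E} (hG : IsOpen G)
    (ht : ∀ φ : E → ℝ, Continuous φ → HasCompactSupport φ → tsupport φ ⊆ G → (∀ x, 0 ≤ φ x) → ∫ x, h x * φ x ≤ 0) :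
    ∀ᵐ x, x ∈ G → h x ≤ 0 := by
  let φ : ℕ → ContDiffBump (0 : E) := fun k => ⟨1 / (2 * ((k:ℝ) + 1)), 1 / ((k:ℝ) + 1), by positivity, by
    apply one_div_lt_one_div_of_lt <;> linarith [(Nat.cast_nonneg k : (0:ℝ) ≤ k)]⟩
  have hφ : Tendsto (fun k => (φ k).rOut) atTop (𝓝 0) := tendsto_one_div_add_atTop_nhds_zero_nat
  have hφ2 : ∀ᶠ k in atTop, (φ k).rOut ≤ 2 * (φ k).rIn := by
    refine Eventually.of_forall fun k => ?_
    show 1 / ((k:ℝ) + 1) ≤ 2 * (1 / (2 * ((k:ℝ) + 1)))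
    have : (0:ℝ) < (k:ℝ) + 1 := by positivity
    apply le_of_eq
    field_simp
  filter_upwards [ContDiffBump.ae_convolution_tendsto_right_of_locallyIntegrable (μ := volume) hφ hφ2 hh] with x hx hxG
  obtain ⟨r, hr, hrG⟩ := Metric.isOpen_iff.1 hG x hxG
  refine le_of_tendsto hx ?_
  filter_upwards [hφ.eventually_lt_const (half_pos hr)] with k hk
  rw [MeasureTheory.convolution_eq_swap]
  have hc : Continuous fun t => (φ k).normed volume (x - t) :=
    (φ k).continuous_normed.comp (continuous_const.sub continuous_id)
  have hsup : ∀ t, t ∉ closedBall x (φ k).rOut → (φ k).normed volume (x - t) = 0 := by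
    intro t ht
    have : x - t ∉ Function.support ((φ k).normed volume) := by
      rw [ContDiffBump.support_normed_eq]
      intro h
      apply ht
      rw [mem_ball_zero_iff] at h
      rw [mem_closedBall, dist_comm, dist_eq_norm]
      exact h.le
    simpa using this
  haveI : ProperSpace E := FiniteDimensional.proper ℝ E
  have := ht (fun t => (φ k).normed volume (x - t)) hc
    (HasCompactSupport.intro (isCompact_closedBall x (φ k).rOut) hsup) (by
      refine (closure_minimal ?_ isClosed_closedBall).trans ((closedBall_subset_ball (by linarith)).trans hrG)
      intro t ht
      by_contra h
      exact ht (hsup t h)) fun t => (φ k).nonneg_normed _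
  refine le_trans (le_of_eq ?_) this
  refine integral_congr_ae (Eventually.of_forall fun t => ?_)
  show _ = h t * _
  simp [mul_comm]

end Env

end Part17

section Part18
set_option linter.unusedSectionVars false
set_option linter.style.haveILetI false
set_option synthInstance.maxHeartbeats 400000
set_option maxSynthPendingDepth 3

section EnvCont
variable {E : Type*} [NormedAddCommGroup E] [NormedSpace ℝ E] [FiniteDimensional ℝ E]
  [MeasureSpace E] [BorelSpace E] [(volume : Measure E).IsAddHaarMeasure]
variable {m : ℕ} {e : Ell E m}

theorem dsub_corr {D G : Set E} (hs : e.SA D) (hGD : G ⊆ D) {u p : E → ℝ} (hu : Continuous u) {t κ : ℝ} (ht : 0 ≤ t)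
    (hp : ContDiff ℝ 2 p) (hp1 : ∀ x ∈ D, 1 ≤ e.M p x)
    (hb : ∀ ω : E → ℝ, ContDiff ℝ 2 ω → (∀ x, 0 ≤ ω x) → HasCompactSupport ω → tsupport ω ⊆ G →
        - (t * (∫ x, ω x)) ≤ ∫ x, u x * e.M ω x) : e.DSub G (fun x => u x + (t * p x - κ)) := by
  have hq : ContDiff ℝ 2 fun x => t * p x - κ := (contDiff_const.mul hp).sub contDiff_const
  have hcont : Continuous fun x => u x + (t * p x - κ) := hu.add hq.continuous
  refine ⟨hcont.locallyIntegrable.locallyIntegrableOn G, fun ω h1 h2 h3 h4 => ?_⟩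
  have hMc := e.M_cont h1
  have hMs := e.M_cs h2
  have i1 : Integrable fun x => u x * e.M ω x := (hu.mul hMc).integrable_of_hasCompactSupport hMs.mul_left
  have i2 : Integrable fun x => (t * p x - κ) * e.M ω x :=
    (hq.continuous.mul hMc).integrable_of_hasCompactSupport hMs.mul_left
  have e1 : ∫ x, (u x + (t * p x - κ)) * e.M ω x = (∫ x, u x * e.M ω x) + ∫ x, (t * p x - κ) * e.M ω x := by
    rw [← integral_add i1 i2]
    congr 1; ext x; ring
  rw [e1, hs _ _ hq h1 h2 (h3.trans hGD)]
  have e2 : t * (∫ x, ω x) ≤ ∫ x, ω x * e.M (fun x => t * p x - κ) x := by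
    rw [← integral_const_mul]
    refine integral_mono ((h1.continuous.integrable_of_hasCompactSupport h2).const_mul t)
      ((h1.continuous.mul (e.M_cont hq)).integrable_of_hasCompactSupport h2.mul_right) fun x => ?_
    by_cases hx : x ∈ tsupport ω
    · have hM : e.M (fun x => t * p x - κ) x = t * e.M p x := by
        rw [e.M_sub (contDiff_const.mul hp) contDiff_const, e.M_smul hp, e.M_const, sub_zero]
      have q1 := hp1 x (hGD (h3 hx))
      have q2 : t * ω x * 1 ≤ t * ω x * e.M p x := mul_le_mul_of_nonneg_left q1 (mul_nonneg ht (h4 x))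
      show t * ω x ≤ ω x * e.M (fun x => t * p x - κ) x
      rw [hM]; linarith
    · simp [image_eq_zero_of_notMem_tsupport hx]
  linarith [hb ω h1 h4 h2 h3]

theorem glue_uc {K D G K2 : Set E} {ψ w g : E → ℝ} (hD : IsOpen D) (hG : IsOpen G) (hGD : G ⊆ D) (hK2 : IsCompact K2)
    (hK2G : K2 ⊆ G) (hw : Continuous w) (hwd : e.DSub G w) {κ : ℝ} (hκ : 0 < κ) (hwk : ∀ x ∈ G, w x ≤ -κ)
    (hwψ : ∀ x ∈ K, w x ≤ ψ x) (hg : SH e D g) (hg0 : ∀ x ∈ D, g x < 0) (hgψ : ∀ x ∈ K, g x ≤ ψ x)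
    (hgk : ∀ x ∈ D, x ∉ K2 → -κ < g x) : ∃ W, UC e K D ψ W ∧ ∀ x ∈ G, w x ≤ W x := by
  classical
  set W : E → ℝ := fun x => if x ∈ G then Max.max (w x) (g x) else g x with hW
  have hWG : ∀ x ∈ G, Max.max (w x) (g x) = W x := fun x hx => by simp [hW, hx]
  have s1 : SH e G W := by
    refine SH.congr_on hG (SH.max hG (SH.of_cont hw hwd) (hg.mono hGD) (fun x hx => (hwk x hx).trans (by linarith))
      fun x hx => (hg0 x (hGD hx)).le) hWG
  have hDK : IsOpen (D \ K2) := hD.sdiff hK2.isClosed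
  have s2 : SH e (D \ K2) W := by
    refine SH.congr_on hDK (hg.mono Set.sdiff_subset) fun x hx => ?_
    by_cases h : x ∈ G
    · rw [← hWG x h]
      exact (max_eq_right ((hwk x h).trans (hgk x hx.1 hx.2).le)).symm
    · simp [hW, h]
  have hun : G ∪ (D \ K2) = D := by
    ext x; constructor
    · rintro (h | h)
      exacts [hGD h, h.1]
    · intro h
      by_cases h2 : x ∈ K2
      exacts [Or.inl (hK2G h2), Or.inr ⟨h, h2⟩]
  refine ⟨W, ⟨hun ▸ SH.union hG hDK s1 s2, fun x hx => ?_, fun x hx => ?_⟩, fun x hx => ?_⟩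
  · simp only [hW]; split_ifs
    · exact max_le (hwψ x hx) (hgψ x hx)
    · exact hgψ x hx
  · simp only [hW]; split_ifs with h
    · exact max_lt ((hwk x h).trans_lt (by linarith)) (hg0 x hx)
    · exact hg0 x hx
  · rw [← hWG x hx]; exact le_max_left _ _

theorem upper_ae {G : Set E} (hG : IsOpen G) {v u : E → ℝ} (hv : Integrable v) (hu : Continuous u) {t : ℝ}
    (ha : ∀ φ : E → ℝ, Continuous φ → (∀ x, 0 ≤ φ x) → HasCompactSupport φ → tsupport φ ⊆ G →
        (∫ x, v x * φ x) - t * (∫ x, φ x) ≤ ∫ x, u x * φ x) : ∀ᵐ x, x ∈ G → v x ≤ u x + t := by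
  have huc : Continuous fun x => u x + t := hu.add continuous_const
  have := ae_nonpos_of_test (h := fun x => v x - (u x + t)) (hv.locallyIntegrable.sub huc.locallyIntegrable) hG
    (fun φ h1 h2 h3 h4 => by
      have i1 : Integrable fun x => v x * φ x :=
        int_cs (Ω := Set.univ) (hv.locallyIntegrable.locallyIntegrableOn _) h2 (Set.subset_univ _) h1
          (fun x hx => image_eq_zero_of_notMem_tsupport hx)
      have i2 : Integrable fun x => u x * φ x := (hu.mul h1).integrable_of_hasCompactSupport h2.mul_left
      have i3 : Integrable fun x => t * φ x := (h1.integrable_of_hasCompactSupport h2).const_mul t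
      have i12 : Integrable (fun x => v x * φ x - u x * φ x) := i1.sub i2
      have e1 : ∫ x, (v x - (u x + t)) * φ x = (∫ x, v x * φ x) - (∫ x, u x * φ x) - t * ∫ x, φ x := by
        rw [← integral_const_mul, ← integral_sub i1 i2,
          ← integral_sub i12 i3]
        congr 1; ext x; ring
      have := ha φ h1 h4 h2 h3
      linarith)
  filter_upwards [this] with x hx hxG
  linarith [hx hxG]

theorem small_ev {e : Ell E m} {a b : ℝ} (hb : 0 < b) : ∀ᶠ lam in atTop, a * e.J lam ≤ b := by
  have := (e.J_tendsto.const_mul a)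
  rw [mul_zero] at this
  exact (this.eventually_lt_const hb).mono fun _ h => h.le

theorem env_cont {D K : Set E} {ψ ρ ω p : E → ℝ} {Mc c Bp : ℝ} (hD : IsOpen D) (hb : Bornology.IsBounded D) (hs : e.SA D)
    (hp : ContDiff ℝ 2 p) (hp0 : ∀ x ∈ D, p x ≤ 0) (hp1 : ∀ x ∈ D, 1 ≤ e.M p x) (hp2 : ∀ x ∈ D, e.M p x ≤ Bp) (hB : 0 ≤ Bp)
    (hK : IsCompact K) (hKD : K ⊆ D) (hψ : ContinuousOn ψ K) (hMc : 0 < Mc) (hψl : ∀ x ∈ K, -Mc ≤ ψ x) (hc : c < 0)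
    (hψc : ∀ x ∈ K, ψ x ≤ c) (hρ : SH e D ρ) (hρ0 : ∀ x ∈ D, ρ x < 0)
    (hρb : ∀ η < 0, ∃ K2 ⊆ D, IsCompact K2 ∧ ∀ x ∈ D, x ∉ K2 → η < ρ x)
    (h1 : ∀ u, UC e K D ψ u → ∀ x ∈ D, u x ≤ ω x)
    (h2 : ∀ x ∈ D, ∀ s, (∀ u, UC e K D ψ u → u x ≤ s) → ω x ≤ s)
    (h3 : ∀ z ∈ K, ∀ a, ψ z < a → ∀ᶠ x in 𝓝 z, ω x < a) : ContinuousOn ω D := by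
  haveI : ProperSpace E := FiniteDimensional.proper ℝ E
  obtain ⟨v, vm, v0, lb, ub, hv, -, vle⟩ := exists_env hD hb hs hKD hMc hψl
  obtain ⟨v', vm', v0', lb', ub', hv', vae', vle'⟩ := exists_env hD hb hs hKD hMc hψl
  clear vm v0 lb ub hv vle v
  -- a uniform bound of `ρ` on `K`
  have hη : ∃ η > 0, ∀ x ∈ K, ρ x ≤ -η := by
    refine hK.induction_on (p := fun S => ∃ η > 0, ∀ x ∈ S, ρ x ≤ -η) ⟨1, one_pos, by simp⟩ ?_ ?_ ?_
    · rintro s t hst ⟨η, h, h'⟩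
      exact ⟨η, h, fun x hx => h' x (hst hx)⟩
    · rintro s t ⟨η, h, h'⟩ ⟨θ, g, g'⟩
      refine ⟨min η θ, lt_min h g, fun x hx => ?_⟩
      rcases hx with hx | hx
      · have := h' x hx; linarith [min_le_left η θ]
      · have := g' x hx; linarith [min_le_right η θ]
    · intro x hx
      have hx0 := hρ0 x (hKD hx)
      refine ⟨_, mem_nhdsWithin_of_mem_nhds (hρ.usc x (hKD hx) (ρ x / 2) (by linarith)), -(ρ x / 2), by linarith, fun y hy => ?_⟩
      have hh : ρ y < ρ x / 2 := hy
      linarith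
  obtain ⟨η, hη0, hηK⟩ := hη
  intro z₀ hz₀
  refine ContinuousAt.continuousWithinAt ?_
  rw [Metric.continuousAt_iff']
  intro ε hε
  obtain ⟨δ, hδ0, hδε, hδc⟩ : ∃ δ > 0, 10 * δ ≤ ε ∧ δ ≤ -c :=
    ⟨min (ε / 10) (-c), lt_min (by linarith) (by linarith), by linarith [min_le_left (ε / 10) (-c)], min_le_right _ _⟩
  set C1 := Mc / η with hC1
  have hC1p : 0 < C1 := div_pos hMc hη0
  obtain ⟨K2, hK2D, hK2, hK2ρ⟩ := hρb (-(3 * δ) / C1) (div_neg_of_neg_of_pos (by linarith) hC1p)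
  have hK3 : IsCompact (K2 ∪ K ∪ {z₀}) := (hK2.union hK).union isCompact_singleton
  obtain ⟨K1, hK1, hK31, hK1D⟩ := exists_compact_between hK3 hD
    (Set.union_subset (Set.union_subset hK2D hKD) (Set.singleton_subset_iff.2 hz₀))
  set G := interior K1 with hGd
  have hGo : IsOpen G := isOpen_interior
  have hGK1 : G ⊆ K1 := interior_subset
  have hGD : G ⊆ D := hGK1.trans hK1D
  have hK2G : K2 ⊆ G := fun x hx => hK31 (Or.inl (Or.inl hx))
  have hKG : K ⊆ G := fun x hx => hK31 (Or.inl (Or.inr hx))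
  have hzG : z₀ ∈ G := hK31 (Or.inr rfl)
  obtain ⟨C, hC0, hT⟩ := Ell.T2 hD hs hMc.le vm' v0' lb' ub' hv' hp hp0 hp1 hp2 hB hK1 hK1D
  choose! u uc un ua ub2 ucc using hT
  -- upper bound on `K`
  have hKev : ∀ᶠ lam in atTop, ∀ y ∈ K, u lam y ≤ ψ y + 3 * δ := by
    have := hK.induction_on (p := fun S => ∀ᶠ lam in atTop, ∀ y ∈ S, y ∈ K → u lam y ≤ ψ y + 3 * δ) (by simp) ?_ ?_ ?_
    · filter_upwards [this] with lam h y hy using h y hy hy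
    · intro s t hst h
      filter_upwards [h] with lam h y hy using h y (hst hy)
    · intro s t hs ht
      filter_upwards [hs, ht] with lam h h' y hy hyK
      rcases hy with hy | hy
      exacts [h y hy hyK, h' y hy hyK]
    · intro z hz
      have o1 : ∀ᶠ x in 𝓝 z, ω x < ψ z + δ ∧ x ∈ G := (h3 z hz _ (by linarith)).and (hGo.mem_nhds (hKG hz))
      obtain ⟨O, hO, hOo, hzO⟩ := _root_.eventually_nhds_iff.1 o1
      obtain ⟨θ, a1, a2, a3, a4, a5, a6⟩ := exists_cut (isCompact_singleton (x := z)) hOo (Set.singleton_subset_iff.2 hzO)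
      obtain ⟨C0, hC00, hMθ⟩ := e.M_bdd (smooth2 a1) a2
      have n1 : interior {x | θ x = 1} ∈ 𝓝[K] z := mem_nhdsWithin_of_mem_nhds (isOpen_interior.mem_nhds (a6 rfl))
      have n2 : {y | ψ z - δ < ψ y} ∈ 𝓝[K] z := (hψ z hz).eventually (lt_mem_nhds (by linarith))
      refine ⟨_, inter_mem n1 n2, ?_⟩
      filter_upwards [e.good_ev, small_ev (e := e) (a := 2 * C0 * Mc) hδ0] with lam hl hsm y hy hyK
      have hyψ : ψ z - δ < ψ y := hy.2
      have := ucc lam hl θ C0 (ψ z + δ) (smooth2 a1) a2 (fun x hx => hGK1 (hO x (a3 hx)).2) a4 a5 hMθ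
        (by linarith [hψc z hz]) (fun x hx => by
          have hxO := hO x (a3 (subset_tsupport θ hx))
          exact vle' x (hGD hxO.2) _ fun w hw => (h1 w hw x (hGD hxO.2)).trans hxO.1.le) y hy.1
      have hJ := e.J_nonneg lam
      have q := mul_nonneg (mul_nonneg hC00 hJ) (show 0 ≤ ψ z + δ + Mc by linarith [hψl z hz])
      nlinarith
  obtain ⟨Pb, hPb⟩ : ∃ Pb : ℝ, ∀ x ∈ K1, -Pb ≤ p x := by
    obtain ⟨Q, hQ⟩ := hK1.exists_bound_of_continuousOn hp.continuous.continuousOn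
    exact ⟨Q, fun x hx => (abs_le.1 (hQ x hx)).1⟩
  obtain ⟨lam, hl, hlK, hl1, hl2⟩ := (e.good_ev.and (hKev.and ((small_ev (e := e) (a := C) hδ0).and
    (small_ev (e := e) (a := C * Pb) hδ0)))).exists
  have ht0 : 0 ≤ C * e.J lam := mul_nonneg hC0 (e.J_nonneg lam)
  set t := C * e.J lam with htd
  have up : ∀ x ∈ G, ω x ≤ u lam x + t := by
    have iv : Integrable v' := ind_int hb hD vm' v0' lb' ub'
    have ae1 := upper_ae hGo iv (uc lam hl) (t := t)
      (fun φ b1 b2 b3 b4 => ua lam hl φ b1 b2 b3 (b4.trans hGK1))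
    intro x hx
    refine h2 x (hGD hx) _ fun w hw => ?_
    refine hw.sh.le_of_ae hD hGo hGD (f := fun x => u lam x + t) ((uc lam hl).add continuous_const) ?_ x hx
    filter_upwards [ae1, vae' w hw] with y q1 q2 hy
    exact (q2 (hGD hy)).trans (q1 hy)
  have low : ∀ x ∈ G, u lam x - 4 * δ ≤ ω x := by
    have hd := dsub_corr (κ := 3 * δ) hs hGD (uc lam hl) ht0 hp hp1
      (fun ω b1 b2 b3 b4 => ub2 lam hl ω b1 b2 b3 (b4.trans hGK1))
    have hle : ∀ x ∈ G, t * p x ≤ 0 := fun x hx => mul_nonpos_of_nonneg_of_nonpos ht0 (hp0 x (hGD hx))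
    obtain ⟨W, hW, hwW⟩ := glue_uc (K := K) (ψ := ψ) (w := fun x => u lam x + (t * p x - 3 * δ)) (g := fun x => C1 * ρ x) (κ := 3 * δ) hD hGo hGD hK2 hK2G
      ((uc lam hl).add ((continuous_const.mul hp.continuous).sub continuous_const)) hd (by linarith)
      (fun x hx => by have := hle x hx; have := un lam hl x; show u lam x + (t * p x - 3 * δ) ≤ _; linarith)
      (fun x hx => by have := hle x (hKG hx); have := hlK x hx; show u lam x + (t * p x - 3 * δ) ≤ _; linarith)
      (hρ.cmul hC1p) (fun x hx => mul_neg_of_pos_of_neg hC1p (hρ0 x hx))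
      (fun x hx => by
        have q := mul_le_mul_of_nonneg_left (hηK x hx) hC1p.le
        have q2 : C1 * η = Mc := by rw [hC1]; field_simp
        have := hψl x hx
        show C1 * ρ x ≤ ψ x
        linarith)
      (fun x hx hx2 => by
        have q := hK2ρ x hx hx2
        rw [div_lt_iff₀ hC1p] at q
        show -(3 * δ) < C1 * ρ x
        linarith)
    intro x hx
    have q1 := (hwW x hx).trans (h1 W hW x (hGD hx))
    have q2 := mul_le_mul_of_nonneg_left (hPb x (hGK1 hx)) ht0
    have q3 : C * Pb * e.J lam = t * Pb := by rw [htd]; ring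
    have q1' : u lam x + (t * p x - 3 * δ) ≤ ω x := q1
    linarith
  have hcu := Metric.continuousAt_iff'.1 ((uc lam hl).continuousAt (x := z₀)) δ hδ0
  filter_upwards [hcu, hGo.mem_nhds hzG] with x hx hxG
  rw [Real.dist_eq, abs_lt] at hx ⊢
  have r1 := up x hxG
  have r2 := low x hxG
  have r3 := up z₀ hzG
  have r4 := low z₀ hzG
  constructor <;> linarith [hx.1, hx.2]

end EnvCont

end Part18

section Part19
set_option linter.unusedSectionVars false
set_option linter.style.haveILetI false
set_option synthInstance.maxHeartbeats 400000
set_option maxSynthPendingDepth 3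

theorem exhaust_of_boundary {n : ℕ} {D : Set (Cn n)} (hD : IsOpen D) (hb : Bornology.IsBounded D) {ρ : Cn n → ℝ}
    (h : ∀ ζ ∈ frontier D, Tendsto ρ (𝓝[D] ζ) (𝓝 0)) {η : ℝ} (hη : η < 0) :
    ∃ K2 ⊆ D, IsCompact K2 ∧ ∀ x ∈ D, x ∉ K2 → η < ρ x := by
  have hO : IsOpen {z | ∀ᶠ x in 𝓝 z, x ∈ D → η < ρ x} := isOpen_setOf_eventually_nhds
  refine ⟨closure D \ {z | ∀ᶠ x in 𝓝 z, x ∈ D → η < ρ x}, fun x hx => ?_, hb.isCompact_closure.diff hO, fun x hx hx2 => ?_⟩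
  · by_contra hxD
    refine hx.2 ?_
    have hf : x ∈ frontier D := by rw [hD.frontier_eq]; exact ⟨hx.1, hxD⟩
    exact eventually_nhdsWithin_iff.1 ((h x hf).eventually (lt_mem_nhds hη))
  · by_contra hlt
    refine hx2 ⟨subset_closure hx, fun hh => hlt ?_⟩
    have hh' : ∀ᶠ y in 𝓝 x, y ∈ D → η < ρ y := hh
    exact hh'.self_of_nhds hx

end Part19

/-- For a bounded `α`-regular domain `D`, a compact `K ⊆ D` and a
bounded weight `ψ` on `K` with `sup_K ψ < 0` admitting a negative `α`-subharmonic
extension to `D`, the function `z ↦ ω_α(z,K,D,ψ)` is continuous on `D` iff `ψ` is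
continuous on `K` and `K` is an `(α,ψ)`-regular compact set. -/
theorem weighted_measure_continuous_iff {n : ℕ} (A : AlphaForm n) (D K : Set (Cn n))
    (hD : IsAlphaRegularDomain A D) (hK : IsCompact K) (hKD : K ⊆ D)
    (ψ : Cn n → ℝ) (hbd : ∃ M : ℝ, ∀ z ∈ K, |ψ z| ≤ M)
    (hsup : ∃ c < (0 : ℝ), ∀ z ∈ K, ψ z ≤ c)
    (hext : ∃ ψt : Cn n → ℝ, IsAlphaSubharmonic A D ψt ∧ (∀ z ∈ D, ψt z < 0) ∧
      ∀ z ∈ K, ψt z = ψ z) :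
    ContinuousOn (omegaW A K D ψ) D ↔
      (ContinuousOn ψ K ∧ ∀ z₀ ∈ K, omegaWStar A K D ψ z₀ = ψ z₀) := by
  obtain ⟨hDo, -, hDb, ρ, hρ, hρ0, hρb⟩ := hD
  obtain ⟨M, hM⟩ := hbd
  obtain ⟨c, hc, hψc⟩ := hsup
  obtain ⟨ψt, t1, t2, t3⟩ := hext
  have tU : ψt ∈ Uclass A K D ψ := ⟨t1, fun z hz => (t3 z hz).le, t2⟩
  have hbdd : ∀ z ∈ D, BddAbove ((fun u : Cn n → ℝ => u z) '' Uclass A K D ψ) := fun z hz =>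
    ⟨0, by rintro _ ⟨u, hu, rfl⟩; exact (hu.2.2 z hz).le⟩
  have h1 : ∀ u ∈ Uclass A K D ψ, ∀ x ∈ D, u x ≤ omegaW A K D ψ x := fun u hu x hx =>
    le_csSup (hbdd x hx) ⟨u, hu, rfl⟩
  have h2 : ∀ x, ∀ s, (∀ u ∈ Uclass A K D ψ, u x ≤ s) → omegaW A K D ψ x ≤ s := fun x s h =>
    csSup_le ⟨_, ψt, tU, rfl⟩ (by rintro _ ⟨u, hu, rfl⟩; exact h u hu)
  have hω0 : ∀ x ∈ D, omegaW A K D ψ x ≤ 0 := fun x hx => h2 x 0 fun u hu => (hu.2.2 x hx).le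
  have hωK : ∀ z ∈ K, omegaW A K D ψ z = ψ z := fun z hz =>
    le_antisymm (h2 z _ fun u hu => hu.2.1 z hz) (by rw [← t3 z hz]; exact h1 ψt tU z (hKD hz))
  constructor
  · intro hcont
    refine ⟨(hcont.mono hKD).congr fun z hz => (hωK z hz).symm, fun z hz => ?_⟩
    have hat : ContinuousAt (omegaW A K D ψ) z := hcont.continuousAt (hDo.mem_nhds (hKD hz))
    rw [← hωK z hz]
    exact Tendsto.limsup_eq hat
  · rintro ⟨hψ, hreg⟩
    rcases Nat.eq_zero_or_pos n with rfl | hn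
    · haveI : Subsingleton (Cn 0) := by unfold Cn; infer_instance
      intro z _
      exact continuous_of_const (fun x y => by rw [Subsingleton.elim x y]) |>.continuousWithinAt
    obtain ⟨e, he⟩ := exists_ell A hDb
    obtain ⟨p, Bp, hB, hp, hp0, hp1, hp2⟩ := exists_p hn A hDb he
    have hU : ∀ u, UC e K D ψ u ↔ u ∈ Uclass A K D ψ := fun u =>
      ⟨fun h => ⟨(sh_iff A hDo he u).2 h.sh, h.le, h.neg⟩, fun h => ⟨(sh_iff A hDo he u).1 h.1, h.2.1, h.2.2⟩⟩
    refine env_cont (e := e) (ρ := ρ) (Mc := Max.max M 1) hDo hDb (ell_SA A he) hp hp0 hp1 hp2 hB hK hKD hψ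
      (lt_of_lt_of_le one_pos (le_max_right _ _)) (fun x hx => ?_) hc hψc ((sh_iff A hDo he ρ).1 hρ) hρ0
      (fun η hη => exhaust_of_boundary hDo hDb hρb hη) (fun u hu => h1 u ((hU u).1 hu))
      (fun x _ s h => h2 x s fun u hu => h u ((hU u).2 hu)) (fun z hz a ha => ?_)
    · have q1 := (abs_le.1 (hM x hx)).1
      have q2 := le_max_left M 1
      linarith
    · refine eventually_lt_of_limsup_lt (f := 𝓝 z) (u := omegaW A K D ψ) ?_ ⟨0, ?_⟩
      · have := hreg z hz
        unfold omegaWStar at this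
        rw [this]; exact ha
      · rw [eventually_map]
        filter_upwards [hDo.mem_nhds (hKD hz)] with x hx using hω0 x hx
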